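/- Let n ≥ 1. Let Ψ be a nonzero vector in (ℂ²)^⊗(2n) satisfying H^{tw}_{2n}Ψ = E₀Ψ, where H^{tw}_{2n} is the twisted-periodic XXZ Hamiltonian at Δ = −1/2 with twist 2π/3 and E₀ is the smallest eigenvalue of H^{tw}_{2n}, and satisfying SᶻΨ = 0. Then the pseudo emptiness formation probability satisfies Ẽ(n) = (−e^{2πi/3})^n · Aₙ^{−2}, where Aₙ = Π_{j=0}^{n−1} (3j+1)!/(n+j)! is the number of Alternating Sign Matrices of size n. -/

import Mathlib

noncomputable section

/-- Spin configurations of a chain of length `N`; `true` = spin up `↑`. -/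
abbrev Cfg (N : ℕ) := Fin N → Bool

/-- Pauli matrix `σ^x` in the basis `(↑,↓)`. -/
def sigmaX : Matrix Bool Bool ℂ := Matrix.of fun b c => if b = c then 0 else 1

/-- Pauli matrix `σ^y` in the basis `(↑,↓)`. -/
def sigmaY : Matrix Bool Bool ℂ :=
  Matrix.of fun b c => if b = c then 0 else if b then -Complex.I else Complex.I

/-- Pauli matrix `σ^z` in the basis `(↑,↓)`. -/
def sigmaZ : Matrix Bool Bool ℂ :=
  Matrix.of fun b c => if b = c then (if b then 1 else -1) else 0

/-- `σ⁺ = σ^x + i σ^y`. -/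
def sigmaP : Matrix Bool Bool ℂ := sigmaX + Complex.I • sigmaY

/-- `σ⁻ = σ^x − i σ^y`. -/
def sigmaM : Matrix Bool Bool ℂ := sigmaX - Complex.I • sigmaY

/-- A one-site operator `A` acting on the `i`-th tensor factor of `(ℂ²)^{⊗N}`. -/
def localOp (N : ℕ) (i : Fin N) (A : Matrix Bool Bool ℂ) : Matrix (Cfg N) (Cfg N) ℂ :=
  Matrix.of fun f g =>
    A (f i) (g i) * ∏ j ∈ Finset.univ.erase i, (if f j = g j then (1 : ℂ) else 0)

/-- The cyclic successor `i+1` of a site index (mod `N`). -/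
def cyc (N : ℕ) (i : Fin N) : Fin N :=
  ⟨(i.val + 1) % N, Nat.mod_lt _ (by have := i.isLt; omega)⟩

/-- Periodic XXZ Hamiltonian at `Δ = −1/2`:
`H_N = −(1/2)·Σ_{i=1}^{N} (σ^x_i σ^x_{i+1} + σ^y_i σ^y_{i+1} − (1/2) σ^z_i σ^z_{i+1})`,
site indices mod `N`. -/
def Hper (N : ℕ) : Matrix (Cfg N) (Cfg N) ℂ :=
  (-(1/2) : ℂ) • ∑ i : Fin N,
    (localOp N i sigmaX * localOp N (cyc N i) sigmaX
      + localOp N i sigmaY * localOp N (cyc N i) sigmaY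
      - (1/2 : ℂ) • (localOp N i sigmaZ * localOp N (cyc N i) sigmaZ))

/-- Total spin `Sᶻ = (1/2)·Σ_i σ^z_i`. -/
def Sz (N : ℕ) : Matrix (Cfg N) (Cfg N) ℂ := (1/2 : ℂ) • ∑ i : Fin N, localOp N i sigmaZ

/-- Projector onto spin up at site `i`: `p_i⁺ = (1 + σ^z_i)/2`. -/
def pUp (N : ℕ) (i : Fin N) : Matrix (Cfg N) (Cfg N) ℂ := (1/2 : ℂ) • (1 + localOp N i sigmaZ)

/-- The product `Π_{i=1}^{k} p_i⁺` of projectors onto spin up at the first `k` sites. -/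
def projProd (N k : ℕ) : Matrix (Cfg N) (Cfg N) ℂ :=
  (((List.finRange N).filter fun i : Fin N => decide (i.val < k)).map (pUp N)).prod

/-- Standard Hermitian inner product on `(ℂ²)^{⊗N}`. -/
def hermInner {N : ℕ} (v w : Cfg N → ℂ) : ℂ := ∑ f, (starRingEnd ℂ) (v f) * w f

/-- Emptiness formation probability `E(k) = ⟨Ψ, Π_{i=1}^k p_i⁺ Ψ⟩ / ⟨Ψ, Ψ⟩`. -/
def EFP {N : ℕ} (Ψ : Cfg N → ℂ) (k : ℕ) : ℂ :=
  hermInner Ψ ((projProd N k).mulVec Ψ) / hermInner Ψ Ψ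

/-- `ω = e^{2πi/3}`. -/
def omega3 : ℂ := Complex.exp (2 * Real.pi * Complex.I / 3)

/-- Twisted-periodic XXZ Hamiltonian at `Δ = −1/2` with twist `2π/3`:
`H^{tw}_N = −(1/2)·[ Σ_{i=1}^{N−1} (σ^x_i σ^x_{i+1} + σ^y_i σ^y_{i+1} − (1/2) σ^z_i σ^z_{i+1})
  + (1/2)(e^{2πi/3} σ⁺_N σ⁻_1 + e^{−2πi/3} σ⁻_N σ⁺_1) − (1/2) σ^z_N σ^z_1 ]`. -/
def Htw (N : ℕ) (hN : 0 < N) : Matrix (Cfg N) (Cfg N) ℂ :=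
  (-(1/2) : ℂ) • (
    (∑ i : Fin (N-1),
      (localOp N ⟨i.val, by have := i.isLt; omega⟩ sigmaX *
          localOp N ⟨i.val+1, by have := i.isLt; omega⟩ sigmaX
        + localOp N ⟨i.val, by have := i.isLt; omega⟩ sigmaY *
            localOp N ⟨i.val+1, by have := i.isLt; omega⟩ sigmaY
        - (1/2 : ℂ) • (localOp N ⟨i.val, by have := i.isLt; omega⟩ sigmaZ *
            localOp N ⟨i.val+1, by have := i.isLt; omega⟩ sigmaZ)))
    + (1/2 : ℂ) • (omega3 • (localOp N ⟨N-1, by omega⟩ sigmaP * localOp N ⟨0, hN⟩ sigmaM)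
        + (Complex.exp (-(2 * Real.pi * Complex.I / 3))) •
            (localOp N ⟨N-1, by omega⟩ sigmaM * localOp N ⟨0, hN⟩ sigmaP))
    - (1/2 : ℂ) • (localOp N ⟨N-1, by omega⟩ sigmaZ * localOp N ⟨0, hN⟩ sigmaZ))

/-- The symmetric bilinear form `(v,w) = Σ_a v_a w_a` (no complex conjugation). -/
def bilin {N : ℕ} (v w : Cfg N → ℂ) : ℂ := ∑ f, v f * w f

/-- Pseudo emptiness formation probability `Ẽ(k) = (Ψ, Π_{i=1}^k p_i⁺ Ψ) / (Ψ, Ψ)`. -/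
def pseudoEFP {N : ℕ} (Ψ : Cfg N → ℂ) (k : ℕ) : ℂ :=
  bilin Ψ ((projProd N k).mulVec Ψ) / bilin Ψ Ψ

/-! ### Constants -/

theorem omega3_sq_add : omega3 ^ 2 + omega3 + 1 = 0 := by
  have h : IsPrimitiveRoot omega3 3 := by
    have := Complex.isPrimitiveRoot_exp 3 (by norm_num)
    simpa [omega3] using this
  have := h.geom_sum_eq_zero (by norm_num)
  simp [Finset.sum_range_succ] at this
  linear_combination this

theorem omega3_cube : omega3 ^ 3 = 1 := by linear_combination (omega3 - 1) * omega3_sq_add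

theorem omega3_ne_zero : omega3 ≠ 0 := Complex.exp_ne_zero _

theorem omega3_ne_one : omega3 ≠ 1 := by
  intro h
  have := omega3_sq_add
  rw [h] at this
  norm_num at this

theorem norm_omega3 : ‖omega3‖ = 1 :=
  Complex.norm_eq_one_of_pow_eq_one omega3_cube (by norm_num)

theorem conj_omega3 : (starRingEnd ℂ) omega3 = omega3 ^ 2 := by
  have h : omega3 * (starRingEnd ℂ) omega3 = 1 := by
    rw [Complex.mul_conj, Complex.normSq_eq_norm_sq, norm_omega3]; norm_num
  apply mul_left_cancel₀ omega3_ne_zero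
  rw [h, ← omega3_cube]; ring

/-- Weight of the cup `↑↓`. -/
def cupA : ℂ := Complex.I * omega3 ^ 2

/-- Weight of the cup `↓↑`. -/
def cupB : ℂ := -(Complex.I * omega3)

theorem cupA_sq : cupA ^ 2 = -omega3 := by
  simp only [cupA, mul_pow, Complex.I_sq]
  linear_combination -omega3 * omega3_cube

theorem cupB_sq : cupB ^ 2 = -omega3 ^ 2 := by
  simp only [cupB, neg_sq, mul_pow, Complex.I_sq]; ring

theorem cupA_mul_cupB : cupA * cupB = 1 := by
  have h := Complex.I_sq
  simp only [cupA, cupB]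
  linear_combination -omega3 ^ 3 * h + omega3_cube

theorem cupA_pow_twelve : cupA ^ 12 = 1 := by
  rw [show cupA ^ 12 = (cupA ^ 2) ^ 6 by ring, cupA_sq]
  linear_combination (omega3 ^ 3 + 1) * omega3_cube

theorem cupB_pow_twelve : cupB ^ 12 = 1 := by
  rw [show cupB ^ 12 = (cupB ^ 2) ^ 6 by ring, cupB_sq]
  linear_combination (omega3 ^ 9 + omega3 ^ 6 + omega3 ^ 3 + 1) * omega3_cube

/-! ### Operators on functions of lists of spins -/

/-- Vectors of chains of arbitrary length. -/
abbrev LVec := List Bool → ℂ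

/-- The cup state on two sites. -/
def cup : Bool → Bool → ℂ
  | true, false => cupA
  | false, true => cupB
  | _, _ => 0

/-- Insertion of a cup at positions `i`, `i+1`. -/
def ins : ℕ → LVec → LVec
  | 0, v, x :: y :: l => cup x y * v l
  | i + 1, v, x :: l => ins i (fun t => v (x :: t)) l
  | _, _, _ => 0

/-- Contraction with a cup at positions `i`, `i+1`. -/
def con : ℕ → LVec → LVec
  | 0, v, l => cupA * v (true :: false :: l) + cupB * v (false :: true :: l)
  | i + 1, v, x :: l => con i (fun t => v (x :: t)) l
  | _ + 1, _, [] => 0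

/-- Temperley–Lieb generator. -/
def gen (i : ℕ) (v : LVec) : LVec := ins i (con i v)

/-- Twist phase. -/
def ph : Bool → ℂ
  | true => -omega3
  | false => -omega3 ^ 2

/-- Twisted rotation. -/
def rot (v : LVec) : LVec
  | [] => v []
  | x :: t => ph x * v (t ++ [x])

/-- The inverse of the twisted rotation. -/
def unrot (v : LVec) (l : List Bool) : ℂ :=
  if h : l = [] then v [] else (ph (l.getLast h))⁻¹ * v (l.getLast h :: l.dropLast)

/-- `v` is supported on lists of length `N`. -/
def Supp (N : ℕ) (v : LVec) : Prop := ∀ l : List Bool, l.length ≠ N → v l = 0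

theorem ph_ne_zero (x : Bool) : ph x ≠ 0 := by
  cases x <;> simp [ph, omega3_ne_zero]

theorem ph_mul_ph : ph true * ph false = 1 := by
  simp only [ph]; linear_combination omega3_cube

theorem ph_pow_twelve (x : Bool) : ph x ^ 12 = 1 := by
  cases x <;> simp only [ph]
  · linear_combination (omega3 ^ 21 + omega3 ^ 18 + omega3 ^ 15 + omega3 ^ 12 + omega3 ^ 9 +
      omega3 ^ 6 + omega3 ^ 3 + 1) * omega3_cube
  · linear_combination (omega3 ^ 9 + omega3 ^ 6 + omega3 ^ 3 + 1) * omega3_cube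

@[simp] theorem ins_zero_cons (v : LVec) (x y : Bool) (l : List Bool) :
    ins 0 v (x :: y :: l) = cup x y * v l := by simp [ins]

@[simp] theorem ins_succ_cons (i : ℕ) (v : LVec) (x : Bool) (l : List Bool) :
    ins (i + 1) v (x :: l) = ins i (fun t => v (x :: t)) l := by simp [ins]

@[simp] theorem ins_nil (i : ℕ) (v : LVec) : ins i v [] = 0 := by cases i <;> simp [ins]

@[simp] theorem ins_zero_singleton (v : LVec) (x : Bool) : ins 0 v [x] = 0 := by simp [ins]

@[simp] theorem con_zero (v : LVec) (l : List Bool) :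
    con 0 v l = cupA * v (true :: false :: l) + cupB * v (false :: true :: l) := by simp [con]

@[simp] theorem con_succ_cons (i : ℕ) (v : LVec) (x : Bool) (l : List Bool) :
    con (i + 1) v (x :: l) = con i (fun t => v (x :: t)) l := by simp [con]

@[simp] theorem con_succ_nil (i : ℕ) (v : LVec) : con (i + 1) v [] = 0 := by simp [con]

@[simp] theorem rot_nil (v : LVec) : rot v [] = v [] := rfl

@[simp] theorem rot_cons (v : LVec) (x : Bool) (t : List Bool) :
    rot v (x :: t) = ph x * v (t ++ [x]) := rfl

@[simp] theorem unrot_nil (v : LVec) : unrot v [] = v [] := by simp [unrot]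

@[simp] theorem unrot_append (v : LVec) (x : Bool) (t : List Bool) :
    unrot v (t ++ [x]) = (ph x)⁻¹ * v (x :: t) := by simp [unrot]

theorem unrot_rot (v : LVec) : unrot (rot v) = v := by
  funext l
  rcases List.eq_nil_or_concat l with rfl | ⟨t, x, rfl⟩
  · simp
  · simp [ph_ne_zero]

theorem rot_unrot (v : LVec) : rot (unrot v) = v := by
  funext l
  cases l with
  | nil => simp
  | cons x t => simp [ph_ne_zero]

theorem ins_smul (i : ℕ) (c : ℂ) (v : LVec) : ins i (c • v) = c • ins i v := by
  funext l
  induction i generalizing v l with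
  | zero =>
    rcases l with _ | ⟨x, _ | ⟨y, l⟩⟩ <;> simp
    ring
  | succ i ih =>
    cases l with
    | nil => simp
    | cons x l => simpa [Pi.smul_def] using ih (fun t => v (x :: t)) l

theorem ins_zero_vec (i : ℕ) : ins i 0 = 0 := by
  simpa using ins_smul i 0 0

theorem con_of_length_lt (i : ℕ) (v : LVec) (l : List Bool) (h : l.length < i) :
    con i v l = 0 := by
  induction i generalizing v l with
  | zero => simp at h
  | succ i ih =>
    cases l with
    | nil => simp
    | cons x l => simpa using ih _ l (by simpa using h)

theorem con_ins_self (i : ℕ) (v : LVec) (l : List Bool) (h : i ≤ l.length) :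
    con i (ins i v) l = v l := by
  induction i generalizing v l with
  | zero =>
    simp only [con_zero, ins_zero_cons, cup]
    linear_combination v l * (cupA_sq + cupB_sq - omega3_sq_add)
  | succ i ih =>
    cases l with
    | nil => simp at h
    | cons x l => simpa using ih (fun t => v (x :: t)) l (by simpa using h)

theorem con_ins_succ (i : ℕ) (v : LVec) (l : List Bool) (h : i + 1 ≤ l.length) :
    con i (ins (i + 1) v) l = v l := by
  induction i generalizing v l with
  | zero =>
    rcases l with _ | ⟨_ | _, l⟩
    · simp at h
    all_goals
      simp [cup]
      linear_combination v (_ :: l) * cupA_mul_cupB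
  | succ i ih =>
    cases l with
    | nil => simp at h
    | cons x l => simpa using ih (fun t => v (x :: t)) l (by simpa using h)

theorem con_succ_ins (i : ℕ) (v : LVec) (l : List Bool) (h : i + 1 ≤ l.length) :
    con (i + 1) (ins i v) l = v l := by
  induction i generalizing v l with
  | zero =>
    rcases l with _ | ⟨_ | _, l⟩
    · simp at h
    all_goals
      simp [cup]
      linear_combination v (_ :: l) * cupA_mul_cupB
  | succ i ih =>
    cases l with
    | nil => simp at h
    | cons x l => simpa using ih (fun t => v (x :: t)) l (by simpa using h)

theorem ins_add (i : ℕ) (v w : LVec) :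
    ins i (fun t => v t + w t) = fun l => ins i v l + ins i w l := by
  funext l
  induction i generalizing v w l with
  | zero =>
    rcases l with _ | ⟨x, _ | ⟨y, l⟩⟩ <;> simp
    ring
  | succ i ih =>
    cases l with
    | nil => simp
    | cons x l => simpa using ih (fun t => v (x :: t)) (fun t => w (x :: t)) l

theorem ins_const_mul (i : ℕ) (c : ℂ) (v : LVec) :
    ins i (fun t => c * v t) = fun l => c * ins i v l := by
  simpa [Pi.smul_def] using ins_smul i c v

theorem con_add (i : ℕ) (v w : LVec) :
    con i (fun t => v t + w t) = fun l => con i v l + con i w l := by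
  funext l
  induction i generalizing v w l with
  | zero => simp; ring
  | succ i ih =>
    cases l with
    | nil => simp
    | cons x l => simpa using ih (fun t => v (x :: t)) (fun t => w (x :: t)) l

theorem con_const_mul (i : ℕ) (c : ℂ) (v : LVec) :
    con i (fun t => c * v t) = fun l => c * con i v l := by
  funext l
  induction i generalizing v l with
  | zero => simp; ring
  | succ i ih =>
    cases l with
    | nil => simp
    | cons x l => simpa using ih (fun t => v (x :: t)) l

theorem con_ins_of_le (i j : ℕ) (h : i ≤ j) (v : LVec) :
    con i (ins (j + 2) v) = ins j (con i v) := by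
  funext l
  induction i generalizing j v l with
  | zero => simp [con_zero, funext (con_zero v), ins_add, ins_const_mul]
  | succ i ih =>
    obtain ⟨j, rfl⟩ : ∃ j', j = j' + 1 := ⟨j - 1, by omega⟩
    cases l with
    | nil => simp
    | cons x l => simpa using ih j (by omega) (fun t => v (x :: t)) l

theorem con_ins_of_ge (i j : ℕ) (h : i ≤ j) (v : LVec) :
    con (j + 2) (ins i v) = ins i (con j v) := by
  funext l
  induction i generalizing j v l with
  | zero =>
    rcases l with _ | ⟨x, _ | ⟨y, l⟩⟩
    · simp
    · simp
    · simp [con_const_mul]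
  | succ i ih =>
    obtain ⟨j, rfl⟩ : ∃ j', j = j' + 1 := ⟨j - 1, by omega⟩
    cases l with
    | nil => simp
    | cons x l => simpa using ih j (by omega) (fun t => v (x :: t)) l

theorem ins_ins (i j : ℕ) (h : i ≤ j) (v : LVec) :
    ins (j + 2) (ins i v) = ins i (ins j v) := by
  funext l
  induction i generalizing j v l with
  | zero =>
    rcases l with _ | ⟨x, _ | ⟨y, l⟩⟩
    · simp
    · simp
    · simp [ins_const_mul]
  | succ i ih =>
    obtain ⟨j, rfl⟩ : ∃ j', j = j' + 1 := ⟨j - 1, by omega⟩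
    cases l with
    | nil => simp
    | cons x l => simpa using ih j (by omega) (fun t => v (x :: t)) l

theorem ins_append (i : ℕ) (v : LVec) (t r : List Bool) (h : i + 2 ≤ t.length) :
    ins i v (t ++ r) = ins i (fun s => v (s ++ r)) t := by
  induction i generalizing v t with
  | zero => rcases t with _ | ⟨x, _ | ⟨y, l⟩⟩ <;> simp at h ⊢
  | succ i ih =>
    cases t with
    | nil => simp at h
    | cons x l => simpa using ih (fun t => v (x :: t)) l (by simp at h; omega)

theorem con_append (i : ℕ) (v : LVec) (t r : List Bool) (h : i ≤ t.length) :
    con i v (t ++ r) = con i (fun s => v (s ++ r)) t := by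
  induction i generalizing v t with
  | zero => simp
  | succ i ih =>
    cases t with
    | nil => simp at h
    | cons x l => simpa using ih (fun t => v (x :: t)) l (by simp at h; omega)

theorem ins_length_append (v : LVec) (l : List Bool) (x y : Bool) (r : List Bool) :
    ins l.length v (l ++ x :: y :: r) = cup x y * v (l ++ r) := by
  induction l generalizing v with
  | nil => simp
  | cons z l ih => simpa using ih (fun t => v (z :: t))

theorem con_length_append (v : LVec) (l r : List Bool) :
    con l.length v (l ++ r) =
      cupA * v (l ++ true :: false :: r) + cupB * v (l ++ false :: true :: r) := by
  induction l generalizing v with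
  | nil => simp
  | cons z l ih => simpa using ih (fun t => v (z :: t))

theorem Supp.ins {N : ℕ} {v : LVec} (h : Supp N v) (i : ℕ) : Supp (N + 2) (ins i v) := by
  intro l hl
  induction i generalizing N v l with
  | zero =>
    rcases l with _ | ⟨x, _ | ⟨y, l⟩⟩ <;> simp
    exact Or.inr (h l (by simpa using hl))
  | succ i ih =>
    cases l with
    | nil => simp
    | cons x l =>
      simp only [ins_succ_cons]
      rcases N with _ | N
      · have : (fun t => v (x :: t)) = (0 : LVec) := by funext t; exact h _ (by simp)
        rw [this, ins_zero_vec]; rfl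
      · exact ih (N := N) (fun t ht => h _ (by simpa using ht)) l (by simp at hl; omega)

theorem Supp.con {N : ℕ} {v : LVec} (h : Supp (N + 2) v) (i : ℕ) : Supp N (con i v) := by
  intro l hl
  by_cases hi : i ≤ l.length
  · obtain ⟨s, r, rfl, rfl⟩ : ∃ s r : List Bool, l = s ++ r ∧ s.length = i :=
      ⟨l.take i, l.drop i, by simp, by simpa using hi⟩
    rw [con_length_append, h, h] <;> simp at hl ⊢ <;> omega
  · exact con_of_length_lt _ _ _ (by omega)

theorem Supp.rot {N : ℕ} {v : LVec} (h : Supp N v) : Supp N (rot v) := by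
  intro l hl
  cases l with
  | nil => exact h _ hl
  | cons x t => rw [rot_cons, h _ (by simpa using hl), mul_zero]

theorem Supp.unrot {N : ℕ} {v : LVec} (h : Supp N v) : Supp N (unrot v) := by
  intro l hl
  rcases List.eq_nil_or_concat l with rfl | ⟨t, x, rfl⟩
  · simpa using h _ hl
  · rw [List.concat_eq_append, unrot_append, h _ (by simpa using hl), mul_zero]

theorem Supp.ext {N : ℕ} {v w : LVec} (hv : Supp N v) (hw : Supp N w)
    (h : ∀ l, l.length = N → v l = w l) : v = w := by
  funext l
  by_cases hl : l.length = N
  · exact h l hl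
  · rw [hv l hl, hw l hl]

theorem rot_ins (i : ℕ) (v : LVec) (l : List Bool) (h : i + 3 ≤ l.length) :
    rot (ins i v) l = ins (i + 1) (rot v) l := by
  cases l with
  | nil => simp at h
  | cons x t =>
    simp only [List.length_cons] at h
    rw [rot_cons, ins_append _ _ _ _ (by omega), ins_succ_cons]
    simp [ins_const_mul]

theorem rot_con (i : ℕ) (v : LVec) (l : List Bool) (h : i + 1 ≤ l.length) :
    rot (con i v) l = con (i + 1) (rot v) l := by
  cases l with
  | nil => simp at h
  | cons x t =>
    simp only [List.length_cons] at h
    rw [rot_cons, con_append _ _ _ _ (by omega), con_succ_cons]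
    simp [con_const_mul]

theorem ph_mul_ph_mul_cup (x y : Bool) : ph x * ph y * cup x y = cup x y := by
  have h : ph true * ph false = 1 := ph_mul_ph
  cases x <;> cases y <;> simp only [cup, mul_zero]
  · linear_combination cupB * h
  · linear_combination cupA * h

theorem rot_rot_ins (v : LVec) (l : List Bool) (k : ℕ) (h : l.length = k + 2) :
    rot (rot (ins k v)) l = ins 0 v l := by
  rcases l with _ | ⟨x, _ | ⟨y, l⟩⟩
  · simp at h
  · simp at h
  · have hk : k = l.length := by simp at h; omega
    subst hk
    have := ins_length_append v l x y []
    simp at this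
    simp [this]
    linear_combination v l * ph_mul_ph_mul_cup x y

theorem con_rot_ins (v : LVec) (l : List Bool) :
    con l.length (rot (ins l.length v)) l = rot v l := by
  cases l with
  | nil =>
    simp [cup, ph]
    linear_combination v [] * (-(omega3^2 + omega3)  * cupA_mul_cupB - omega3_sq_add)
  | cons x l =>
    have h1 := con_length_append (rot (ins (x :: l).length v)) (x :: l) []
    simp only [List.append_nil] at h1
    rw [h1]
    have h2 := ins_length_append v (l ++ [true]) false x []
    have h3 := ins_length_append v (l ++ [false]) true x []
    simp at h2 h3 ⊢
    rw [h2, h3]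
    cases x <;> simp [cup]
    · linear_combination ph false * v (l ++ [false]) * cupA_mul_cupB
    · linear_combination ph true * v (l ++ [true]) * cupA_mul_cupB

theorem con_zero_rot_ins (v : LVec) (l : List Bool) :
    con 0 (rot (ins l.length v)) l = unrot v l := by
  rcases List.eq_nil_or_concat l with rfl | ⟨t, x, rfl⟩
  · simp [cup, ph]
    linear_combination v [] * (-(omega3^2 + omega3)  * cupA_mul_cupB - omega3_sq_add)
  · have h2 := ins_length_append v (true :: t) x false []
    have h3 := ins_length_append v (false :: t) x true []
    simp at h2 h3 ⊢
    rw [h2, h3]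
    have h := ph_mul_ph
    have ht : (ph true)⁻¹ = ph false := inv_eq_of_mul_eq_one_right h
    have hf : (ph false)⁻¹ = ph true := by rw [← ht, inv_inv]
    cases x <;> simp [cup, hf, ht]
    · linear_combination ph true * v (false :: t) * cupA_mul_cupB
    · linear_combination ph false * v (true :: t) * cupA_mul_cupB

/-! ### Link-pattern vectors and the maximum principle -/

theorem con_smul (i : ℕ) (c : ℂ) (v : LVec) : con i (c • v) = c • con i v := by
  simpa [Pi.smul_def] using con_const_mul i c v

theorem con_zero_vec (i : ℕ) : con i 0 = 0 := by
  simpa using con_smul i 0 0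

theorem rot_zero_vec : rot 0 = 0 := by
  funext l; cases l <;> simp

theorem unrot_zero_vec : unrot 0 = 0 := by
  rw [← rot_zero_vec, unrot_rot]; exact rot_zero_vec.symm

/-- The vector supported on the single configuration `s` with value `u`. -/
def single (u : ℂ) (s : List Bool) : LVec := fun l => if l = s then u else 0

theorem supp_single (u : ℂ) (s : List Bool) : Supp s.length (single u s) := by
  intro l hl
  simp only [single, ite_eq_right_iff]
  rintro rfl
  exact absurd rfl hl

/-- Balanced spin lists. -/
def Bal (s : List Bool) : Prop := s.count true = s.count false

/-- Vectors with `2 * k` sites built from basis vectors by insertion of cups. -/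
inductive Dia : ℕ → LVec → Prop
  | zero (k : ℕ) : Dia k 0
  | single (k : ℕ) (u : ℂ) (s : List Bool) (hs : s.length = 2 * k) (hb : Bal s)
      (hu : u ^ 12 = 1) : Dia k (single u s)
  | ins (k i : ℕ) (hi : i ≤ 2 * k) (v : LVec) (hv : Dia k v) : Dia (k + 1) (ins i v)
  | wrap (k : ℕ) (v : LVec) (hv : Dia k v) : Dia (k + 1) (rot (_root_.ins (2 * k) v))

theorem Dia.supp {k : ℕ} {v : LVec} (h : Dia k v) : Supp (2 * k) v := by
  induction h with
  | zero k => exact fun _ _ => rfl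
  | single k u s hs hb hu => exact hs ▸ supp_single u s
  | ins k i hi v hv ih => exact ih.ins i
  | wrap k v hv ih => exact (ih.ins (2 * k)).rot

theorem rot_single (u : ℂ) (x : Bool) (t : List Bool) :
    rot (single u (t ++ [x])) = single (ph x * u) (x :: t) := by
  funext l
  cases l with
  | nil => simp [single]
  | cons y l =>
    simp only [rot_cons, single, List.cons.injEq]
    by_cases h : l ++ [y] = t ++ [x]
    · obtain ⟨rfl, h2⟩ := List.append_inj' h rfl
      obtain rfl : y = x := by simpa using h2
      simp
    · have h' : ¬ (y = x ∧ l = t) := by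
        rintro ⟨rfl, rfl⟩; exact h rfl
      simp [h, h']

theorem unrot_single (u : ℂ) (x : Bool) (t : List Bool) :
    unrot (single u (x :: t)) = single ((ph x)⁻¹ * u) (t ++ [x]) := by
  have := rot_single ((ph x)⁻¹ * u) x t
  rw [mul_inv_cancel_left₀ (ph_ne_zero x)] at this
  rw [← this, unrot_rot]

theorem Dia.rot {k : ℕ} {v : LVec} (h : Dia k v) : Dia k (rot v) := by
  induction h with
  | zero k => rw [rot_zero_vec]; exact Dia.zero k
  | single k u s hs hb hu =>
    rcases List.eq_nil_or_concat s with rfl | ⟨t, x, rfl⟩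
    · have : _root_.rot (_root_.single u []) = _root_.single u [] := by
        funext l; cases l <;> simp [_root_.single]
      rw [this]; exact Dia.single k u [] hs hb hu
    · rw [List.concat_eq_append, rot_single]
      refine Dia.single k _ _ (by simpa using hs) ?_ (by rw [mul_pow, ph_pow_twelve, hu, one_mul])
      simpa [Bal, List.count_append, List.count_cons] using hb
  | ins k i hi v hv ih =>
    rcases hi.eq_or_lt with rfl | hi
    · exact Dia.wrap k v hv
    · have : _root_.rot (_root_.ins i v) = _root_.ins (i + 1) (_root_.rot v) :=
        Supp.ext (hv.supp.ins i).rot (hv.supp.rot.ins (i + 1))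
          fun l hl => rot_ins i v l (by omega)
      rw [this]
      exact Dia.ins k (i + 1) hi _ ih
  | wrap k v hv ih =>
    have : _root_.rot (_root_.rot (_root_.ins (2 * k) v)) = _root_.ins 0 v :=
      Supp.ext (hv.supp.ins _).rot.rot (hv.supp.ins 0) fun l hl => rot_rot_ins v l _ hl
    rw [this]
    exact Dia.ins k 0 (Nat.zero_le _) v hv

theorem unrot_ins_succ {N : ℕ} {v : LVec} (hv : Supp N v) (i : ℕ) (hi : i + 1 ≤ N) :
    unrot (ins (i + 1) v) = ins i (unrot v) := by
  have : rot (ins i (unrot v)) = ins (i + 1) (rot (unrot v)) :=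
    Supp.ext (hv.unrot.ins i).rot (hv.unrot.rot.ins (i + 1))
      fun l hl => rot_ins i _ l (by omega)
  rw [← unrot_rot (ins i (unrot v)), this, rot_unrot]

theorem unrot_ins_zero {N : ℕ} {v : LVec} (hv : Supp N v) :
    unrot (ins 0 v) = rot (ins N v) := by
  have : rot (rot (ins N v)) = ins 0 v :=
    Supp.ext (hv.ins _).rot.rot (hv.ins 0) fun l hl => rot_rot_ins v l _ hl
  rw [← this, unrot_rot]

theorem Dia.unrot {k : ℕ} {v : LVec} (h : Dia k v) : Dia k (unrot v) := by
  induction h with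
  | zero k => rw [unrot_zero_vec]; exact Dia.zero k
  | single k u s hs hb hu =>
    cases s with
    | nil =>
      have : _root_.rot (_root_.single u []) = _root_.single u [] := by
        funext l; cases l <;> simp [_root_.single]
      rw [← this, unrot_rot]; exact Dia.single k u [] hs hb hu
    | cons x t =>
      rw [unrot_single]
      refine Dia.single k _ _ (by simpa using hs) ?_
        (by rw [mul_pow, inv_pow, ph_pow_twelve, hu, inv_one, one_mul])
      simpa [Bal, List.count_append, List.count_cons] using hb
  | ins k i hi v hv ih =>
    cases i with
    | zero => rw [unrot_ins_zero hv.supp]; exact Dia.wrap k v hv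
    | succ i =>
      rw [unrot_ins_succ hv.supp i hi]
      exact Dia.ins k i (by omega) _ ih
  | wrap k v hv ih =>
    rw [unrot_rot]
    exact Dia.ins k _ le_rfl v hv

theorem con_single_ne (i : ℕ) (u : ℂ) (l r : List Bool) (x : Bool) (hi : l.length = i) :
    con i (single u (l ++ x :: x :: r)) = 0 := by
  subst hi
  funext t
  by_cases ht : l.length ≤ t.length
  · obtain ⟨s, q, rfl, h⟩ : ∃ s q : List Bool, t = s ++ q ∧ s.length = l.length :=
      ⟨t.take l.length, t.drop l.length, by simp, by simpa using ht⟩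
    rw [← h, con_length_append]
    have h1 : s ++ true :: false :: q ≠ l ++ x :: x :: r := by
      intro e
      have := (List.append_inj e h).2
      simp at this
      grind
    have h2 : s ++ false :: true :: q ≠ l ++ x :: x :: r := by
      intro e
      have := (List.append_inj e h).2
      simp at this
      grind
    simp [single, h1, h2]
  · exact con_of_length_lt _ _ _ (by omega)

theorem con_single_cup (u : ℂ) (l r : List Bool) (x : Bool) :
    con l.length (single u (l ++ x :: (!x) :: r)) = single (cup x (!x) * u) (l ++ r) := by
  funext t
  by_cases ht : l.length ≤ t.length
  · obtain ⟨s, q, rfl, h⟩ : ∃ s q : List Bool, t = s ++ q ∧ s.length = l.length :=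
      ⟨t.take l.length, t.drop l.length, by simp, by simpa using ht⟩
    rw [← h, con_length_append]
    by_cases e : s = l ∧ q = r
    · obtain ⟨rfl, rfl⟩ := e
      cases x <;> simp [single, cup]
    · have h0 : s ++ q ≠ l ++ r := fun e' => e (List.append_inj e' h)
      have h1 : s ++ true :: false :: q ≠ l ++ x :: (!x) :: r := by
        intro e'
        have := List.append_inj e' h
        simp at this
        exact e ⟨this.1, by simp_all⟩
      have h2 : s ++ false :: true :: q ≠ l ++ x :: (!x) :: r := by
        intro e'
        have := List.append_inj e' h
        simp at this
        exact e ⟨this.1, by simp_all⟩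
      simp [single, h0, h1, h2]
  · have : t ≠ l ++ r := by rintro rfl; simp at ht
    rw [con_of_length_lt _ _ _ (by omega)]
    simp [single, this]

theorem exists_split_two (i : ℕ) (s : List Bool) (h : i + 2 ≤ s.length) :
    ∃ l x y r, s = l ++ x :: y :: r ∧ l.length = i := by
  refine ⟨s.take i, s[i], s[i + 1], s.drop (i + 2), ?_, by simp; omega⟩
  rw [List.getElem_cons_drop, List.getElem_cons_drop, List.take_append_drop]

theorem cup_pow_twelve (x : Bool) : cup x (!x) ^ 12 = 1 := by
  cases x <;> simp [cup, cupA_pow_twelve, cupB_pow_twelve]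

theorem dia_con_single (k i : ℕ) (hi : i ≤ 2 * k) (u : ℂ) (s : List Bool)
    (hs : s.length = 2 * (k + 1)) (hb : Bal s) (hu : u ^ 12 = 1) :
    Dia k (con i (single u s)) := by
  obtain ⟨l, x, y, r, rfl, rfl⟩ := exists_split_two i s (by omega)
  by_cases hxy : y = x
  · subst hxy
    rw [con_single_ne _ _ _ _ _ rfl]
    exact Dia.zero k
  · obtain rfl : y = !x := by cases x <;> cases y <;> simp_all
    rw [con_single_cup]
    refine Dia.single k _ _ ?_ ?_ (by rw [mul_pow, cup_pow_twelve, hu, one_mul])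
    · simp at hs ⊢; omega
    · cases x <;> simp [Bal, List.count_append] at hb ⊢ <;> omega

theorem con_ins_self_eq {N : ℕ} {v : LVec} (hv : Supp N v) (i : ℕ) (hi : i ≤ N) :
    con i (ins i v) = v :=
  Supp.ext ((hv.ins i).con i) hv fun l hl => con_ins_self i v l (by omega)

theorem con_ins_succ_eq {N : ℕ} {v : LVec} (hv : Supp N v) (i : ℕ) (hi : i + 1 ≤ N) :
    con i (ins (i + 1) v) = v :=
  Supp.ext ((hv.ins _).con i) hv fun l hl => con_ins_succ i v l (by omega)

theorem con_succ_ins_eq {N : ℕ} {v : LVec} (hv : Supp N v) (i : ℕ) (hi : i + 1 ≤ N) :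
    con (i + 1) (ins i v) = v :=
  Supp.ext ((hv.ins i).con _) hv fun l hl => con_succ_ins i v l (by omega)

theorem Dia.con {k : ℕ} : ∀ {v : LVec}, Dia (k + 1) v → ∀ j ≤ 2 * k, Dia k (con j v) := by
  induction k with
  | zero =>
    intro v h j hj
    obtain rfl : j = 0 := by omega
    cases h with
    | zero => rw [con_zero_vec]; exact Dia.zero _
    | single _ u s hs hb hu => exact dia_con_single 0 0 hj u s hs hb hu
    | ins _ i hi v hv =>
      obtain rfl : i = 0 := by omega
      rw [con_ins_self_eq hv.supp _ (Nat.zero_le _)]; exact hv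
    | wrap k v hv =>
      have : _root_.con 0 (_root_.rot (_root_.ins (2 * 0) v)) = _root_.unrot v :=
        Supp.ext ((hv.supp.ins _).rot.con 0) hv.supp.unrot fun l hl => by
          have := con_zero_rot_ins v l
          rwa [hl] at this
      rw [this]; exact hv.unrot
  | succ k ih =>
    intro v h j hj
    cases h with
    | zero => rw [con_zero_vec]; exact Dia.zero _
    | single _ u s hs hb hu => exact dia_con_single _ j hj u s hs hb hu
    | ins k i hi v hv =>
      rcases lt_trichotomy i j with h | rfl | h
      · obtain ⟨d, rfl⟩ : ∃ d, j = i + d + 1 := ⟨j - i - 1, by omega⟩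
        cases d with
        | zero => rw [con_succ_ins_eq hv.supp i (by omega)]; exact hv
        | succ d =>
          rw [show i + (d + 1) + 1 = (i + d) + 2 by ring, con_ins_of_ge i (i + d) (by omega)]
          exact Dia.ins k i (by omega) _ (ih hv _ (by omega))
      · rw [con_ins_self_eq hv.supp _ hj]; exact hv
      · obtain ⟨d, rfl⟩ : ∃ d, i = j + d + 1 := ⟨i - j - 1, by omega⟩
        cases d with
        | zero => rw [con_ins_succ_eq hv.supp j (by omega)]; exact hv
        | succ d =>
          rw [show j + (d + 1) + 1 = (j + d) + 2 by ring, con_ins_of_le j (j + d) (by omega)]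
          exact Dia.ins k _ (by omega) _ (ih hv _ (by omega))
    | wrap k v hv =>
      rcases j with _ | j
      · have : _root_.con 0 (_root_.rot (_root_.ins (2 * (k + 1)) v)) = _root_.unrot v :=
          Supp.ext ((hv.supp.ins _).rot.con 0) hv.supp.unrot fun l hl => by
            have := con_zero_rot_ins v l
            rwa [hl] at this
        rw [this]; exact hv.unrot
      · rcases hj.eq_or_lt with h | h
        · have : _root_.con (j + 1) (_root_.rot (_root_.ins (2 * (k + 1)) v)) = _root_.rot v :=
            Supp.ext ((hv.supp.ins _).rot.con _) hv.supp.rot fun l hl => by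
              have := con_rot_ins v l
              rw [hl] at this
              rwa [h]
          rw [this]; exact hv.rot
        · have : _root_.con (j + 1) (_root_.rot (_root_.ins (2 * k + 2) v))
              = _root_.rot (_root_.con j (_root_.ins (2 * k + 2) v)) :=
            Supp.ext ((hv.supp.ins _).rot.con _) ((hv.supp.ins _).con _).rot fun l hl =>
              (rot_con j _ l (by omega)).symm
          rw [show 2 * (k + 1) = 2 * k + 2 by ring, this, con_ins_of_le j (2 * k) (by omega)]
          exact Dia.wrap k _ (ih hv _ (by omega))

/-- The generator acting on the last and first of `N` sites. -/
def genWrap (N : ℕ) (v : LVec) : LVec := rot (gen (N - 2) (unrot v))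

theorem Dia.gen {k : ℕ} {v : LVec} (h : Dia (k + 1) v) (j : ℕ) (hj : j ≤ 2 * k) :
    Dia (k + 1) (gen j v) := Dia.ins k j hj _ (h.con j hj)

theorem Dia.genWrap {k : ℕ} {v : LVec} (h : Dia (k + 1) v) :
    Dia (k + 1) (genWrap (2 * (k + 1)) v) := (h.unrot.gen _ (by omega)).rot

theorem finite_dia (k : ℕ) : {v | Dia k v}.Finite := by
  have hroots : {u : ℂ | u ^ 12 = 1}.Finite := by
    have : {u : ℂ | u ^ 12 = 1} = ↑(Polynomial.nthRootsFinset 12 (1 : ℂ)) := by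
      ext u; simp
    rw [this]; exact Finset.finite_toSet _
  have hsing (k : ℕ) : {v | ∃ u s, u ^ 12 = 1 ∧ s.length = 2 * k ∧ v = single u s}.Finite := by
    refine ((hroots.prod (List.finite_length_eq Bool (2 * k))).image
      fun p => single p.1 p.2).subset ?_
    rintro v ⟨u, s, hu, hs, rfl⟩
    exact ⟨(u, s), ⟨hu, hs⟩, rfl⟩
  induction k with
  | zero =>
    refine ((Set.finite_singleton 0).union (hsing 0)).subset ?_
    rintro v hv
    cases hv with
    | zero => exact Or.inl rfl
    | single _ u s hs hb hu => exact Or.inr ⟨u, s, hu, hs, rfl⟩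
  | succ k ih =>
    refine ((((Set.finite_singleton 0).union (hsing (k + 1))).union
      ((Set.finite_Iic (2 * k)).image2 (fun i v => ins i v) ih)).union
        (ih.image fun v => rot (ins (2 * k) v))).subset ?_
    rintro v hv
    cases hv with
    | zero => exact Or.inl (Or.inl (Or.inl rfl))
    | single _ u s hs hb hu => exact Or.inl (Or.inl (Or.inr ⟨u, s, hu, hs, rfl⟩))
    | ins k i hi v hv => exact Or.inl (Or.inr ⟨i, hi, v, hv, rfl⟩)
    | wrap k v hv => exact Or.inr ⟨v, hv, rfl⟩

/-- The product of adjacent cups. -/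
def cups : ℕ → LVec
  | 0 => single 1 []
  | k + 1 => ins 0 (cups k)

theorem exists_cups_mem {k : ℕ} (S : Set LVec)
    (hgen : ∀ v ∈ S, Dia k v → ∀ j, j + 2 ≤ 2 * k → gen j v ∈ S)
    (hwrap : ∀ v ∈ S, Dia k v → 1 ≤ k → genWrap (2 * k) v ∈ S)
    {v : LVec} (hv : v ∈ S) (hd : Dia k v) :
    (0 : LVec) ∈ S ∨ ∃ u : ℂ, u ^ 12 = 1 ∧ u • cups k ∈ S := by
  induction k generalizing S v with
  | zero =>
    cases hd with
    | zero => exact Or.inl hv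
    | single _ u s hs hb hu =>
      right
      refine ⟨u, hu, ?_⟩
      obtain rfl : s = [] := by simpa using hs
      have : u • cups 0 = single u [] := by funext l; simp [cups, single]
      rwa [this]
  | succ k ih =>
    have key := ih {w | ins 0 w ∈ S} ?_ ?_ (v := con 0 v) ?_ (hd.con 0 (Nat.zero_le _))
    · rcases key with h | ⟨u, hu, h⟩
      · left
        rw [Set.mem_ofPred_eq, ins_zero_vec] at h
        exact h
      · right
        rw [Set.mem_ofPred_eq, ins_smul] at h
        exact ⟨u, hu, h⟩
    · intro w hw hdw j hj
      have h1 := hgen _ hw (Dia.ins k 0 (Nat.zero_le _) w hdw) (j + 2) (by omega)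
      rw [gen, con_ins_of_ge 0 j (Nat.zero_le _), ins_ins 0 j (Nat.zero_le _)] at h1
      exact h1
    · intro w hw hdw hk
      obtain ⟨k, rfl⟩ : ∃ k', k = k' + 1 := ⟨k - 1, by omega⟩
      have hs := hdw.supp
      have d0 := Dia.ins _ 0 (Nat.zero_le _) w hdw
      have h1 := hgen _ hw d0 1 (by omega)
      have d1 := d0.gen 1 (by omega)
      have e1 : gen 1 (ins 0 w) = ins 1 w := by
        rw [gen, con_succ_ins_eq hs 0 (by omega)]
      rw [e1] at h1 d1
      have h2 := hwrap _ h1 d1 (by omega)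
      have d2 := d1.genWrap
      have e2 : genWrap (2 * (k + 1 + 1)) (ins 1 w) = ins 1 (genWrap (2 * (k + 1)) w) := by
        rw [genWrap, unrot_ins_succ hs 0 (by omega), gen,
          show 2 * (k + 1 + 1) - 2 = 2 * k + 2 by omega, con_ins_of_ge 0 _ (Nat.zero_le _),
          ins_ins 0 _ (Nat.zero_le _), genWrap, gen, show 2 * (k + 1) - 2 = 2 * k by omega]
        have hs' : Supp (2 * k + 2) (ins (2 * k) (con (2 * k) (unrot w))) :=
          Supp.ins (Supp.con (N := 2 * k) hs.unrot _) _
        exact Supp.ext (hs'.ins 0).rot (hs'.rot.ins 1) fun l hl => rot_ins 0 _ l (by omega)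
      rw [e2] at h2 d2
      have h3 := hgen _ h2 d2 0 (by omega)
      have d3 : Dia (k + 1) (genWrap (2 * (k + 1)) w) := hdw.genWrap
      rw [gen, con_ins_succ_eq d3.supp 0 (by omega)] at h3
      exact h3
    · exact hgen _ hv hd 0 (by omega)

theorem cups_pairing_ne_zero {k : ℕ} (f : LVec → ℂ) (f_zero : f 0 = 0)
    (f_smul : ∀ (u : ℂ) v, u ^ 12 = 1 → ‖f (u • v)‖ = ‖f v‖) (lam : ℝ)
    (hlam : (2 * (k + 1) : ℕ) ≤ lam)
    (hf : ∀ v, Dia (k + 1) v → (lam : ℂ) * f v =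
      ∑ j ∈ Finset.range (2 * k + 1), f (gen j v) + f (genWrap (2 * (k + 1)) v))
    (v₀ : LVec) (hv₀ : Dia (k + 1) v₀) (hne : f v₀ ≠ 0) :
    lam = (2 * (k + 1) : ℕ) ∧ f (cups (k + 1)) ≠ 0 := by
  obtain ⟨m, hm, hmax⟩ := Set.exists_max_image _ (fun v => ‖f v‖) (finite_dia (k + 1)) ⟨v₀, hv₀⟩
  have hpos : 0 < ‖f m‖ := (norm_pos_iff.mpr hne).trans_le (hmax v₀ hv₀)
  have main : ∀ v, Dia (k + 1) v → ‖f v‖ = ‖f m‖ → lam = (2 * (k + 1) : ℕ) ∧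
      (∀ j ≤ 2 * k, ‖f (gen j v)‖ = ‖f m‖) ∧ ‖f (genWrap (2 * (k + 1)) v)‖ = ‖f m‖ := by
    intro v hv hvm
    have h0 : (0 : ℝ) ≤ lam := le_trans (Nat.cast_nonneg _) hlam
    have hg : ∀ j ≤ 2 * k, ‖f (gen j v)‖ ≤ ‖f m‖ := fun j hj => hmax _ (hv.gen j hj)
    have hw : ‖f (genWrap (2 * (k + 1)) v)‖ ≤ ‖f m‖ := hmax _ hv.genWrap
    have h1 : lam * ‖f m‖ ≤ ∑ j ∈ Finset.range (2 * k + 1), ‖f (gen j v)‖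
        + ‖f (genWrap (2 * (k + 1)) v)‖ := by
      have : ‖(lam : ℂ) * f v‖ = lam * ‖f m‖ := by
        rw [norm_mul, hvm, Complex.norm_real, Real.norm_of_nonneg h0]
      rw [← this, hf v hv]
      exact (norm_add_le _ _).trans (by gcongr; exact norm_sum_le _ _)
    have hle : ∀ j ∈ Finset.range (2 * k + 1), ‖f (gen j v)‖ ≤ ‖f m‖ :=
      fun j hj => hg j (by simpa [Nat.lt_succ_iff] using hj)
    have h2 : ∑ j ∈ Finset.range (2 * k + 1), ‖f (gen j v)‖ ≤ (2 * k + 1) * ‖f m‖ := by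
      refine (Finset.sum_le_sum hle).trans (by simp)
    push_cast at hlam
    have h3 : (2 * ((k : ℝ) + 1)) * ‖f m‖ ≤ lam * ‖f m‖ := by gcongr
    have e1 : lam * ‖f m‖ = (2 * ((k : ℝ) + 1)) * ‖f m‖ := by linarith
    refine ⟨by push_cast; exact mul_right_cancel₀ hpos.ne' e1, ?_, by linarith⟩
    have e2 : ∑ j ∈ Finset.range (2 * k + 1), ‖f (gen j v)‖ =
        ∑ j ∈ Finset.range (2 * k + 1), ‖f m‖ := by
      simp; linarith
    have := (Finset.sum_eq_sum_iff_of_le hle).mp e2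
    exact fun j hj => this j (by simp; omega)
  refine ⟨(main m hm rfl).1, ?_⟩
  have := exists_cups_mem (k := k + 1) {v | ‖f v‖ = ‖f m‖}
    (fun v hv hd j hj => (main v hd hv).2.1 j (by omega))
    (fun v hv hd _ => (main v hd hv).2.2) (v := m) rfl hm
  rcases this with h | ⟨u, hu, h⟩
  · rw [Set.mem_ofPred_eq, f_zero, norm_zero] at h
    exact absurd h hpos.ne
  · rw [Set.mem_ofPred_eq, f_smul u _ hu] at h
    rw [← norm_pos_iff, h]; exact hpos

/-! ### Demazure–Lusztig operators -/

open MvPolynomial in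
/-- Polynomials agreeing at all points with distinct positive real coordinates are equal. -/
theorem mvPoly_ext {f g : MvPolynomial ℕ ℂ}
    (h : ∀ r : ℕ → ℝ, Function.Injective r → (∀ i, 0 < r i) →
      eval (fun i => (r i : ℂ)) f = eval (fun i => (r i : ℂ)) g) : f = g := by
  refine MvPolynomial.funext_set
    (fun i : ℕ => (fun x : ℝ => (x : ℂ)) '' Set.Ioo ((i : ℝ) + 1) (i + 2)) (fun i => ?_) ?_
  · exact (Set.Ioo_infinite (by linarith)).image Complex.ofReal_injective.injOn
  · intro z hz
    have hz' : ∀ i : ℕ, ∃ x : ℝ, ((i : ℝ) + 1 < x ∧ x < i + 2) ∧ (x : ℂ) = z i :=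
      fun i => by simpa using hz i (Set.mem_univ i)
    choose r hr hrz using hz'
    have : z = fun i => (r i : ℂ) := funext fun i => (hrz i).symm
    rw [this]
    refine h r (fun i j hij => ?_) (fun i => ?_)
    · have h1 := hr i
      have h2 := hr j
      rw [hij] at h1
      have h3 : (i : ℝ) < j + 1 := by linarith
      have h4 : (j : ℝ) < i + 1 := by linarith
      norm_cast at h3 h4
      omega
    · have := hr i
      have : (0 : ℝ) ≤ i := Nat.cast_nonneg i
      linarith

/-- Exchange of the variables `i` and `i + 1`. -/
abbrev sw (i : ℕ) : Equiv.Perm ℕ := Equiv.swap i (i + 1)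

open MvPolynomial in
theorem X_sub_X_dvd (i : ℕ) (f : MvPolynomial ℕ ℂ) :
    (X i - X (i + 1)) ∣ rename (sw i) f - f := by
  induction f using MvPolynomial.induction_on with
  | C a => simp
  | add p q hp hq =>
    rw [map_add]
    convert dvd_add hp hq using 1
    ring
  | mul_X p j hp =>
    rw [map_mul, rename_X]
    have hj : (X i - X (i + 1) : MvPolynomial ℕ ℂ) ∣ X (sw i j) - X j := by
      by_cases h1 : j = i
      · subst h1
        rw [Equiv.swap_apply_left]
        exact ⟨-1, by ring⟩
      · by_cases h2 : j = i + 1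
        · subst h2
          rw [Equiv.swap_apply_right]
        · rw [Equiv.swap_apply_of_ne_of_ne h1 h2]
          simp
    have e : rename (sw i) p * X (sw i j) - p * X j =
        (rename (sw i) p - p) * X (sw i j) + p * (X (sw i j) - X j) := by ring
    rw [e]
    exact dvd_add (Dvd.dvd.mul_right hp _) (Dvd.dvd.mul_left hj _)

/-- Divided difference. -/
def divDiff (i : ℕ) (f : MvPolynomial ℕ ℂ) : MvPolynomial ℕ ℂ :=
  Classical.choose (X_sub_X_dvd i f)

open MvPolynomial in
theorem divDiff_spec (i : ℕ) (f : MvPolynomial ℕ ℂ) :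
    rename (sw i) f - f = (X i - X (i + 1)) * divDiff i f :=
  Classical.choose_spec (X_sub_X_dvd i f)

open MvPolynomial in
theorem X_sub_X_ne_zero (i : ℕ) : (X i - X (i + 1) : MvPolynomial ℕ ℂ) ≠ 0 := by
  rw [sub_ne_zero]
  intro h
  have := X_injective h
  omega

/-- Demazure–Lusztig operators. -/
def dl (i : ℕ) : Module.End ℂ (MvPolynomial ℕ ℂ) where
  toFun f := MvPolynomial.C (-omega3) *
    ((MvPolynomial.X i - MvPolynomial.C omega3 * MvPolynomial.X (i + 1)) * divDiff i f
      + MvPolynomial.C omega3 * f)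
  map_add' f g := by
    have : divDiff i (f + g) = divDiff i f + divDiff i g := by
      apply mul_left_cancel₀ (X_sub_X_ne_zero i)
      rw [mul_add, ← divDiff_spec, ← divDiff_spec, ← divDiff_spec, map_add]
      ring
    rw [this]; ring
  map_smul' c f := by
    have : divDiff i (c • f) = c • divDiff i f := by
      apply mul_left_cancel₀ (X_sub_X_ne_zero i)
      rw [mul_smul_comm, ← divDiff_spec, ← divDiff_spec, map_smul, smul_sub]
    rw [this]
    simp only [RingHom.id_apply, MvPolynomial.smul_eq_C_mul]
    ring

open MvPolynomial in
theorem X_sub_X_mul_dl (i : ℕ) (f : MvPolynomial ℕ ℂ) :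
    (X i - X (i + 1)) * dl i f = C (-omega3) *
      ((X i - C omega3 * X (i + 1)) * rename (sw i) f + C (omega3 - 1) * X i * f) := by
  have h := divDiff_spec i f
  simp only [dl, LinearMap.coe_mk, AddHom.coe_mk, map_sub, map_one, map_neg]
  linear_combination -C omega3 * (X i - C omega3 * X (i + 1)) * (-h)

/-- Coefficient of the exchanged term in `dl`. -/
def dlA (x y : ℂ) : ℂ := -omega3 * (x - omega3 * y) / (x - y)

/-- Coefficient of the diagonal term in `dl`. -/
def dlB (x y : ℂ) : ℂ := -omega3 * ((omega3 - 1) * x) / (x - y)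

open MvPolynomial in
theorem eval_dl {i : ℕ} {z : ℕ → ℂ} (hz : z i ≠ z (i + 1)) (f : MvPolynomial ℕ ℂ) :
    eval z (dl i f) =
      dlA (z i) (z (i + 1)) * eval (z ∘ sw i) f + dlB (z i) (z (i + 1)) * eval z f := by
  have h := congrArg (eval z) (X_sub_X_mul_dl i f)
  simp only [map_mul, map_sub, map_add, eval_X, eval_C, eval_rename, map_neg, map_one] at h
  have h0 : z i - z (i + 1) ≠ 0 := sub_ne_zero.mpr hz
  apply mul_left_cancel₀ h0
  rw [h, dlA, dlB]
  field_simp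
  ring

theorem comp_sw_braid (i : ℕ) (z : ℕ → ℂ) :
    ((z ∘ sw i) ∘ sw (i + 1)) ∘ sw i = ((z ∘ sw (i + 1)) ∘ sw i) ∘ sw (i + 1) := by
  funext j
  simp only [Function.comp_apply]
  congr 1
  simp only [Equiv.swap_apply_def]
  split_ifs <;> omega

theorem comp_sw_comm {i j : ℕ} (h : i + 2 ≤ j) (z : ℕ → ℂ) :
    (z ∘ sw i) ∘ sw j = (z ∘ sw j) ∘ sw i := by
  funext k
  simp only [Function.comp_apply]
  congr 1
  simp only [Equiv.swap_apply_def]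
  split_ifs <;> omega

theorem comp_sw_sw (i : ℕ) (z : ℕ → ℂ) : (z ∘ sw i) ∘ sw i = z := by
  funext k; simp

theorem comp_sw_self {α : Type*} (i : ℕ) (z : ℕ → α) : (z ∘ sw i) i = z (i + 1) := by simp

theorem comp_sw_succ {α : Type*} (i : ℕ) (z : ℕ → α) : (z ∘ sw i) (i + 1) = z i := by simp

theorem comp_sw_of_lt {α : Type*} {i k : ℕ} (h : i + 1 < k) (z : ℕ → α) : (z ∘ sw i) k = z k := by
  rw [Function.comp_apply, Equiv.swap_apply_of_ne_of_ne (by omega) (by omega)]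

theorem comp_sw_of_gt {α : Type*} {i k : ℕ} (h : k < i) (z : ℕ → α) : (z ∘ sw i) k = z k := by
  rw [Function.comp_apply, Equiv.swap_apply_of_ne_of_ne (by omega) (by omega)]

theorem dl_braid (i : ℕ) (f : MvPolynomial ℕ ℂ) :
    dl i (dl (i + 1) (dl i f)) = dl (i + 1) (dl i (dl (i + 1) f)) := by
  apply mvPoly_ext
  intro r hr _
  generalize hz : (fun i => (r i : ℂ)) = z
  have hinj : Function.Injective z := hz ▸ Complex.ofReal_injective.comp hr
  have h01 : z i ≠ z (i + 1) := fun h => by simpa using hinj h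
  have h02 : z i ≠ z (i + 2) := fun h => by simpa using hinj h
  have h12 : z (i + 1) ≠ z (i + 2) := fun h => by simpa using hinj h
  have a0 := comp_sw_self (α := ℂ) i
  have a1 := comp_sw_succ (α := ℂ) i
  have a2 := fun z : ℕ → ℂ => comp_sw_of_lt (i := i) (k := i + 2) (by omega) z
  have b0 := fun z : ℕ → ℂ => comp_sw_of_gt (i := i + 1) (k := i) (by omega) z
  have b1 := comp_sw_self (α := ℂ) (i + 1)
  have b2 := comp_sw_succ (α := ℂ) (i + 1)
  simp only [add_assoc, Nat.reduceAdd] at b1 b2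
  rw [eval_dl (by
      simpa only [add_assoc, Nat.reduceAdd, a0, a1, a2, b0, b1, b2] using h01),
    eval_dl (by
      simpa only [add_assoc, Nat.reduceAdd, a0, a1, a2, b0, b1, b2] using h02),
    eval_dl (by
      simpa only [add_assoc, Nat.reduceAdd, a0, a1, a2, b0, b1, b2] using h12),
    eval_dl (by
      simpa only [add_assoc, Nat.reduceAdd, a0, a1, a2, b0, b1, b2] using h01.symm),
    eval_dl (by
      simpa only [add_assoc, Nat.reduceAdd, a0, a1, a2, b0, b1, b2] using h12),
    eval_dl (by
      simpa only [add_assoc, Nat.reduceAdd, a0, a1, a2, b0, b1, b2] using h02),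
    eval_dl (by
      simpa only [add_assoc, Nat.reduceAdd, a0, a1, a2, b0, b1, b2] using h01)]
  rw [eval_dl (by
      simpa only [add_assoc, Nat.reduceAdd, a0, a1, a2, b0, b1, b2] using h12),
    eval_dl (by
      simpa only [add_assoc, Nat.reduceAdd, a0, a1, a2, b0, b1, b2] using h02),
    eval_dl (by
      simpa only [add_assoc, Nat.reduceAdd, a0, a1, a2, b0, b1, b2] using h01),
    eval_dl (by
      simpa only [add_assoc, Nat.reduceAdd, a0, a1, a2, b0, b1, b2] using h12.symm),
    eval_dl (by
      simpa only [add_assoc, Nat.reduceAdd, a0, a1, a2, b0, b1, b2] using h01),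
    eval_dl (by
      simpa only [add_assoc, Nat.reduceAdd, a0, a1, a2, b0, b1, b2] using h02),
    eval_dl (by
      simpa only [add_assoc, Nat.reduceAdd, a0, a1, a2, b0, b1, b2] using h12)]
  rw [comp_sw_braid, comp_sw_sw, comp_sw_sw]
  simp only [add_assoc, Nat.reduceAdd, a0, a1, a2, b0, b1, b2, dlA, dlB]
  have e01 := sub_ne_zero.mpr h01
  have e02 := sub_ne_zero.mpr h02
  have e12 := sub_ne_zero.mpr h12
  have e10 := sub_ne_zero.mpr h01.symm
  have e20 := sub_ne_zero.mpr h02.symm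
  have e21 := sub_ne_zero.mpr h12.symm
  rw [← sub_eq_zero]
  generalize z i = x at *
  generalize z (i + 1) = y at *
  generalize z (i + 2) = t at *
  rw [← neg_sub y x, ← neg_sub t y] at *
  field_simp
  ring

theorem dl_comm {i j : ℕ} (h : i + 2 ≤ j) (f : MvPolynomial ℕ ℂ) :
    dl i (dl j f) = dl j (dl i f) := by
  apply mvPoly_ext
  intro r hr _
  generalize hz : (fun i => (r i : ℂ)) = z
  have hinj : Function.Injective z := hz ▸ Complex.ofReal_injective.comp hr
  have h1 : z i ≠ z (i + 1) := fun h => by simpa using hinj h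
  have h2 : z j ≠ z (j + 1) := fun h => by simpa using hinj h
  have a0 := comp_sw_of_gt (i := j) (k := i) (by omega) z
  have a1 := comp_sw_of_gt (i := j) (k := i + 1) (by omega) z
  have b0 := comp_sw_of_lt (i := i) (k := j) (by omega) z
  have b1 := comp_sw_of_lt (i := i) (k := j + 1) (by omega) z
  rw [eval_dl h1, eval_dl h2, eval_dl h2, eval_dl (by rwa [b0, b1]), eval_dl h1,
    eval_dl (by rwa [a0, a1]), comp_sw_comm h, a0, a1, b0, b1]
  ring

theorem dl_dl (i : ℕ) (f : MvPolynomial ℕ ℂ) :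
    dl i (dl i f) = (omega3 - omega3 ^ 2) • dl i f + f := by
  apply mvPoly_ext
  intro r hr _
  generalize hz : (fun i => (r i : ℂ)) = z
  have hinj : Function.Injective z := hz ▸ Complex.ofReal_injective.comp hr
  have h1 : z i ≠ z (i + 1) := fun h => by simpa using hinj h
  rw [map_add, MvPolynomial.smul_eval, eval_dl h1, eval_dl h1, eval_dl (by simpa using h1.symm),
    comp_sw_sw, comp_sw_self, comp_sw_succ, dlA, dlB, dlA, dlB]
  have e1 := sub_ne_zero.mpr h1
  rw [← neg_sub (z i) (z (i + 1))]
  field_simp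
  generalize z i = x at *
  generalize z (i + 1) = y at *
  linear_combination (x - y) ^ 2 * MvPolynomial.eval z f * omega3_cube

open MvPolynomial in
theorem rename_dl (e : Equiv.Perm ℕ) {i j : ℕ} (h1 : e i = j) (h2 : e (i + 1) = j + 1)
    (f : MvPolynomial ℕ ℂ) : rename e (dl i f) = dl j (rename e f) := by
  apply mvPoly_ext
  intro r hr _
  generalize hz : (fun i => (r i : ℂ)) = z
  have hinj : Function.Injective z := hz ▸ Complex.ofReal_injective.comp hr
  have h0 : z j ≠ z (j + 1) := fun h => by simpa using hinj h
  have h3 : (z ∘ e) ∘ sw i = (z ∘ sw j) ∘ e := by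
    funext k
    simp only [Function.comp_apply]
    rw [e.injective.map_swap, h1, h2]
  rw [eval_rename, eval_dl (by simpa [h1, h2] using h0), eval_dl h0, eval_rename, eval_rename, h3]
  simp [h1, h2]

open MvPolynomial in
theorem le_degreeOf_X_sub_X {i j : ℕ} (h : j = i ∨ j = i + 1) :
    1 ≤ degreeOf j (X i - X (i + 1) : MvPolynomial ℕ ℂ) := by
  have key : ∀ k : ℕ, k = i ∨ k = i + 1 →
      Finsupp.single k 1 ∈ (X i - X (i + 1) : MvPolynomial ℕ ℂ).support := by
    intro k hk
    rw [mem_support_iff, coeff_sub, coeff_X, coeff_X]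
    rcases hk with rfl | rfl <;> simp [Finsupp.single_left_inj]
  simpa using monomial_le_degreeOf j (key j h)

open MvPolynomial in
theorem degreeOf_dl_le {d : ℕ} (i : ℕ) {f : MvPolynomial ℕ ℂ} (hf : ∀ j, degreeOf j f ≤ d) (j : ℕ) :
    degreeOf j (dl i f) ≤ d := by
  by_cases h0 : dl i f = 0
  · simp [h0]
  have h1 := degreeOf_mul_eq (n := j) (X_sub_X_ne_zero i) h0
  rw [X_sub_X_mul_dl] at h1
  have hr : degreeOf j (rename (sw i) f) ≤ d := by
    have := degreeOf_rename_of_injective (p := f) (sw i).injective (sw i j)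
    rw [Equiv.swap_apply_self] at this
    rw [this]; exact hf _
  have hX : ∀ k, degreeOf j (X k : MvPolynomial ℕ ℂ) ≤ if j = k then 1 else 0 := by
    intro k; rw [degreeOf_X]
  have h2 : degreeOf j (C (-omega3) *
      ((X i - C omega3 * X (i + 1)) * rename (sw i) f + C (omega3 - 1) * X i * f)) ≤
      (if j = i ∨ j = i + 1 then 1 else 0) + d := by
    refine (degreeOf_C_mul_le _ _ _).trans ((degreeOf_add_le _ _ _).trans (max_le ?_ ?_))
    · refine (degreeOf_mul_le _ _ _).trans (add_le_add ((degreeOf_sub_le _ _ _).trans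
        (max_le ?_ ((degreeOf_C_mul_le _ _ _).trans ?_))) hr)
      · refine (hX i).trans ?_
        split_ifs <;> simp_all
      · refine (hX (i + 1)).trans ?_
        split_ifs <;> simp_all
    · refine (degreeOf_mul_le _ _ _).trans (add_le_add ((degreeOf_C_mul_le _ _ _).trans ?_) (hf j))
      refine (hX i).trans ?_
      split_ifs <;> simp_all
  by_cases h : j = i ∨ j = i + 1
  · rw [if_pos h] at h2
    have := le_degreeOf_X_sub_X h
    omega
  · rw [if_neg h] at h2
    omega

/-! ### Families of polynomials generated from the sorted configuration -/

/-- `dl o ∘ dl (o + 1) ∘ ⋯ ∘ dl (o + u - 1)`. -/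
def chain : ℕ → ℕ → MvPolynomial ℕ ℂ → MvPolynomial ℕ ℂ
  | _, 0, f => f
  | o, u + 1, f => dl o (chain (o + 1) u f)

/-- `dl (o + d - 1) ∘ ⋯ ∘ dl (o + 1) ∘ dl o`. -/
def chainDown (o : ℕ) : ℕ → MvPolynomial ℕ ℂ → MvPolynomial ℕ ℂ
  | 0, f => f
  | d + 1, f => dl (o + d) (chainDown o d f)

/-- The component at the configuration `s` on the sites `o, o + 1, …`, given the component at the
sorted configuration. -/
def spread : ℕ → List Bool → MvPolynomial ℕ ℂ → MvPolynomial ℕ ℂ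
  | _, [], f => f
  | o, true :: s, f => spread (o + 1) s f
  | o, false :: s, f => spread (o + 1) s (chain o (s.count true) f)

theorem chain_smul (o u : ℕ) (c : ℂ) (f : MvPolynomial ℕ ℂ) :
    chain o u (c • f) = c • chain o u f := by
  induction u generalizing o with
  | zero => rfl
  | succ u ih => simp [chain, ih]

theorem spread_smul (o : ℕ) (s : List Bool) (c : ℂ) (f : MvPolynomial ℕ ℂ) :
    spread o s (c • f) = c • spread o s f := by
  induction s generalizing o f with
  | nil => rfl
  | cons x s ih => cases x <;> simp [spread, ih, chain_smul]

theorem dl_chain_of_ge {o u j : ℕ} (h : o + u + 1 ≤ j) (f : MvPolynomial ℕ ℂ) :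
    dl j (chain o u f) = chain o u (dl j f) := by
  induction u generalizing o with
  | zero => rfl
  | succ u ih => rw [chain, ← dl_comm (by omega), ih (by omega), chain]

theorem dl_chain_of_le {o u j : ℕ} (h : j + 2 ≤ o) (f : MvPolynomial ℕ ℂ) :
    dl j (chain o u f) = chain o u (dl j f) := by
  induction u generalizing o with
  | zero => rfl
  | succ u ih => rw [chain, dl_comm (by omega), ih (by omega), chain]

theorem dl_succ_chain {o u j : ℕ} (h1 : o ≤ j) (h2 : j + 2 ≤ o + u) (f : MvPolynomial ℕ ℂ) :
    dl (j + 1) (chain o u f) = chain o u (dl j f) := by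
  induction u generalizing o with
  | zero => omega
  | succ u ih =>
    rcases h1.eq_or_lt with rfl | h1
    · obtain ⟨u, rfl⟩ : ∃ u', u = u' + 1 := ⟨u - 1, by omega⟩
      rw [chain, chain, ← dl_braid, dl_chain_of_le (by omega), chain, chain]
    · rw [chain, ← dl_comm (by omega), ih h1 (by omega), chain]

theorem dl_chain_chain (o u : ℕ) (f : MvPolynomial ℕ ℂ) :
    dl o (chain (o + 1) u (chain o u f)) = chain (o + 1) u (chain o u (dl (o + u) f)) := by
  induction u generalizing o with
  | zero => rfl
  | succ u ih =>
    simp only [chain]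
    rw [← dl_chain_of_le (by omega), dl_braid, ih, dl_chain_of_le (by omega),
      show o + (u + 1) = o + 1 + u by ring]

theorem dl_spread {o j : ℕ} (h : j + 2 ≤ o) (s : List Bool) (f : MvPolynomial ℕ ℂ) :
    dl j (spread o s f) = spread o s (dl j f) := by
  induction s generalizing o f with
  | nil => rfl
  | cons x s ih =>
    cases x
    · rw [spread, ih (by omega), dl_chain_of_le h, spread]
    · rw [spread, ih (by omega), spread]

/-- Sufficient symmetry of the component at the sorted configuration `↑^u ↓^d`. -/
def Sorted (o u d : ℕ) (f : MvPolynomial ℕ ℂ) : Prop :=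
  (∀ j, o ≤ j → j + 1 < o + u → dl j f = omega3 • f) ∧
    ∀ j, o + u ≤ j → j + 1 < o + u + d → dl j f = omega3 • f

theorem Sorted.tail_up {o u d : ℕ} {f : MvPolynomial ℕ ℂ} (h : Sorted o (u + 1) d f) :
    Sorted (o + 1) u d f :=
  ⟨fun j h1 h2 => h.1 j (by omega) (by omega), fun j h1 h2 => h.2 j (by omega) (by omega)⟩

theorem Sorted.tail_down {o u d : ℕ} {f : MvPolynomial ℕ ℂ} (h : Sorted o u (d + 1) f) :
    Sorted (o + 1) u d (chain o u f) := by
  refine ⟨fun j h1 h2 => ?_, fun j h1 h2 => ?_⟩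
  · obtain ⟨j, rfl⟩ : ∃ j', j = j' + 1 := ⟨j - 1, by omega⟩
    rw [dl_succ_chain (by omega) (by omega), h.1 j (by omega) (by omega), chain_smul]
  · rw [dl_chain_of_ge (by omega), h.2 j (by omega) (by omega), chain_smul]

theorem dl_spread_swap (o : ℕ) (l r : List Bool) (f : MvPolynomial ℕ ℂ) :
    dl (o + l.length) (spread o (l ++ true :: false :: r) f) =
      spread o (l ++ false :: true :: r) f := by
  induction l generalizing o f with
  | nil =>
    simp only [List.length_nil, List.nil_append, spread, List.count_cons, add_zero]
    rw [dl_spread (by omega)]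
    simp [chain]
  | cons x l ih =>
    have hc : (l ++ true :: false :: r).count true = (l ++ false :: true :: r).count true := by
      simp
    cases x
    · have := ih (o + 1) (chain o ((l ++ true :: false :: r).count true) f)
      simp only [List.cons_append, spread, List.length_cons, ← hc]
      rw [← this]
      congr 2
      ring
    · have := ih (o + 1) f
      simp only [List.cons_append, spread, List.length_cons]
      rw [← this]
      congr 2
      ring

theorem dl_spread_same (o : ℕ) (l r : List Bool) (x : Bool) (f : MvPolynomial ℕ ℂ)
    (hf : Sorted o ((l ++ x :: x :: r).count true) ((l ++ x :: x :: r).count false) f) :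
    dl (o + l.length) (spread o (l ++ x :: x :: r) f) =
      omega3 • spread o (l ++ x :: x :: r) f := by
  induction l generalizing o f with
  | nil =>
    cases x
    · simp only [List.length_nil, List.nil_append, spread, List.count_cons, add_zero] at hf ⊢
      rw [dl_spread (by omega), ← spread_smul]
      congr 1
      simp only [beq_iff_eq, Bool.false_eq_true, if_false, add_zero, if_true] at hf ⊢
      rw [dl_chain_chain, hf.2 _ (by omega) (by omega), chain_smul, chain_smul]
    · simp only [List.length_nil, List.nil_append, spread, List.count_cons, add_zero] at hf ⊢
      rw [dl_spread (by omega), ← spread_smul]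
      congr 1
      simp only [beq_iff_eq, if_true] at hf
      exact hf.1 _ (by omega) (by omega)
  | cons y l ih =>
    have e : o + (l.length + 1) = o + 1 + l.length := by ring
    cases y
    · simp only [List.cons_append, spread, List.length_cons, e]
      apply ih
      apply Sorted.tail_down
      simpa [List.count_cons] using hf
    · simp only [List.cons_append, spread, List.length_cons, e]
      apply ih
      apply Sorted.tail_up
      simpa [List.count_cons] using hf

/-- Families of polynomials indexed by configurations of `L` sites, starting at site `o`, in which
neighbouring `↑↓` are exchanged by the operators `dl`. -/
def ExchFamily (o L : ℕ) (Φ : List Bool → MvPolynomial ℕ ℂ) : Prop :=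
  ∀ l r : List Bool, l.length + r.length + 2 = L →
    dl (o + l.length) (Φ (l ++ true :: false :: r)) = Φ (l ++ false :: true :: r)

theorem ExchFamily.chain_eq {o L : ℕ} {Φ : List Bool → MvPolynomial ℕ ℂ} (h : ExchFamily o L Φ)
    (u : ℕ) (l r : List Bool) (hL : l.length + u + 1 + r.length = L) :
    Φ (l ++ false :: (List.replicate u true ++ r)) =
      chain (o + l.length) u (Φ (l ++ (List.replicate u true ++ false :: r))) := by
  induction u generalizing l with
  | zero => simp [chain]
  | succ u ih =>
    have h1 := h l (List.replicate u true ++ r) (by simp; omega)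
    have h2 := ih (l ++ [true]) (by simp; omega)
    simp only [List.replicate_succ, List.cons_append, chain]
    rw [← h1]
    simp at h2
    rw [h2]
    simp [add_assoc]

theorem ExchFamily.chainDown_eq {o L : ℕ} {Φ : List Bool → MvPolynomial ℕ ℂ}
    (h : ExchFamily o L Φ) (d : ℕ) (l r : List Bool) (hL : l.length + d + 1 + r.length = L) :
    Φ (l ++ (List.replicate d false ++ true :: r)) =
      chainDown (o + l.length) d (Φ (l ++ true :: (List.replicate d false ++ r))) := by
  induction d generalizing r with
  | zero => simp [chainDown]
  | succ d ih =>
    have h1 := h (l ++ List.replicate d false) r (by simp; omega)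
    have h2 := ih (false :: r) (by simp; omega)
    simp only [chainDown, List.replicate_succ', List.append_assoc, List.singleton_append]
    simp only [List.append_assoc, List.length_append, List.length_replicate] at h1
    rw [← h1, h2]
    simp [add_assoc]

theorem ExchFamily.eq_spread {o L : ℕ} {Φ : List Bool → MvPolynomial ℕ ℂ} (h : ExchFamily o L Φ)
    (s : List Bool) (hs : s.length = L) :
    Φ s = spread o s (Φ (List.replicate (s.count true) true ++
      List.replicate (s.count false) false)) := by
  induction s generalizing o L Φ with
  | nil => simp [spread]
  | cons x s ih =>
    have h' : ExchFamily (o + 1) s.length (fun t => Φ (x :: t)) := by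
      intro l r hlr
      have := h (x :: l) r (by simp at hs ⊢; omega)
      simpa [add_assoc, add_comm 1] using this
    have h1 := ih h' rfl
    cases x
    · rw [h1, spread]
      have h2 := h.chain_eq (s.count true) [] (List.replicate (s.count false) false)
        (by have := List.count_true_add_count_false s; simp at hs ⊢; omega)
      simp only [List.nil_append, List.length_nil, add_zero] at h2
      rw [h2]
      simp [List.replicate_succ]
    · rw [h1, spread]
      simp [List.replicate_succ]

/-! ### The sorted component -/

theorem exchange_of_dl_eq {i : ℕ} {f : MvPolynomial ℕ ℂ} (h : dl i f = omega3 • f) (z : ℕ → ℂ) :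
    (z i - omega3 * z (i + 1)) * MvPolynomial.eval (z ∘ sw i) f =
      (z (i + 1) - omega3 * z i) * MvPolynomial.eval z f := by
  have h1 := congrArg (MvPolynomial.eval z) (X_sub_X_mul_dl i f)
  rw [h] at h1
  simp only [map_mul, map_sub, map_add, MvPolynomial.eval_X, MvPolynomial.eval_C,
    MvPolynomial.eval_rename, map_neg, map_one, MvPolynomial.smul_eval] at h1
  apply mul_left_cancel₀ omega3_ne_zero
  linear_combination h1

theorem dl_eq_of_exchange {i : ℕ} {f : MvPolynomial ℕ ℂ}
    (h : ∀ z : ℕ → ℂ, (z i - omega3 * z (i + 1)) * MvPolynomial.eval (z ∘ sw i) f =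
      (z (i + 1) - omega3 * z i) * MvPolynomial.eval z f) : dl i f = omega3 • f := by
  apply mvPoly_ext
  intro r hr _
  generalize hz : (fun i => (r i : ℂ)) = z
  have hinj : Function.Injective z := hz ▸ Complex.ofReal_injective.comp hr
  have h0 : z i ≠ z (i + 1) := fun h => by simpa using hinj h
  have h1 := sub_ne_zero.mpr h0
  rw [eval_dl h0, MvPolynomial.smul_eval, dlA, dlB]
  field_simp
  linear_combination -omega3 * h z

/-- The product of `x i - q * x j` over `i < j < m`. -/
def tri {R : Type*} [CommRing R] (q : R) (m : ℕ) (x : ℕ → R) : R :=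
  ∏ j ∈ Finset.range m, ∏ i ∈ Finset.range j, (x i - q * x j)

section tri
variable {R : Type*} [CommRing R] (q : R)

theorem tri_succ (m : ℕ) (x : ℕ → R) :
    tri q (m + 1) x = tri q m x * ∏ i ∈ Finset.range m, (x i - q * x m) := by
  rw [tri, Finset.prod_range_succ]; rfl

theorem tri_succ' (m : ℕ) (x : ℕ → R) :
    tri q (m + 1) x =
      (∏ j ∈ Finset.range m, (x 0 - q * x (j + 1))) * tri q m (fun i => x (i + 1)) := by
  rw [tri, Finset.prod_range_succ', tri, ← Finset.prod_mul_distrib]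
  simp only [Finset.range_zero, Finset.prod_empty, mul_one]
  refine Finset.prod_congr rfl fun j _ => ?_
  rw [Finset.prod_range_succ', mul_comm]

theorem tri_congr {m : ℕ} {x y : ℕ → R} (h : ∀ i < m, x i = y i) : tri q m x = tri q m y := by
  refine Finset.prod_congr rfl fun j hj => Finset.prod_congr rfl fun i hi => ?_
  simp only [Finset.mem_range] at hi hj
  rw [h i (by omega), h j hj]

theorem tri_eq_zero {m i j : ℕ} {x : ℕ → R} (hij : i < j) (hj : j < m) (h : x i = q * x j) :
    tri q m x = 0 := by
  refine Finset.prod_eq_zero (Finset.mem_range.mpr hj) ?_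
  exact Finset.prod_eq_zero (Finset.mem_range.mpr hij) (by rw [h, sub_self])

theorem map_tri {S : Type*} [CommRing S] (φ : R →+* S) (m : ℕ) (x : ℕ → R) :
    φ (tri q m x) = tri (φ q) m (fun i => φ (x i)) := by
  simp [tri, map_prod]

theorem prod_range_comp_sw {m j : ℕ} (h : j + 1 < m) (g : ℕ → R) :
    ∏ i ∈ Finset.range m, g (sw j i) = ∏ i ∈ Finset.range m, g i := by
  refine Equiv.Perm.prod_comp (sw j) _ g ?_
  intro a ha
  simp only [Set.mem_ofPred_eq, Finset.coe_range, Set.mem_Iio] at ha ⊢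
  by_contra hc
  exact ha (Equiv.swap_apply_of_ne_of_ne (by omega) (by omega))

theorem tri_comp_sw {m j : ℕ} (h : j + 1 < m) (x : ℕ → R) :
    (x j - q * x (j + 1)) * tri q m (x ∘ sw j) = (x (j + 1) - q * x j) * tri q m x := by
  induction m with
  | zero => omega
  | succ m ih =>
    rcases Nat.lt_succ_iff_lt_or_eq.mp h with h | rfl
    · rw [tri_succ, tri_succ, ← mul_assoc, ih h, comp_sw_of_lt h]
      have := prod_range_comp_sw h (fun i => x i - q * x m)
      simp only [Function.comp_apply]
      rw [this]
      ring
    · have h1 : ∀ y : ℕ → R, tri q (j + 1 + 1) y =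
          tri q j y * (∏ i ∈ Finset.range j, (y i - q * y j)) *
          (∏ i ∈ Finset.range j, (y i - q * y (j + 1))) * (y j - q * y (j + 1)) := by
        intro y
        rw [tri_succ, tri_succ, Finset.prod_range_succ]
        ring
      have h2 : tri q j (x ∘ sw j) = tri q j x := tri_congr q fun i hi => comp_sw_of_gt hi x
      have h3 : ∀ c : R, ∏ i ∈ Finset.range j, ((x ∘ sw j) i - q * c) =
          ∏ i ∈ Finset.range j, (x i - q * c) := fun c =>
        Finset.prod_congr rfl fun i hi => by rw [comp_sw_of_gt (Finset.mem_range.mp hi)]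
      rw [h1, h1, h2, h3, h3, comp_sw_self, comp_sw_succ]
      ring

end tri

/-- The component at `↑ⁿ↓ⁿ`. -/
def gpoly (n : ℕ) : MvPolynomial ℕ ℂ :=
  tri (MvPolynomial.C omega3) n MvPolynomial.X *
    tri (MvPolynomial.C omega3) n (fun i => MvPolynomial.X (n + i))

theorem eval_gpoly (n : ℕ) (z : ℕ → ℂ) :
    MvPolynomial.eval z (gpoly n) = tri omega3 n z * tri omega3 n (fun i => z (n + i)) := by
  simp [gpoly, map_tri]

theorem sorted_gpoly (n : ℕ) : Sorted 0 n n (gpoly n) := by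
  refine ⟨fun j _ h => dl_eq_of_exchange fun z => ?_, fun j h1 h2 => dl_eq_of_exchange fun z => ?_⟩
  · have h1 := tri_comp_sw omega3 (m := n) (j := j) (by omega) z
    have h2 : tri omega3 n (fun i => (z ∘ sw j) (n + i)) = tri omega3 n (fun i => z (n + i)) :=
      tri_congr _ fun i _ => comp_sw_of_lt (by omega) z
    rw [eval_gpoly, eval_gpoly, h2]
    linear_combination tri omega3 n (fun i => z (n + i)) * h1
  · obtain ⟨j, rfl⟩ : ∃ j', j = n + j' := ⟨j - n, by omega⟩
    have h3 := tri_comp_sw omega3 (m := n) (j := j) (by omega) (fun i => z (n + i))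
    have h4 : tri omega3 n (z ∘ sw (n + j)) = tri omega3 n z :=
      tri_congr _ fun i _ => comp_sw_of_gt (by omega) z
    have h5 : (fun i => (z ∘ sw (n + j)) (n + i)) = (fun i => z (n + i)) ∘ sw j := by
      funext i
      simp only [Function.comp_apply, Equiv.swap_apply_def]
      congr 1
      split_ifs <;> omega
    rw [eval_gpoly, eval_gpoly, h4, h5]
    linear_combination tri omega3 n z * h3

open MvPolynomial in
theorem degreeOf_tri_le (o m j : ℕ) :
    degreeOf j (tri (C omega3) m (fun i => X (o + i)) : MvPolynomial ℕ ℂ) ≤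
      if o ≤ j ∧ j < o + m then m - 1 else 0 := by
  have hfac : ∀ a b : ℕ, degreeOf j (X a - C omega3 * X b : MvPolynomial ℕ ℂ) ≤
      if j = a ∨ j = b then 1 else 0 := by
    intro a b
    refine (degreeOf_sub_le _ _ _).trans (max_le ?_ ((degreeOf_C_mul_le _ _ _).trans ?_)) <;>
    · rw [degreeOf_X]
      split_ifs <;> simp_all
  induction m with
  | zero => simp [tri, degreeOf_one]
  | succ m ih =>
    rw [tri_succ]
    refine (degreeOf_mul_le _ _ _).trans ((add_le_add ih ((degreeOf_prod_le _ _ _).trans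
      (Finset.sum_le_sum fun a _ => hfac (o + a) (o + m)))).trans ?_)
    by_cases h1 : j = o + m
    · subst h1
      simp
    · have e : ∀ a, (j = o + a ∨ j = o + m) ↔ (o ≤ j ∧ a = j - o) := by intro a; omega
      simp only [e]
      by_cases h2 : o ≤ j
      · simp only [h2, true_and, Finset.sum_ite_eq', Finset.mem_range]
        split_ifs <;> omega
      · simp [h2]

theorem degreeOf_gpoly_le (n j : ℕ) : MvPolynomial.degreeOf j (gpoly n) ≤ n - 1 := by
  refine (MvPolynomial.degreeOf_mul_le _ _ _).trans ?_
  have h1 := degreeOf_tri_le 0 n j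
  have h2 := degreeOf_tri_le n n j
  simp only [zero_add] at h1
  refine (add_le_add h1 h2).trans ?_
  split_ifs <;> omega

theorem degreeOf_chain_le {d : ℕ} (o u : ℕ) {f : MvPolynomial ℕ ℂ}
    (hf : ∀ j, MvPolynomial.degreeOf j f ≤ d) (j : ℕ) :
    MvPolynomial.degreeOf j (chain o u f) ≤ d := by
  induction u generalizing o j with
  | zero => exact hf j
  | succ u ih => exact degreeOf_dl_le o (ih (o + 1)) j

open MvPolynomial in
theorem exists_restrict (f : MvPolynomial ℕ ℂ) (z : ℕ → ℂ) (i : ℕ) :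
    ∃ p : Polynomial ℂ, p.natDegree ≤ degreeOf i f ∧
      ∀ t, p.eval t = eval (Function.update z i t) f := by
  refine ⟨aeval (fun j => if j = i then Polynomial.X else Polynomial.C (z j)) f, ?_, fun t => ?_⟩
  · rw [aeval_def, eval₂_eq]
    refine Polynomial.natDegree_sum_le_of_forall_le _ _ fun m hm => ?_
    refine (Polynomial.natDegree_C_mul_le _ _).trans ?_
    refine (Polynomial.natDegree_prod_le _ _).trans ?_
    refine (Finset.sum_le_sum (g := fun j => if j = i then m i else 0) fun j _ => ?_).trans ?_
    · by_cases hj : j = i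
      · subst hj; simp
      · simp only [if_neg hj, ← Polynomial.C_pow, Polynomial.natDegree_C, le_refl]
    · rw [Finset.sum_ite_eq']
      split_ifs
      · exact monomial_le_degreeOf i hm
      · exact Nat.zero_le _
  · have : (Polynomial.evalRingHom t).comp
        (aeval (R := ℂ) (fun j => if j = i then Polynomial.X else Polynomial.C (z j))).toRingHom =
        eval (Function.update z i t) := by
      apply MvPolynomial.ringHom_ext
      · intro c; simp
      · intro j
        by_cases hj : j = i <;> simp [hj]
    exact congrArg (fun φ => φ f) this

open MvPolynomial in
/-- A polynomial of degree at most `d` in the variable `i` with more than `d` zeros in that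
variable vanishes. -/
theorem eval_update_eq_zero {f : MvPolynomial ℕ ℂ} {i d : ℕ} (hd : degreeOf i f ≤ d)
    (z : ℕ → ℂ) (S : Finset ℂ) (hS : d < S.card)
    (h : ∀ t ∈ S, eval (Function.update z i t) f = 0) (t : ℂ) :
    eval (Function.update z i t) f = 0 := by
  obtain ⟨p, hdeg, hev⟩ := exists_restrict f z i
  have : p = 0 := by
    refine Polynomial.eq_zero_of_natDegree_lt_card_of_eval_eq_zero' p S (fun t ht => ?_)
      (by omega)
    rw [hev]; exact h t ht
  rw [← hev, this, Polynomial.eval_zero]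

/-! ### Rotation of the variables -/

theorem omega3_mul_ofReal_ne {x y : ℝ} (hx : 0 < x) (hy : 0 < y) : omega3 * x ≠ y := by
  intro h
  have h1 := congrArg norm h
  rw [norm_mul, norm_omega3, one_mul, Complex.norm_of_nonneg hx.le,
    Complex.norm_of_nonneg hy.le] at h1
  rw [h1] at h
  have h2 : (y : ℂ) ≠ 0 := by exact_mod_cast hy.ne'
  exact omega3_ne_one (mul_right_cancel₀ h2 (h.trans (one_mul _).symm))

theorem omega3_sq_mul_ofReal_ne {x y : ℝ} (hx : 0 < x) (hy : 0 < y) : omega3 ^ 2 * x ≠ y := by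
  intro h
  refine omega3_mul_ofReal_ne hy hx ?_
  rw [← h]
  linear_combination (x : ℂ) * omega3_cube

/-- The point with the coordinate `o` moved `u` places to the right. -/
def shiftPt : ℕ → ℕ → (ℕ → ℂ) → ℕ → ℂ
  | _, 0, z => z
  | o, u + 1, z => shiftPt (o + 1) u (z ∘ sw o)

theorem shiftPt_of_lt {o u i : ℕ} (h : i < o) (z : ℕ → ℂ) : shiftPt o u z i = z i := by
  induction u generalizing o z with
  | zero => rfl
  | succ u ih => rw [shiftPt, ih (by omega), comp_sw_of_gt h]

theorem shiftPt_of_gt {o u i : ℕ} (h : o + u < i) (z : ℕ → ℂ) : shiftPt o u z i = z i := by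
  induction u generalizing o z with
  | zero => rfl
  | succ u ih => rw [shiftPt, ih (by omega), comp_sw_of_lt (by omega)]

theorem shiftPt_of_mem {o u i : ℕ} (h1 : o ≤ i) (h2 : i < o + u) (z : ℕ → ℂ) :
    shiftPt o u z i = z (i + 1) := by
  induction u generalizing o z with
  | zero => omega
  | succ u ih =>
    rw [shiftPt]
    rcases Nat.eq_or_lt_of_le h1 with rfl | h1
    · rw [shiftPt_of_lt (by omega), comp_sw_self]
    · rw [ih h1 (by omega), comp_sw_of_lt (by omega)]

theorem shiftPt_last (o u : ℕ) (z : ℕ → ℂ) : shiftPt o u z (o + u) = z o := by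
  induction u generalizing o z with
  | zero => rfl
  | succ u ih =>
    rw [shiftPt, show o + (u + 1) = o + 1 + u by omega, ih, comp_sw_succ]

open MvPolynomial in
theorem eval_chain_of_eq_zero (o u : ℕ) (f : MvPolynomial ℕ ℂ) (z : ℕ → ℂ) (h0 : z o = 0)
    (h : ∀ i, o < i → i ≤ o + u → z i ≠ 0) :
    eval z (chain o u f) = (-omega3 ^ 2) ^ u * eval (shiftPt o u z) f := by
  induction u generalizing o z with
  | zero => simp [chain, shiftPt]
  | succ u ih =>
    have h1 : z (o + 1) ≠ 0 := h _ (by omega) (by omega)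
    rw [chain, shiftPt, eval_dl (by rw [h0]; exact h1.symm), ih, h0, pow_succ]
    · simp only [dlA, dlB]
      field_simp
      ring
    · rw [comp_sw_succ, h0]
    · intro i hi hi'
      rw [comp_sw_of_lt hi]
      exact h i (by omega) (by omega)

open MvPolynomial in
theorem eval_chain_gpoly_eq_zero {n o u : ℕ} (ho : 1 ≤ o) (hu : o + u ≤ n) {z : ℕ → ℂ}
    (hz : Function.Injective z) {k j : ℕ} (hk : 1 ≤ k) (hkn : k ≤ n) (hzk : z 0 = omega3 * z k)
    (hj : n < j) (hjn : j < 2 * n) (hzj : z j = omega3 * z 0) :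
    eval z (chain o u (gpoly n)) = 0 := by
  induction u generalizing o z k with
  | zero =>
    rw [chain, eval_gpoly]
    rcases Nat.lt_or_eq_of_le hkn with hkn | rfl
    · rw [tri_eq_zero omega3 (i := 0) (j := k) (by omega) hkn hzk, zero_mul]
    · rw [mul_comm, tri_eq_zero omega3 (i := 0) (j := j - k) (by omega) (by omega), zero_mul]
      simp only [add_zero]
      rw [show k + (j - k) = j by omega, hzj, hzk]
      linear_combination -z k * omega3_cube
  | succ u ih =>
    have h0 : z o ≠ z (o + 1) := fun h => by simpa using hz h
    have h1 : eval (z ∘ sw o) (chain (o + 1) u (gpoly n)) = 0 := by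
      refine ih (k := sw o k) (by omega) (by omega) (hz.comp (sw o).injective) ?_ ?_ ?_ ?_
      · simp only [Equiv.swap_apply_def]; split_ifs <;> omega
      · simp only [Equiv.swap_apply_def]; split_ifs <;> omega
      · rw [comp_sw_of_gt (k := 0) (by omega), hzk]; simp
      · rw [comp_sw_of_gt (k := 0) (by omega), comp_sw_of_lt (k := j) (by omega), hzj]
    rw [chain, eval_dl h0, ih (by omega) (by omega) hz hk hkn hzk hzj, h1]
    ring

open MvPolynomial in
theorem eval_eq_zero_of_exchange {n : ℕ} {h : MvPolynomial ℕ ℂ}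
    (hh : ∀ i, 1 ≤ i → i < n → dl i h = omega3 • h) {k : ℕ} (hk : 2 ≤ k) (hkn : k ≤ n) {z : ℕ → ℂ}
    (hz : ∀ i, 2 ≤ i → ∃ r : ℝ, 0 < r ∧ (r : ℂ) = z i) (h1 : z 1 = omega3 * z k) :
    eval z h = 0 := by
  induction k, hk using Nat.le_induction generalizing z with
  | base =>
    have e := exchange_of_dl_eq (hh 1 le_rfl (by omega)) z
    obtain ⟨r, hr, hrz⟩ := hz 2 le_rfl
    rw [h1, sub_self, zero_mul, eq_comm, mul_eq_zero, ← hrz] at e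
    refine e.resolve_left fun e => omega3_sq_mul_ofReal_ne hr hr ?_
    linear_combination -e
  | succ k hk ih =>
    have e := exchange_of_dl_eq (hh k (by omega) (by omega)) z
    rw [ih (by omega), mul_zero, eq_comm, mul_eq_zero] at e
    · obtain ⟨r, hr, hrz⟩ := hz k hk
      obtain ⟨r', hr', hrz'⟩ := hz (k + 1) (by omega)
      refine e.resolve_left fun e => ?_
      rw [← hrz, ← hrz', sub_eq_zero] at e
      exact omega3_mul_ofReal_ne hr hr' e.symm
    · intro i hi
      refine (hz (sw k i) ?_).imp fun r hr => hr
      simp only [Equiv.swap_apply_def]; split_ifs <;> omega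
    · rw [comp_sw_of_gt (by omega), comp_sw_self, h1]

theorem injective_update {z : ℕ → ℂ} {k : ℕ} {c : ℂ} (hz : Function.Injective z)
    (hc : ∀ i, z i ≠ c) : Function.Injective (Function.update z k c) := by
  intro i j hij
  simp only [Function.update_apply] at hij
  split_ifs at hij with h1 h2 h2
  · rw [h1, h2]
  · exact absurd hij.symm (hc j)
  · exact absurd hij (hc i)
  · exact hz hij

/-- The cyclic permutation of the variables `0, …, N - 1`. -/
def rotPerm (N : ℕ) : Equiv.Perm ℕ where
  toFun i := if i + 1 < N then i + 1 else if i + 1 = N then 0 else i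
  invFun i := if i = 0 then N - 1 else if i < N then i - 1 else i
  left_inv i := by
    dsimp only
    grind
  right_inv i := by
    dsimp only
    grind

theorem rotPerm_of_lt {N i : ℕ} (h : i + 1 < N) : rotPerm N i = i + 1 := if_pos h

theorem rotPerm_last {N i : ℕ} (h : i + 1 = N) : rotPerm N i = 0 := by
  change (if i + 1 < N then i + 1 else if i + 1 = N then 0 else i) = 0
  rw [if_neg (by omega), if_pos h]

open MvPolynomial in
theorem eval_chain_gpoly_update_eq_zero {n : ℕ} {r : ℕ → ℝ} (hr : Function.Injective r)
    (hpos : ∀ i, 0 < r i) {j : ℕ} (hj : n < j) (hjn : j < 2 * n) :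
    eval (Function.update (fun i => (r i : ℂ)) 0 (omega3 ^ 2 * r j)) (chain 0 n (gpoly n)) = 0 := by
  set z : ℕ → ℂ := fun i => (r i : ℂ) with hz
  have hinj : Function.Injective z := Complex.ofReal_injective.comp hr
  set z' := Function.update z 0 (omega3 ^ 2 * r j) with hz'
  have hinj' : Function.Injective z' :=
    injective_update hinj fun i => (omega3_sq_mul_ofReal_ne (hpos j) (hpos i)).symm
  have h0 : ∀ t, Function.update z' 1 t 0 = omega3 ^ 2 * r j := fun t => by
    rw [Function.update_of_ne (by omega), hz', Function.update_self]
  have h1 : ∀ t i, 2 ≤ i → Function.update z' 1 t i = r i := fun t i hi => by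
    rw [Function.update_of_ne (by omega), hz', Function.update_of_ne (by omega)]
  have hne : (r j : ℂ) ≠ 0 := by exact_mod_cast (hpos j).ne'
  have key := eval_update_eq_zero (degreeOf_chain_le 0 n (degreeOf_gpoly_le n) 1) z'
    ((insert j (Finset.Icc 2 n)).image fun k => omega3 * (r k : ℂ)) ?_ ?_ (z' 1)
  · rwa [Function.update_eq_self] at key
  · rw [Finset.card_image_of_injective, Finset.card_insert_of_notMem, Nat.card_Icc]
    · omega
    · simp only [Finset.mem_Icc]; omega
    · intro a b hab
      exact hinj (mul_left_cancel₀ omega3_ne_zero hab)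
  · intro t ht
    simp only [Finset.mem_image, Finset.mem_insert, Finset.mem_Icc] at ht
    obtain ⟨k, hk, rfl⟩ := ht
    rcases hk with rfl | ⟨hk2, hkn⟩
    · obtain ⟨m, rfl⟩ : ∃ m, n = m + 1 := ⟨n - 1, by omega⟩
      have hw : Function.update z' 1 (omega3 * (r k : ℂ)) 1 = omega3 * r k :=
        Function.update_self ..
      have hne' : omega3 ^ 2 * (r k : ℂ) ≠ omega3 * r k := by
        intro h
        refine omega3_mul_ofReal_ne (hpos k) (hpos k) (mul_left_cancel₀ omega3_ne_zero ?_)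
        linear_combination h
      have hinj2 : Function.Injective (Function.update z' 1 (omega3 * (r k : ℂ))) := by
        refine injective_update hinj' fun i => ?_
        rw [hz', Function.update_apply]
        split_ifs
        · exact hne'
        · exact (omega3_mul_ofReal_ne (hpos k) (hpos i)).symm
      rw [chain, eval_dl (by rw [h0, hw]; exact hne'),
        eval_chain_gpoly_eq_zero (k := 1) (j := k) le_rfl (by omega) hinj2 le_rfl (by omega) ?_
          hj hjn ?_, h0, hw, dlA]
      · simp only [zero_add]
        ring
      · rw [h0, hw]; ring
      · rw [h0, h1 _ _ (by omega)]
        linear_combination -(r k : ℂ) * omega3_cube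
    · refine eval_eq_zero_of_exchange (n := n) (k := k) ?_ hk2 hkn ?_ ?_
      · intro i hi hin
        obtain ⟨i, rfl⟩ : ∃ i', i = i' + 1 := ⟨i - 1, by omega⟩
        rw [dl_succ_chain (by omega) (by omega), (sorted_gpoly n).1 i (by omega) (by omega),
          chain_smul]
      · exact fun i hi => ⟨r i, hpos i, (h1 _ i hi).symm⟩
      · rw [Function.update_self, h1 _ k hk2]

open MvPolynomial in
theorem chain_gpoly {n : ℕ} (hn : 1 ≤ n) :
    chain 0 n (gpoly n) = (-omega3 ^ 2) • rename (rotPerm (2 * n)) (gpoly n) := by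
  obtain ⟨m, rfl⟩ : ∃ m, n = m + 1 := ⟨n - 1, by omega⟩
  apply mvPoly_ext
  intro r hr hpos
  set z : ℕ → ℂ := fun i => (r i : ℂ) with hz
  have hinj : Function.Injective z := Complex.ofReal_injective.comp hr
  have hup : ∀ t i, 1 ≤ i → Function.update z 0 t i = z i := fun t i hi =>
    Function.update_of_ne (by omega) ..
  have h0 : ∀ t, Function.update z 0 t 0 = t := fun t => Function.update_self ..
  have hrot : ∀ t, eval (Function.update z 0 t) (rename (rotPerm (2 * (m + 1))) (gpoly (m + 1))) =
      tri omega3 (m + 1) (fun i => z (i + 1)) *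
        (tri omega3 m (fun i => z (m + 2 + i)) *
          ∏ i ∈ Finset.range m, (z (m + 2 + i) - omega3 * t)) := by
    intro t
    rw [eval_rename, eval_gpoly, tri_succ _ m
      (fun i => (Function.update z 0 t ∘ rotPerm (2 * (m + 1))) (m + 1 + i))]
    have e : ∀ i < m, (Function.update z 0 t ∘ rotPerm (2 * (m + 1))) (m + 1 + i) =
        z (m + 2 + i) := by
      intro i hi
      rw [Function.comp_apply, rotPerm_of_lt (by omega), hup _ _ (by omega)]
      congr 1; omega
    have e' : (Function.update z 0 t ∘ rotPerm (2 * (m + 1))) (m + 1 + m) = t := by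
      rw [Function.comp_apply, rotPerm_last (by omega), h0]
    rw [e']
    congr 1
    · refine tri_congr _ fun i hi => ?_
      rw [Function.comp_apply, rotPerm_of_lt (by omega), hup _ _ (by omega)]
    · congr 1
      · exact tri_congr _ e
      · exact Finset.prod_congr rfl fun i hi => by rw [e i (Finset.mem_range.mp hi)]
  rw [← sub_eq_zero, ← map_sub]
  have key := eval_update_eq_zero (f := chain 0 (m + 1) (gpoly (m + 1)) -
      (-omega3 ^ 2) • rename (rotPerm (2 * (m + 1))) (gpoly (m + 1))) (i := 0) (d := m) ?_ z
    (insert 0 ((Finset.Ico (m + 2) (2 * (m + 1))).image fun j => omega3 ^ 2 * (r j : ℂ)))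
    ?_ ?_ (z 0)
  · rwa [Function.update_eq_self] at key
  · refine (degreeOf_sub_le _ _ _).trans (max_le ?_ ?_)
    · exact degreeOf_chain_le 0 _ (degreeOf_gpoly_le _) 0
    · rw [MvPolynomial.smul_eq_C_mul]
      refine (degreeOf_C_mul_le _ _ _).trans ?_
      have := degreeOf_rename_of_injective (p := gpoly (m + 1)) (rotPerm (2 * (m + 1))).injective
        ((rotPerm (2 * (m + 1))).symm 0)
      rw [Equiv.apply_symm_apply] at this
      rw [this]
      exact degreeOf_gpoly_le _ _
  · rw [Finset.card_insert_of_notMem, Finset.card_image_of_injective, Nat.card_Ico]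
    · omega
    · intro a b hab
      exact hinj (mul_left_cancel₀ (pow_ne_zero 2 omega3_ne_zero) hab)
    · simp only [Finset.mem_image, not_exists, not_and]
      intro j _ h
      have : (r j : ℂ) ≠ 0 := by exact_mod_cast (hpos j).ne'
      exact mul_ne_zero (pow_ne_zero 2 omega3_ne_zero) this h
  · intro t ht
    rw [Finset.mem_insert, Finset.mem_image] at ht
    rw [map_sub, MvPolynomial.smul_eval, hrot]
    rcases ht with rfl | ⟨j, hj, rfl⟩
    · rw [eval_chain_of_eq_zero _ _ _ _ (h0 0) ?_, eval_gpoly]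
      · have e1 : tri omega3 (m + 1) (shiftPt 0 (m + 1) (Function.update z 0 0)) =
            tri omega3 (m + 1) (fun i => z (i + 1)) := by
          refine tri_congr _ fun i hi => ?_
          rw [shiftPt_of_mem (by omega) (by omega), hup _ _ (by omega)]
        have e2 :
            tri omega3 (m + 1) (fun i => shiftPt 0 (m + 1) (Function.update z 0 0) (m + 1 + i)) =
            (∏ j ∈ Finset.range m, (-omega3 * z (m + 2 + j))) *
              tri omega3 m (fun i => z (m + 2 + i)) := by
          have e3 : ∀ i, shiftPt 0 (m + 1) (Function.update z 0 0) (m + 1 + (i + 1)) =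
              z (m + 2 + i) := by
            intro i
            rw [shiftPt_of_gt (by omega), hup _ _ (by omega)]
            congr 1; omega
          have e4 : shiftPt 0 (m + 1) (Function.update z 0 0) (m + 1 + 0) = 0 := by
            have := shiftPt_last 0 (m + 1) (Function.update z 0 0)
            rw [h0] at this
            simpa using this
          rw [tri_succ']
          simp only [e3, e4, zero_sub, neg_mul]
        rw [e1, e2, Finset.prod_mul_distrib, Finset.prod_const, Finset.card_range]
        simp only [mul_zero, sub_zero]
        have e5 : (-omega3 ^ 2) ^ (m + 1) * (-omega3) ^ m = -omega3 ^ 2 := by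
          rw [pow_succ, mul_right_comm, ← mul_pow, show -omega3 ^ 2 * -omega3 = 1 by
            linear_combination omega3_cube, one_pow, one_mul]
        linear_combination (tri omega3 (m + 1) (fun i => z (i + 1)) *
          tri omega3 m (fun i => z (m + 2 + i)) * ∏ i ∈ Finset.range m, z (m + 2 + i)) * e5
      · intro i hi _
        rw [hup _ _ (by omega)]
        have := (hpos i).ne'
        simp only [hz]
        exact_mod_cast this
    · rw [Finset.mem_Ico] at hj
      rw [eval_chain_gpoly_update_eq_zero hr hpos (by omega) hj.2,
        Finset.prod_eq_zero (i := j - (m + 2)) (by rw [Finset.mem_range]; omega)]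
      · simp
      · rw [show m + 2 + (j - (m + 2)) = j by omega]
        linear_combination -(r j : ℂ) * omega3_cube

/-- Reversal of the first `N` coordinates, together with inversion. -/
def invPt (N : ℕ) (z : ℕ → ℂ) : ℕ → ℂ := fun i => if i < N then (z (N - 1 - i))⁻¹ else z i

theorem invPt_of_lt {N i : ℕ} (h : i < N) (z : ℕ → ℂ) : invPt N z i = (z (N - 1 - i))⁻¹ := if_pos h

theorem invPt_comp_sw {N i : ℕ} (h : i + 1 < N) (z : ℕ → ℂ) :
    invPt N z ∘ sw i = invPt N (z ∘ sw (N - 2 - i)) := by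
  funext j
  simp only [Function.comp_apply, invPt, Equiv.swap_apply_def]
  split_ifs <;> first | rfl | omega | (congr 2; omega)

open MvPolynomial in
/-- `g` arises from `f` by reversal and inversion of the first `N` variables. -/
def IsInv (N d : ℕ) (f g : MvPolynomial ℕ ℂ) : Prop :=
  ∀ z : ℕ → ℂ, Function.Injective z → (∀ i, z i ≠ 0) →
    eval z g = (∏ i ∈ Finset.range N, z i ^ d) * eval (invPt N z) f

theorem IsInv.unique {N d : ℕ} {f g g' : MvPolynomial ℕ ℂ} (h : IsInv N d f g)
    (h' : IsInv N d f g') : g = g' := by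
  apply mvPoly_ext
  intro r hr hpos
  have h1 := Complex.ofReal_injective.comp hr
  have h2 : ∀ i, (r i : ℂ) ≠ 0 := fun i => by exact_mod_cast (hpos i).ne'
  exact (h _ h1 h2).trans (h' _ h1 h2).symm

theorem IsInv.smul {N d : ℕ} {f g : MvPolynomial ℕ ℂ} (h : IsInv N d f g) (c : ℂ) :
    IsInv N d (c • f) (c • g) := by
  intro z h1 h2
  rw [MvPolynomial.smul_eval, MvPolynomial.smul_eval, h z h1 h2]
  ring

theorem IsInv.dl {N d i : ℕ} {f g : MvPolynomial ℕ ℂ} (h : IsInv N d f g) (hi : i + 1 < N) :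
    IsInv N d (dl i f) (dl (N - 2 - i) g) := by
  intro z h1 h2
  set k := N - 2 - i with hk
  have e1 : invPt N z i = (z (k + 1))⁻¹ := by
    rw [invPt_of_lt (by omega)]; congr 2; omega
  have e2 : invPt N z (i + 1) = (z k)⁻¹ := by
    rw [invPt_of_lt (by omega)]; congr 2; omega
  have hne : z k ≠ z (k + 1) := fun h => by simpa using h1 h
  have hne' : (z (k + 1))⁻¹ ≠ (z k)⁻¹ := fun h => hne (inv_injective h).symm
  have ha : dlA (z (k + 1))⁻¹ (z k)⁻¹ = dlA (z k) (z (k + 1)) := by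
    rw [dlA, dlA]
    have := sub_ne_zero.mpr hne
    have := sub_ne_zero.mpr hne'
    have := h2 k
    have := h2 (k + 1)
    field_simp
  have hb : dlB (z (k + 1))⁻¹ (z k)⁻¹ = dlB (z k) (z (k + 1)) := by
    rw [dlB, dlB]
    have := sub_ne_zero.mpr hne
    have := sub_ne_zero.mpr hne'
    have := h2 k
    have := h2 (k + 1)
    field_simp
  rw [eval_dl hne, eval_dl (by rw [e1, e2]; exact hne'), e1, e2, ha, hb, h z h1 h2,
    invPt_comp_sw hi, ← hk, h _ (h1.comp (sw k).injective) fun i => h2 _]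
  have := prod_range_comp_sw (m := N) (j := k) (by omega) (fun i => z i ^ d)
  simp only [Function.comp_apply]
  rw [this]
  ring

theorem IsInv.chain {N d : ℕ} {f g : MvPolynomial ℕ ℂ} (h : IsInv N d f g) (o u : ℕ)
    (hu : o + u + 1 ≤ N) : IsInv N d (chain o u f) (chainDown (N - 1 - o - u) u g) := by
  induction u generalizing o with
  | zero => exact h
  | succ u ih =>
    have h1 := (ih (o + 1) (by omega)).dl (i := o) (by omega)
    rw [_root_.chain, chainDown]
    rw [show N - 1 - (o + 1) - u = N - 1 - o - (u + 1) by omega] at h1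
    rwa [show N - 1 - o - (u + 1) + u = N - 2 - o by omega]

theorem tri_reverse_inv (q : ℂ) (m : ℕ) {x : ℕ → ℂ} (hx : ∀ i, x i ≠ 0) :
    (∏ i ∈ Finset.range m, x i ^ (m - 1)) * tri q m (fun i => (x (m - 1 - i))⁻¹) = tri q m x := by
  induction m with
  | zero => simp [tri]
  | succ m ih =>
    rw [tri_succ', tri_succ, ← ih]
    have e1 : tri q m (fun i => (x (m + 1 - 1 - (i + 1)))⁻¹) =
        tri q m (fun i => (x (m - 1 - i))⁻¹) :=
      tri_congr _ fun i hi => by congr 2; omega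
    have e2 : ∏ j ∈ Finset.range m, ((x (m + 1 - 1 - 0))⁻¹ - q * (x (m + 1 - 1 - (j + 1)))⁻¹) =
        ∏ j ∈ Finset.range m, ((x m)⁻¹ - q * (x j)⁻¹) := by
      rw [← Finset.prod_range_reflect]
      refine Finset.prod_congr rfl fun j hj => ?_
      rw [Finset.mem_range] at hj
      congr 4
      omega
    have e3 : ∏ j ∈ Finset.range m, (x j - q * x m) =
        (∏ j ∈ Finset.range m, ((x m)⁻¹ - q * (x j)⁻¹)) * (∏ j ∈ Finset.range m, x j) *
          x m ^ m := by
      have e : x m ^ m = ∏ _j ∈ Finset.range m, x m := by simp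
      rw [e, ← Finset.prod_mul_distrib, ← Finset.prod_mul_distrib]
      refine Finset.prod_congr rfl fun j _ => ?_
      have := hx j
      have := hx m
      field_simp
    have e4 : ∏ i ∈ Finset.range (m + 1), x i ^ (m + 1 - 1) =
        (∏ i ∈ Finset.range m, x i ^ (m - 1)) * (∏ j ∈ Finset.range m, x j) * x m ^ m := by
      rw [Finset.prod_range_succ, ← Finset.prod_mul_distrib, Nat.add_sub_cancel]
      congr 1
      refine Finset.prod_congr rfl fun j hj => ?_
      rw [Finset.mem_range] at hj
      rw [← pow_succ]
      congr 1
      omega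
    rw [e1, e2, e3, e4]
    ring

theorem isInv_gpoly (n : ℕ) : IsInv (2 * n) (n - 1) (gpoly n) (gpoly n) := by
  intro z _ h2
  rw [eval_gpoly, eval_gpoly, ← tri_reverse_inv omega3 n h2,
    ← tri_reverse_inv omega3 n (fun i => h2 (n + i)), two_mul, Finset.prod_range_add]
  have e1 : tri omega3 n (invPt (n + n) z) = tri omega3 n (fun i => (z (n + (n - 1 - i)))⁻¹) :=
    tri_congr _ fun i hi => by
      rw [invPt_of_lt (by omega)]; congr 2; omega
  have e2 : tri omega3 n (fun i => invPt (n + n) z (n + i)) =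
      tri omega3 n (fun i => (z (n - 1 - i))⁻¹) :=
    tri_congr _ fun i hi => by
      rw [invPt_of_lt (by omega)]; congr 2; omega
  rw [e1, e2]
  ring

theorem rotPerm_of_ge {N i : ℕ} (h : N ≤ i) : rotPerm N i = i := by
  change (if i + 1 < N then i + 1 else if i + 1 = N then 0 else i) = i
  rw [if_neg (by omega), if_neg (by omega)]

theorem rotPerm_lt {N i : ℕ} (h : i < N) : rotPerm N i < N := by
  change (if i + 1 < N then i + 1 else if i + 1 = N then 0 else i) < N
  split_ifs <;> omega

theorem invPt_comp_rotPerm (N : ℕ) (z : ℕ → ℂ) :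
    invPt N z ∘ rotPerm N = invPt N (z ∘ (rotPerm N).symm) := by
  funext i
  rw [Function.comp_apply]
  by_cases h : i < N
  · rw [invPt_of_lt (rotPerm_lt h), invPt_of_lt h, Function.comp_apply]
    congr 2
    rw [Equiv.eq_symm_apply]
    by_cases h1 : i + 1 < N
    · rw [rotPerm_of_lt h1, rotPerm_of_lt (by omega)]
      omega
    · rw [rotPerm_last (i := i) (by omega), rotPerm_last (i := N - 1 - 0) (by omega)]
      omega
  · rw [rotPerm_of_ge (by omega)]
    simp only [invPt, if_neg h, Function.comp_apply]
    congr 1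
    rw [Equiv.eq_symm_apply, rotPerm_of_ge (by omega)]

open MvPolynomial in
theorem IsInv.rename_rotPerm {N d : ℕ} {f g : MvPolynomial ℕ ℂ} (h : IsInv N d f g) :
    IsInv N d (rename (rotPerm N) f) (rename (rotPerm N).symm g) := by
  intro z h1 h2
  rw [eval_rename, eval_rename, invPt_comp_rotPerm,
    h _ (h1.comp (rotPerm N).symm.injective) fun i => h2 _]
  congr 1
  refine Equiv.Perm.prod_comp (rotPerm N).symm _ (fun i => z i ^ d) ?_
  intro a ha
  simp only [Set.mem_ofPred_eq, Finset.coe_range, Set.mem_Iio] at ha ⊢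
  by_contra hc
  refine ha ?_
  rw [Equiv.symm_apply_eq, rotPerm_of_ge (by omega)]

open MvPolynomial in
theorem chainDown_gpoly {n : ℕ} (hn : 1 ≤ n) :
    chainDown (n - 1) n (gpoly n) = (-omega3 ^ 2) • rename (rotPerm (2 * n)).symm (gpoly n) := by
  have h1 := (isInv_gpoly n).chain 0 n (by omega)
  rw [chain_gpoly hn, show 2 * n - 1 - 0 - n = n - 1 by omega] at h1
  exact h1.unique ((isInv_gpoly n).rename_rotPerm.smul _)

/-! ### The polynomial solution -/

open Classical in
/-- Components of the polynomial solution of the exchange relations. -/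
def psi (n : ℕ) (s : List Bool) : MvPolynomial ℕ ℂ :=
  if s.count true = n ∧ s.count false = n then spread 0 s (gpoly n) else 0

theorem psi_of_count {n : ℕ} {s : List Bool} (h1 : s.count true = n) (h2 : s.count false = n) :
    psi n s = spread 0 s (gpoly n) := if_pos ⟨h1, h2⟩

theorem psi_swap (n : ℕ) (l r : List Bool) :
    dl l.length (psi n (l ++ true :: false :: r)) = psi n (l ++ false :: true :: r) := by
  have h := dl_spread_swap 0 l r (gpoly n)
  rw [zero_add] at h
  unfold psi
  rw [← h]
  have e : ∀ b, (l ++ true :: false :: r).count b = (l ++ false :: true :: r).count b := by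
    intro b; simp only [List.count_append, List.count_cons]; ring
  rw [e, e]
  split_ifs
  · rfl
  · exact map_zero _

theorem psi_same (n : ℕ) (l r : List Bool) (x : Bool) :
    dl l.length (psi n (l ++ x :: x :: r)) = omega3 • psi n (l ++ x :: x :: r) := by
  unfold psi
  split_ifs with h
  · have h' := dl_spread_same 0 l r x (gpoly n) (by rw [h.1, h.2]; exact sorted_gpoly n)
    rwa [zero_add] at h'
  · rw [map_zero, smul_zero]

theorem spread_replicate_true (o u : ℕ) (s : List Bool) (f : MvPolynomial ℕ ℂ) :
    spread o (List.replicate u true ++ s) f = spread (o + u) s f := by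
  induction u generalizing o with
  | zero => rfl
  | succ u ih =>
    rw [List.replicate_succ, List.cons_append, spread, ih]
    congr 1; omega

theorem spread_replicate_false (o d : ℕ) (f : MvPolynomial ℕ ℂ) :
    spread o (List.replicate d false) f = f := by
  induction d generalizing o with
  | zero => rfl
  | succ d ih =>
    rw [List.replicate_succ, spread, List.count_replicate, if_neg (by decide), chain, ih]

theorem psi_sorted (n : ℕ) :
    psi n (List.replicate n true ++ List.replicate n false) = gpoly n := by
  rw [psi_of_count, spread_replicate_true, spread_replicate_false] <;>
    simp [List.count_replicate]

theorem exchFamily_psi (n : ℕ) : ExchFamily 0 (2 * n) (psi n) := by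
  intro l r _
  rw [zero_add, psi_swap]

open MvPolynomial in
/-- Rotating the chain amounts to rotating the variables. -/
theorem psi_cons (n : ℕ) (x : Bool) (s : List Bool) (hs : s.length + 1 = 2 * n) :
    psi n (x :: s) = ph x • rename (rotPerm (2 * n)) (psi n (s ++ [x])) := by
  by_cases hc : (x :: s).count true = n ∧ (x :: s).count false = n
  swap
  · have hc' : ¬ ((s ++ [x]).count true = n ∧ (s ++ [x]).count false = n) := by
      simpa only [List.count_append, List.count_cons, List.count_nil, zero_add] using hc
    rw [psi, if_neg hc, psi, if_neg hc', map_zero, smul_zero]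
  obtain ⟨hc1, hc2⟩ := hc
  have hn : 1 ≤ n := by omega
  have hfam : ExchFamily 1 (2 * n - 1)
      (fun s => ph x • rename (rotPerm (2 * n)) (psi n (s ++ [x]))) := by
    intro l r hl
    simp only [map_smul]
    rw [← rename_dl (rotPerm (2 * n)) (i := l.length) (by rw [rotPerm_of_lt (by omega)]; omega)
      (by rw [rotPerm_of_lt (by omega)]; omega)]
    have := psi_swap n l (r ++ [x])
    simp only [List.append_assoc, List.cons_append]
    rw [this]
  have h1 := hfam.eq_spread s (by omega)
  refine Eq.trans ?_ h1.symm
  rw [psi_of_count hc1 hc2]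
  simp only [List.append_assoc]
  cases x with
  | false =>
    simp only [List.count_cons, beq_self_eq_true, if_true, if_false, add_zero,
      beq_iff_eq, Bool.false_eq_true] at hc1 hc2
    have e1 : s.count false = n - 1 := by omega
    have e2 : List.replicate (n - 1) false ++ [false] = List.replicate n false := by
      rw [← List.replicate_succ', Nat.sub_add_cancel hn]
    rw [hc1, e1, e2, psi_sorted, spread, hc1, chain_gpoly hn]
    rfl
  | true =>
    simp only [List.count_cons, beq_self_eq_true, if_true, Bool.true_eq_false, if_false, add_zero,
      beq_iff_eq] at hc1 hc2
    have e1 : s.count true = n - 1 := by omega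
    have h2 := (exchFamily_psi n).chainDown_eq n (List.replicate (n - 1) true) []
      (by simp only [List.length_replicate, List.length_nil]; omega)
    have e2 : List.replicate (n - 1) true ++ true :: (List.replicate n false ++ []) =
        List.replicate n true ++ List.replicate n false := by
      rw [List.append_nil, ← List.singleton_append, ← List.append_assoc, ← List.replicate_succ',
        Nat.sub_add_cancel hn]
    rw [e2, psi_sorted, List.length_replicate, zero_add, chainDown_gpoly hn] at h2
    rw [e1, hc2, h2, map_smul, rename_rename, Equiv.self_comp_symm, rename_id, spread, smul_smul]
    have : ph true * -omega3 ^ 2 = 1 := by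
      simp only [ph]
      linear_combination omega3_cube
    rw [this, one_smul, AlgHom.id_apply]

/-! ### The homogeneous point -/

/-- The polynomial solution evaluated at a point. -/
def psiVec (n : ℕ) (z : ℕ → ℂ) : LVec := fun s => MvPolynomial.eval z (psi n s)

theorem supp_psiVec (n : ℕ) (z : ℕ → ℂ) : Supp (2 * n) (psiVec n z) := by
  intro s hs
  rw [psiVec, psi, if_neg, map_zero]
  rintro ⟨h1, h2⟩
  have := List.count_true_add_count_false s
  omega

theorem psiVec_exchange (n : ℕ) (z : ℕ → ℂ) (i : ℕ) (s : List Bool) (hs : i + 2 ≤ s.length) :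
    (z i - omega3 * z (i + 1)) * psiVec n (z ∘ sw i) s =
      (z (i + 1) - omega3 * z i) * psiVec n z s +
        (1 + omega3) * (z i - z (i + 1)) * gen i (psiVec n z) s := by
  obtain ⟨l, x, y, r, rfl, rfl⟩ := exists_split_two i s hs
  rw [gen, ins_length_append, con_length_append]
  have hswap := psi_swap n l r
  have h1 : ∀ s, (z l.length - z (l.length + 1)) *
      MvPolynomial.eval z (dl l.length (psi n s)) = -omega3 *
        ((z l.length - omega3 * z (l.length + 1)) * psiVec n (z ∘ sw l.length) s
          + (omega3 - 1) * z l.length * psiVec n z s) := by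
    intro s
    have := congrArg (MvPolynomial.eval z) (X_sub_X_mul_dl l.length (psi n s))
    simpa only [map_mul, map_sub, map_add, MvPolynomial.eval_X, MvPolynomial.eval_C,
      MvPolynomial.eval_rename, map_neg, map_one, psiVec] using this
  have hww := omega3_sq_add
  by_cases hxy : x = y
  · subst hxy
    have h2 := exchange_of_dl_eq (psi_same n l r x) z
    have h3 : cup x x = 0 := by cases x <;> rfl
    rw [h3, zero_mul, mul_zero, add_zero]
    exact h2
  · apply mul_left_cancel₀ omega3_ne_zero
    have hud := h1 (l ++ true :: false :: r)
    have hdu := h1 (l ++ false :: true :: r)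
    rw [hswap] at hud
    rw [← hswap, dl_dl, hswap, map_add, MvPolynomial.smul_eval] at hdu
    change _ * psiVec n z _ = _ at hud
    change _ * (_ * psiVec n z _ + psiVec n z _) = _ at hdu
    cases x <;> cases y <;> simp only [cup, not_true_eq_false] at hxy ⊢ <;>
      generalize psiVec n z (l ++ true :: false :: r) = p at * <;>
      generalize psiVec n z (l ++ false :: true :: r) = q at * <;>
      generalize z l.length = a at * <;>
      generalize z (l.length + 1) = b at *
    · linear_combination hdu - omega3 * (1 + omega3) * (a - b) * (p * cupA_mul_cupB + q * cupB_sq)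
        + (-(a - b) * p + omega3 ^ 2 * (a - b) * q) * hww
    · linear_combination hud - omega3 * (1 + omega3) * (a - b) * (p * cupA_sq + q * cupA_mul_cupB)
        + (-(a - b) * q + omega3 * (a - b) * p) * hww

theorem psiVec_eq_rot {n : ℕ} (z : ℕ → ℂ) :
    psiVec n z = rot (psiVec n (z ∘ rotPerm (2 * n))) := by
  refine Supp.ext (supp_psiVec n z) (supp_psiVec n _).rot fun s hs => ?_
  cases s with
  | nil =>
    obtain rfl : n = 0 := by simpa using hs.symm
    simp [psiVec, psi, spread, gpoly, tri]
  | cons x s =>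
    rw [rot_cons, psiVec, psi_cons n x s hs, MvPolynomial.smul_eval, MvPolynomial.eval_rename]
    rfl

theorem psiVec_exchange_wrap {n : ℕ} (hn : 1 ≤ n) (z : ℕ → ℂ) (s : List Bool)
    (hs : s.length = 2 * n) :
    (z (2 * n - 1) - omega3 * z 0) * psiVec n (z ∘ Equiv.swap (2 * n - 1) 0) s =
      (z 0 - omega3 * z (2 * n - 1)) * psiVec n z s +
        (1 + omega3) * (z (2 * n - 1) - z 0) * genWrap (2 * n) (psiVec n z) s := by
  obtain ⟨x, s, rfl⟩ : ∃ x t, s = x :: t := by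
    cases s with
    | nil => simp at hs; omega
    | cons x t => exact ⟨x, t, rfl⟩
  rw [List.length_cons] at hs
  have h1 := psiVec_exchange n (z ∘ rotPerm (2 * n)) (2 * n - 2) (s ++ [x])
    (by simp only [List.length_append, List.length_singleton]; omega)
  have e1 : (z ∘ rotPerm (2 * n)) (2 * n - 2) = z (2 * n - 1) := by
    rw [Function.comp_apply, rotPerm_of_lt (by omega)]; congr 1; omega
  have e2 : (z ∘ rotPerm (2 * n)) (2 * n - 2 + 1) = z 0 := by
    rw [Function.comp_apply, rotPerm_last (by omega)]
  have e3 : (z ∘ rotPerm (2 * n)) ∘ sw (2 * n - 2) =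
      (z ∘ Equiv.swap (2 * n - 1) 0) ∘ rotPerm (2 * n) := by
    funext k
    simp only [Function.comp_apply]
    rw [(rotPerm (2 * n)).injective.map_swap, rotPerm_of_lt (by omega), rotPerm_last (by omega)]
    congr 4; omega
  have e4 : unrot (psiVec n z) = psiVec n (z ∘ rotPerm (2 * n)) := by
    rw [psiVec_eq_rot z, unrot_rot]
  rw [e1, e2, e3] at h1
  rw [genWrap, e4, psiVec_eq_rot z, psiVec_eq_rot (z ∘ Equiv.swap (2 * n - 1) 0),
    rot_cons, rot_cons, rot_cons]
  linear_combination ph x * h1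

/-- Partial derivative at the point with all coordinates equal to one. -/
def derivOne (k : ℕ) (f : MvPolynomial ℕ ℂ) : ℂ :=
  deriv (fun t => MvPolynomial.eval (Function.update 1 k t) f) 1

theorem hasDerivAt_derivOne (k : ℕ) (f : MvPolynomial ℕ ℂ) :
    HasDerivAt (fun t => MvPolynomial.eval (Function.update 1 k t) f) (derivOne k f) 1 := by
  obtain ⟨p, _, hp⟩ := exists_restrict f 1 k
  rw [derivOne, ← funext hp]
  exact p.differentiable.differentiableAt.hasDerivAt

theorem derivOne_exchange {i j : ℕ} (hij : i ≠ j) (f : MvPolynomial ℕ ℂ) {g : (ℕ → ℂ) → ℂ}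
    (hg : Continuous g) (h : ∀ z : ℕ → ℂ,
      (z i - omega3 * z j) * MvPolynomial.eval (z ∘ Equiv.swap i j) f =
        (z j - omega3 * z i) * MvPolynomial.eval z f + (1 + omega3) * (z i - z j) * g z) :
    (1 - omega3) * (derivOne j f - derivOne i f) =
      (1 + omega3) * (g 1 - MvPolynomial.eval 1 f) := by
  set G : ℂ → ℂ := fun t => g (Function.update 1 i t) with hG
  have hGc : Continuous G := hg.comp (continuous_const.update i continuous_id)
  have hd : HasDerivAt (fun t => (t - 1) * G t) (G 1) 1 := by
    rw [hasDerivAt_iff_tendsto_slope]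
    refine (hGc.continuousAt.tendsto.mono_left nhdsWithin_le_nhds).congr' ?_
    filter_upwards [self_mem_nhdsWithin] with t ht
    rw [slope_def_field, sub_self, zero_mul, sub_zero, mul_comm,
      mul_div_cancel_right₀ _ (sub_ne_zero.mpr ht)]
  have h1 : ∀ t : ℂ, (t - omega3) * MvPolynomial.eval (Function.update 1 j t) f -
      (1 - omega3 * t) * MvPolynomial.eval (Function.update 1 i t) f =
      (1 + omega3) * ((t - 1) * G t) := by
    intro t
    have e := h (Function.update 1 i t)
    have e1 : Function.update (1 : ℕ → ℂ) i t ∘ Equiv.swap i j =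
        Function.update (1 : ℕ → ℂ) j t := by
      funext k
      simp only [Function.comp_apply, Function.update_apply, Pi.one_apply, Equiv.swap_apply_def]
      split_ifs <;> simp_all
    rw [e1, Function.update_self, Function.update_of_ne hij.symm, Pi.one_apply] at e
    linear_combination e
  have hL := ((((hasDerivAt_id (1 : ℂ)).sub_const omega3).mul (hasDerivAt_derivOne j f)).sub
    ((((hasDerivAt_id (1 : ℂ)).const_mul omega3).const_sub 1).mul (hasDerivAt_derivOne i f)))
  have hR := hd.const_mul (1 + omega3)
  rw [← funext h1] at hR
  have e := hL.unique hR
  have u : ∀ k, Function.update (1 : ℕ → ℂ) k 1 = 1 := fun k => Function.update_eq_self k 1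
  simp only [id_eq, u, hG] at e
  linear_combination e

theorem continuous_con {V : (ℕ → ℂ) → LVec} (i : ℕ) (hV : ∀ s, Continuous fun z => V z s)
    (s : List Bool) : Continuous fun z => con i (V z) s := by
  induction i generalizing V s with
  | zero =>
    simp only [con_zero]
    exact (continuous_const.mul (hV _)).add (continuous_const.mul (hV _))
  | succ i ih =>
    cases s with
    | nil => simpa using continuous_const
    | cons x s => simpa using ih (V := fun z t => V z (x :: t)) (fun t => hV _) s

theorem continuous_ins {V : (ℕ → ℂ) → LVec} (i : ℕ) (hV : ∀ s, Continuous fun z => V z s)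
    (s : List Bool) : Continuous fun z => ins i (V z) s := by
  induction i generalizing V s with
  | zero =>
    rcases s with _ | ⟨x, _ | ⟨y, s⟩⟩
    · simpa using continuous_const
    · simpa using continuous_const
    · simp only [ins_zero_cons]
      exact continuous_const.mul (hV s)
  | succ i ih =>
    cases s with
    | nil => simpa using continuous_const
    | cons x s => simpa using ih (V := fun z t => V z (x :: t)) (fun t => hV _) s

theorem continuous_rot {V : (ℕ → ℂ) → LVec} (hV : ∀ s, Continuous fun z => V z s)
    (s : List Bool) : Continuous fun z => rot (V z) s := by
  cases s with
  | nil => exact hV []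
  | cons x s => exact continuous_const.mul (hV _)

theorem continuous_unrot {V : (ℕ → ℂ) → LVec} (hV : ∀ s, Continuous fun z => V z s)
    (s : List Bool) : Continuous fun z => unrot (V z) s := by
  rcases List.eq_nil_or_concat s with rfl | ⟨t, x, rfl⟩
  · simpa using hV []
  · simp only [List.concat_eq_append, unrot_append]
    exact continuous_const.mul (hV (x :: t))

theorem continuous_psiVec (n : ℕ) (s : List Bool) : Continuous fun z => psiVec n z s :=
  MvPolynomial.continuous_eval _

theorem one_add_omega3_ne_zero : 1 + omega3 ≠ 0 := by
  intro h
  have := omega3_sq_add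
  exact pow_ne_zero 2 omega3_ne_zero (by linear_combination this - h)

theorem sum_gen_psiVec_one {n : ℕ} (hn : 1 ≤ n) (s : List Bool) (hs : s.length = 2 * n) :
    ∑ j ∈ Finset.range (2 * n - 1), gen j (psiVec n 1) s + genWrap (2 * n) (psiVec n 1) s =
      (2 * n : ℕ) * psiVec n 1 s := by
  have h1 : ∀ i ∈ Finset.range (2 * n - 1),
      (1 + omega3) * (gen i (psiVec n 1) s - psiVec n 1 s) =
      (1 - omega3) * (derivOne (i + 1) (psi n s) - derivOne i (psi n s)) := by
    intro i hi
    rw [Finset.mem_range] at hi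
    exact (derivOne_exchange (by omega) (psi n s) (g := fun z => gen i (psiVec n z) s)
      (continuous_ins _ (continuous_con _ (continuous_psiVec n)) s)
      fun z => psiVec_exchange n z i s (by omega)).symm
  have h2 := derivOne_exchange (i := 2 * n - 1) (j := 0) (by omega) (psi n s)
    (g := fun z => genWrap (2 * n) (psiVec n z) s)
    (continuous_rot
      (continuous_ins _ (continuous_con _ (continuous_unrot (continuous_psiVec n)))) s)
    fun z => psiVec_exchange_wrap hn z s hs
  have h3 := Finset.sum_congr rfl h1
  rw [← Finset.mul_sum, ← Finset.mul_sum, Finset.sum_range_sub (fun i => derivOne i (psi n s)),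
    Finset.sum_sub_distrib, Finset.sum_const, Finset.card_range, nsmul_eq_mul] at h3
  change _ = _ * (_ - psiVec n 1 s) at h2
  obtain ⟨m, hm⟩ : ∃ m, 2 * n = m + 1 := ⟨2 * n - 1, by omega⟩
  rw [hm] at h2 h3 ⊢
  simp only [Nat.add_sub_cancel] at h2 h3 ⊢
  apply mul_left_cancel₀ one_add_omega3_ne_zero
  push_cast
  linear_combination h3 - h2

/-! ### Combinations of link patterns and their pairings -/

/-- Sum over all lists of length `N`. -/
def sumL : ℕ → (List Bool → ℂ) → ℂ
  | 0, f => f []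
  | N + 1, f => sumL N (fun s => f (true :: s)) + sumL N (fun s => f (false :: s))

theorem sumL_add (N : ℕ) (f g : List Bool → ℂ) :
    sumL N (fun s => f s + g s) = sumL N f + sumL N g := by
  induction N generalizing f g with
  | zero => rfl
  | succ N ih => simp only [sumL, ih]; ring

theorem sumL_const_mul (N : ℕ) (c : ℂ) (f : List Bool → ℂ) :
    sumL N (fun s => c * f s) = c * sumL N f := by
  induction N generalizing f with
  | zero => rfl
  | succ N ih => simp only [sumL, ih]; ring

theorem sumL_zero (N : ℕ) : sumL N (fun _ => 0) = 0 := by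
  induction N with
  | zero => rfl
  | succ N ih => simp only [sumL, ih]; ring

/-- The symmetric pairing of two vectors on `N` sites. -/
def pairing (N : ℕ) (v w : LVec) : ℂ := sumL N fun s => v s * w s

theorem pairing_add_left (N : ℕ) (v v' w : LVec) :
    pairing N (v + v') w = pairing N v w + pairing N v' w := by
  simp only [pairing, Pi.add_apply, add_mul, sumL_add]

theorem pairing_smul_left (N : ℕ) (c : ℂ) (v w : LVec) :
    pairing N (c • v) w = c * pairing N v w := by
  simp only [pairing, Pi.smul_apply, smul_eq_mul, mul_assoc, sumL_const_mul]

theorem pairing_comm (N : ℕ) (v w : LVec) : pairing N v w = pairing N w v := by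
  simp only [pairing, mul_comm]

theorem pairing_smul_right (N : ℕ) (c : ℂ) (v w : LVec) :
    pairing N v (c • w) = c * pairing N v w := by
  rw [pairing_comm, pairing_smul_left, pairing_comm]

theorem pairing_ins (N i : ℕ) (hi : i ≤ N) (v w : LVec) :
    pairing (N + 2) (ins i v) w = pairing N v (con i w) := by
  induction i generalizing N v w with
  | zero =>
    simp only [pairing, sumL, ins_zero_cons, con_zero, cup, zero_mul, sumL_zero, zero_add, add_zero]
    rw [← sumL_add]
    congr 1
    funext s
    ring
  | succ i ih =>
    obtain ⟨N, rfl⟩ : ∃ M, N = M + 1 := ⟨N - 1, by omega⟩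
    have h1 := ih N (by omega) (fun t => v (true :: t)) (fun t => w (true :: t))
    have h2 := ih N (by omega) (fun t => v (false :: t)) (fun t => w (false :: t))
    exact congrArg₂ (· + ·) h1 h2

/-- `Link n v c`: the vector `v` on `2 * n` sites is a combination of link patterns, with sum of
coefficients `c`. -/
inductive Link : ℕ → LVec → ℂ → Prop
  | base : Link 0 (single 1 []) 1
  | zero (n : ℕ) : Link n 0 0
  | add (n : ℕ) (v w : LVec) (c d : ℂ) (hv : Link n v c) (hw : Link n w d) :
      Link n (v + w) (c + d)
  | smul (n : ℕ) (a : ℂ) (v : LVec) (c : ℂ) (hv : Link n v c) : Link n (a • v) (a * c)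
  | ins (n i : ℕ) (hi : i ≤ 2 * n) (v : LVec) (c : ℂ) (hv : Link n v c) :
      Link (n + 1) (ins i v) c

theorem Supp.add {N : ℕ} {v w : LVec} (hv : Supp N v) (hw : Supp N w) : Supp N (v + w) :=
  fun l hl => by rw [Pi.add_apply, hv l hl, hw l hl, add_zero]

theorem Supp.smul {N : ℕ} {v : LVec} (hv : Supp N v) (a : ℂ) : Supp N (a • v) :=
  fun l hl => by rw [Pi.smul_apply, hv l hl, smul_zero]

theorem Link.supp {n : ℕ} {v : LVec} {c : ℂ} (h : Link n v c) : Supp (2 * n) v := by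
  induction h with
  | base => exact supp_single 1 []
  | zero n => exact fun _ _ => rfl
  | add n v w c d _ _ hv hw => exact hv.add hw
  | smul n a v c _ hv => exact hv.smul a
  | ins n i hi v c _ hv => exact hv.ins i

theorem con_add' (i : ℕ) (v w : LVec) : con i (v + w) = con i v + con i w := con_add i v w

theorem Link.con {m : ℕ} {v : LVec} {c : ℂ} (h : Link m v c) :
    ∀ n, m = n + 1 → ∀ j ≤ 2 * n, Link n (con j v) c := by
  induction h with
  | base => exact fun n hn => absurd hn (by omega)
  | zero m => intro n _ j _; rw [con_zero_vec]; exact Link.zero n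
  | add m v w c d _ _ hv hw =>
    intro n hn j hj
    rw [con_add']
    exact Link.add n _ _ c d (hv n hn j hj) (hw n hn j hj)
  | smul m a v c _ hv =>
    intro n hn j hj
    rw [con_smul]
    exact Link.smul n a _ c (hv n hn j hj)
  | ins m i hi v c hv ih =>
    intro n hn j hj
    obtain rfl : m = n := by omega
    rcases lt_trichotomy i j with h | rfl | h
    · obtain ⟨d, rfl⟩ : ∃ d, j = i + d + 1 := ⟨j - i - 1, by omega⟩
      cases d with
      | zero => rw [con_succ_ins_eq hv.supp i (by omega)]; exact hv
      | succ d =>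
        rw [show i + (d + 1) + 1 = (i + d) + 2 by ring, con_ins_of_ge i (i + d) (by omega)]
        obtain ⟨k, rfl⟩ : ∃ k, m = k + 1 := ⟨m - 1, by omega⟩
        exact Link.ins k i (by omega) _ c (ih k rfl _ (by omega))
    · rw [con_ins_self_eq hv.supp _ hj]; exact hv
    · obtain ⟨d, rfl⟩ : ∃ d, i = j + d + 1 := ⟨i - j - 1, by omega⟩
      cases d with
      | zero => rw [con_ins_succ_eq hv.supp j (by omega)]; exact hv
      | succ d =>
        rw [show j + (d + 1) + 1 = (j + d) + 2 by ring, con_ins_of_le j (j + d) (by omega)]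
        obtain ⟨k, rfl⟩ : ∃ k, m = k + 1 := ⟨m - 1, by omega⟩
        exact Link.ins k _ (by omega) _ c (ih k rfl _ (by omega))

theorem Link.gen {n : ℕ} {v : LVec} {c : ℂ} (h : Link n v c) {j : ℕ} (hj : j + 2 ≤ 2 * n) :
    Link n (gen j v) c := by
  obtain ⟨k, rfl⟩ : ∃ k, n = k + 1 := ⟨n - 1, by omega⟩
  exact Link.ins k j (by omega) _ c (h.con k rfl j (by omega))

theorem Link.apply_nil {v : LVec} {c : ℂ} {m : ℕ} (h : Link m v c) : m = 0 → v [] = c := by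
  induction h with
  | base => exact fun _ => rfl
  | zero n => exact fun _ => rfl
  | add n v w c d _ _ hv hw => intro h; rw [Pi.add_apply, hv h, hw h]
  | smul n a v c _ hv => intro h; rw [Pi.smul_apply, hv h, smul_eq_mul]
  | ins n i hi v c _ hv => exact fun h => absurd h (by omega)

theorem Link.pairing_eq {n : ℕ} {v : LVec} {c : ℂ} (hv : Link n v c) :
    ∀ {w : LVec} {d : ℂ}, Link n w d → pairing (2 * n) v w = c * d := by
  induction hv with
  | base =>
    intro w d hw
    change (if [] = [] then (1 : ℂ) else 0) * w [] = 1 * d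
    rw [if_pos rfl, hw.apply_nil rfl]
  | zero n =>
    intro w d _
    simp only [pairing, Pi.zero_apply, zero_mul, sumL_zero]
  | add n v v' c c' _ _ hv hv' =>
    intro w d hw
    rw [pairing_add_left, hv hw, hv' hw, add_mul]
  | smul n a v c _ hv =>
    intro w d hw
    rw [pairing_smul_left, hv hw, mul_assoc]
  | ins n i hi v c _ ih =>
    intro w d hw
    rw [show 2 * (n + 1) = 2 * n + 2 by ring, pairing_ins _ _ hi, ih (hw.con n rfl i hi)]

theorem Link.sum {n : ℕ} {ι : Type*} (S : Finset ι) (v : ι → LVec) (c : ι → ℂ)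
    (h : ∀ i ∈ S, Link n (v i) (c i)) : Link n (∑ i ∈ S, v i) (∑ i ∈ S, c i) := by
  classical
  induction S using Finset.induction_on with
  | empty => exact Link.zero n
  | insert a S ha ih =>
    rw [Finset.sum_insert ha, Finset.sum_insert ha]
    exact Link.add n _ _ _ _ (h a (Finset.mem_insert_self _ _))
      (ih fun i hi => h i (Finset.mem_insert_of_mem hi))

/-! ### Interpolation -/

/-- `f` is a polynomial function of degree at most `d`. -/
def PolyLe (d : ℕ) (f : ℂ → ℂ) : Prop :=
  ∃ p : Polynomial ℂ, p.natDegree ≤ d ∧ ∀ t, p.eval t = f t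

theorem PolyLe.const_mul {d : ℕ} {f : ℂ → ℂ} (a : ℂ) (hf : PolyLe d f) :
    PolyLe d fun t => a * f t := by
  obtain ⟨p, hp, hpf⟩ := hf
  exact ⟨Polynomial.C a * p, (Polynomial.natDegree_C_mul_le a p).trans hp, fun t => by simp [hpf]⟩

theorem PolyLe.mul {d e : ℕ} {f g : ℂ → ℂ} (hf : PolyLe d f) (hg : PolyLe e g) :
    PolyLe (d + e) fun t => f t * g t := by
  obtain ⟨p, hp, hpf⟩ := hf
  obtain ⟨q, hq, hqg⟩ := hg
  exact ⟨p * q, Polynomial.natDegree_mul_le_of_le hp hq, fun t => by simp [hpf, hqg]⟩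

theorem PolyLe.eq_sum {d : ℕ} {f : ℂ → ℂ} (hf : PolyLe d f) (S : Finset ℂ) (hS : d < S.card)
    (t : ℂ) : f t = ∑ x ∈ S, (Lagrange.basis S id x).eval t * f x := by
  obtain ⟨p, hp, hpf⟩ := hf
  have h := Lagrange.eq_interpolate (s := S) (v := id) (f := p) Function.injective_id.injOn
    ((Polynomial.degree_le_natDegree).trans_lt (by exact_mod_cast hp.trans_lt hS))
  rw [← hpf t]
  conv_lhs => rw [h]
  simp [Lagrange.interpolate_apply, Polynomial.eval_finsetSum, hpf, mul_comm]

theorem Link.interpolate {n d : ℕ} {V : ℂ → LVec} {c : ℂ → ℂ}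
    (hV : ∀ s, PolyLe d fun t => V t s) (hc : PolyLe d c) (S : Finset ℂ) (hS : d < S.card)
    (h : ∀ t ∈ S, Link n (V t) (c t)) (t : ℂ) : Link n (V t) (c t) := by
  have e : V t = ∑ x ∈ S, (Lagrange.basis S id x).eval t • V x := by
    funext s
    rw [(hV s).eq_sum S hS t, Finset.sum_apply]
    rfl
  rw [e, hc.eq_sum S hS t]
  exact Link.sum S _ _ fun x hx => Link.smul n _ _ _ (h x hx)

/-! ### Alternants -/

/-- The alternant with exponents `e` in the first `N` variables. -/
def altn (N : ℕ) (e : ℕ → ℕ) (z : ℕ → ℂ) : ℂ :=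
  Matrix.det (Matrix.of fun i j : Fin N => z i ^ e j)

theorem altn_comp_sw {N i : ℕ} (hi : i + 1 < N) (e : ℕ → ℕ) (z : ℕ → ℂ) :
    altn N e (z ∘ sw i) = -altn N e z := by
  have h := Matrix.det_permute (Equiv.swap (⟨i, by omega⟩ : Fin N) ⟨i + 1, hi⟩)
    (Matrix.of fun i j : Fin N => z i ^ e j)
  rw [Equiv.Perm.sign_swap (by simp)] at h
  simp only [Units.val_neg, Units.val_one, Int.cast_neg, Int.cast_one, neg_one_mul] at h
  unfold altn
  rw [← h]
  congr 1
  ext a b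
  simp only [Matrix.of_apply, Matrix.submatrix_apply, id_eq, Function.comp_apply]
  congr 2
  have := Fin.val_injective.map_swap (x := (⟨i, by omega⟩ : Fin N)) (y := ⟨i + 1, hi⟩) (z := a)
  exact this.symm

theorem altn_eq_zero {N i j : ℕ} (hi : i < N) (hj : j < N) (hij : i ≠ j) (e : ℕ → ℕ) {z : ℕ → ℂ}
    (h : z i = z j) : altn N e z = 0 := by
  refine Matrix.det_zero_of_row_eq (i := (⟨i, hi⟩ : Fin N)) (j := ⟨j, hj⟩) (by simpa using hij) ?_
  funext k
  simp only [Matrix.of_apply, h]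

theorem polyLe_altn {N d : ℕ} {e : ℕ → ℕ} (he : ∀ j < N, e j ≤ d) (z : ℕ → ℂ) :
    PolyLe d fun t => altn N e (Function.update z 0 t) := by
  cases N with
  | zero =>
    refine ⟨1, by simp, fun t => by simp [altn]⟩
  | succ N =>
    refine ⟨∑ j : Fin (N + 1), Polynomial.C ((-1) ^ (j : ℕ) *
      ((Matrix.of fun i j : Fin (N + 1) => z i ^ e j).submatrix Fin.succ j.succAbove).det) *
        Polynomial.X ^ e j, ?_, fun t => ?_⟩
    · refine Polynomial.natDegree_sum_le_of_forall_le _ _ fun j _ => ?_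
      exact (Polynomial.natDegree_C_mul_X_pow_le _ _).trans (he j j.isLt)
    · dsimp only [altn]
      rw [Matrix.det_succ_row_zero, Polynomial.eval_finsetSum]
      refine Finset.sum_congr rfl fun j _ => ?_
      have : (Matrix.of fun i j : Fin (N + 1) => Function.update z 0 t i ^ e j).submatrix
          Fin.succ j.succAbove =
          (Matrix.of fun i j : Fin (N + 1) => z i ^ e j).submatrix Fin.succ j.succAbove := by
        ext a b
        simp
      rw [this]
      simp only [Polynomial.eval_mul, Polynomial.eval_C, Polynomial.eval_pow, Polynomial.eval_X,
        Matrix.of_apply, Fin.val_zero, Function.update_self]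
      ring

theorem altn_id_eq (N : ℕ) (z : ℕ → ℂ) :
    altn N id z = ∏ k ∈ Finset.range N, ∏ j ∈ Finset.range k, (z k - z j) := by
  have h : altn N id z = (Matrix.vandermonde fun i : Fin N => z i).det := rfl
  rw [h, Matrix.det_vandermonde]
  clear h
  induction N generalizing z with
  | zero => simp
  | succ N ih =>
    rw [Fin.prod_univ_succ, Fin.prod_Ioi_zero]
    simp only [Fin.prod_Ioi_succ]
    have := ih (fun i => z (i + 1))
    simp only [Fin.val_succ, Fin.val_zero]
    rw [this, Fin.prod_univ_eq_prod_range (fun j => z (j + 1) - z 0) N,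
      Finset.prod_range_succ' _ N]
    simp only [Finset.prod_range_succ' _ (_ : ℕ), Finset.prod_mul_distrib]
    simp [mul_comm]

/-- Exponents `0, 1, 3, 4, 6, 7, …`. -/
def expo (j : ℕ) : ℕ := 3 * (j / 2) + j % 2

theorem expo_add_two (j : ℕ) : expo (j + 2) = expo j + 3 := by unfold expo; omega

theorem expo_le {j n : ℕ} (h : j < 2 * n + 2) : expo j ≤ 3 * n + 1 := by unfold expo; omega

theorem det_of_two_rows {N : ℕ} (P : Matrix (Fin (N + 2)) (Fin (N + 2)) ℂ)
    (h0 : ∀ j : Fin N, P 0 j.succ.succ = 0) (h1 : ∀ j : Fin N, P 1 j.succ.succ = 0) :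
    P.det = (P 0 0 * P 1 1 - P 0 1 * P 1 0) *
      (P.submatrix (fun i : Fin N => i.succ.succ) (fun i : Fin N => i.succ.succ)).det := by
  have e : ∀ Q : Matrix (Fin (N + 1)) (Fin (N + 1)) ℂ, (∀ j : Fin N, Q 0 j.succ = 0) →
      Q.det = Q 0 0 * (Q.submatrix Fin.succ Fin.succ).det := by
    intro Q hQ
    rw [Matrix.det_succ_row_zero, Fin.sum_univ_succ, Finset.sum_eq_zero]
    · simp
    · intro j _
      rw [hQ, mul_zero, zero_mul]
  have e0 : (P.submatrix Fin.succ (Fin.succAbove 0)).det = P 1 1 *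
      (P.submatrix (fun i : Fin N => i.succ.succ) (fun i : Fin N => i.succ.succ)).det := by
    rw [e _ fun j => by simpa using h1 j]
    simp [Matrix.submatrix_submatrix, Function.comp_def]
  have e1 : (P.submatrix Fin.succ (Fin.succAbove (Fin.succ 0))).det = P 1 0 *
      (P.submatrix (fun i : Fin N => i.succ.succ) (fun i : Fin N => i.succ.succ)).det := by
    rw [e _ fun j => by simpa using h1 j]
    simp [Matrix.submatrix_submatrix, Function.comp_def]
  rw [Matrix.det_succ_row_zero, Fin.sum_univ_succ, Fin.sum_univ_succ, Finset.sum_eq_zero, e0, e1]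
  · simp
    ring
  · intro j _
    rw [h0, mul_zero, zero_mul]

theorem altn_expo_reduce (N : ℕ) (z : ℕ → ℂ) (hz : z 0 ^ 3 = z 1 ^ 3) :
    altn (N + 2) expo z = (z 1 - z 0) * (∏ j ∈ Finset.range N, (z (j + 2) ^ 3 - z 1 ^ 3)) *
      altn N expo fun j => z (j + 2) := by
  set c := z 1 ^ 3 with hc
  set M : Matrix (Fin (N + 2)) (Fin (N + 2)) ℂ := Matrix.of fun i j => z i ^ expo j with hM
  set U : Matrix (Fin (N + 2)) (Fin (N + 2)) ℂ :=
    Matrix.of fun k j => (if k = j then 1 else 0) - (if (k : ℕ) + 2 = j then c else 0) with hU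
  have hdet : U.det = 1 := by
    rw [Matrix.det_of_isUpperTriangular]
    · simp [hU]
    · intro i j hij
      change j < i at hij
      simp only [hU, Matrix.of_apply]
      rw [if_neg hij.ne', if_neg (by have : (j : ℕ) < i := hij; omega), sub_zero]
  have h2 : ∀ (i : Fin (N + 2)) (j : Fin N), (M * U) i j.succ.succ =
      (z i ^ 3 - c) * z i ^ expo j := by
    intro i j
    rw [Matrix.mul_apply]
    simp only [hU, hM, Matrix.of_apply, mul_sub, mul_ite, mul_one, mul_zero,
      Finset.sum_sub_distrib, Finset.sum_ite_eq', Finset.mem_univ, if_true]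
    rw [Finset.sum_eq_single (⟨j, by omega⟩ : Fin (N + 2))]
    · simp only [Fin.val_succ, if_true, expo_add_two]
      ring
    · intro k _ hk
      rw [if_neg]
      simp only [Fin.val_succ]
      intro h
      exact hk (Fin.ext (by simp; omega))
    · simp
  have h0 : ∀ (i : Fin (N + 2)) (j : Fin (N + 2)), (j : ℕ) < 2 → (M * U) i j = z i ^ (j : ℕ) := by
    intro i j hj
    rw [Matrix.mul_apply]
    simp only [hU, hM, Matrix.of_apply, mul_sub, mul_ite, mul_one, mul_zero,
      Finset.sum_sub_distrib, Finset.sum_ite_eq', Finset.mem_univ, if_true]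
    rw [Finset.sum_eq_zero fun k _ => if_neg (by omega), sub_zero]
    congr 1
    unfold expo
    omega
  have h1 : altn (N + 2) expo z = (M * U).det := by rw [Matrix.det_mul, hdet, mul_one]; rfl
  have h3 : ((M * U).submatrix (fun i : Fin N => i.succ.succ) (fun i : Fin N => i.succ.succ)).det =
      (∏ j ∈ Finset.range N, (z (j + 2) ^ 3 - c)) * altn N expo fun j => z (j + 2) := by
    rw [← Fin.prod_univ_eq_prod_range (fun j => z (j + 2) ^ 3 - c) N, altn,
      ← Matrix.det_mul_column]
    congr 1
    ext i j
    rw [Matrix.submatrix_apply, h2]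
    rfl
  have hz1 : ∀ j : Fin N, (M * U) 1 j.succ.succ = 0 := fun j => by
    rw [h2, Fin.val_one, hc, sub_self, zero_mul]
  have hz0 : ∀ j : Fin N, (M * U) 0 j.succ.succ = 0 := fun j => by
    rw [h2, Fin.val_zero, hz, sub_self, zero_mul]
  rw [h1, det_of_two_rows _ hz0 hz1, h3, h0 _ _ (by simp), h0 _ _ (by simp), h0 _ _ (by simp),
    h0 _ _ (by simp)]
  simp only [Fin.val_zero, Fin.val_one, pow_zero, pow_one]
  ring

/-! ### Wheel recursion -/

theorem list_swap_induction {P : List Bool → Prop}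
    (hP : ∀ l r, P (l ++ false :: true :: r) → P (l ++ true :: false :: r)) (s : List Bool)
    (h : P (List.replicate (s.count false) false ++ List.replicate (s.count true) true)) : P s := by
  induction s generalizing P with
  | nil => exact h
  | cons x s ih =>
    cases x with
    | false =>
      refine ih (P := fun s => P (false :: s)) (fun l r hl => hP (false :: l) r hl) ?_
      simpa [List.replicate_succ] using h
    | true =>
      refine ih (P := fun s => P (true :: s)) (fun l r hl => hP (true :: l) r hl) ?_
      have hmove : ∀ a r, P (List.replicate a false ++ true :: r) →
          P (true :: (List.replicate a false ++ r)) := by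
        intro a
        induction a with
        | zero => exact fun r h => h
        | succ a iha =>
          intro r h
          rw [List.replicate_succ', List.append_assoc] at h ⊢
          exact iha _ (hP _ _ h)
      refine hmove _ _ ?_
      simpa [List.replicate_succ] using h

theorem psiVec_replicate_append (n m : ℕ) (z : ℕ → ℂ) (s : List Bool) (hs : m + s.length = 2 * n) :
    psiVec n (z ∘ ((rotPerm (2 * n)) ^ m).symm) (List.replicate m true ++ s) =
      (-omega3) ^ m * psiVec n z (s ++ List.replicate m true) := by
  induction m generalizing s with
  | zero =>
    simp only [List.replicate_zero, List.nil_append, List.append_nil, pow_zero, one_mul]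
    rfl
  | succ m ih =>
    rw [psiVec_eq_rot, List.replicate_succ, List.cons_append, rot_cons, List.append_assoc]
    have e : (z ∘ ((rotPerm (2 * n)) ^ (m + 1)).symm) ∘ rotPerm (2 * n) =
        z ∘ ((rotPerm (2 * n)) ^ m).symm := by
      funext k
      simp only [Function.comp_apply]
      congr 1
      rw [Equiv.symm_apply_eq, pow_succ', Equiv.Perm.mul_apply, Equiv.apply_symm_apply]
    rw [e, ih _ (by simp; omega), ph]
    simp only [List.append_assoc, List.singleton_append]
    ring

theorem rotPerm_pow_apply {N m i : ℕ} (hi : i < N) (hm : m ≤ N) :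
    ((rotPerm N) ^ m) i = if i + m < N then i + m else i + m - N := by
  induction m with
  | zero => simp [hi]
  | succ m ih =>
    rw [pow_succ', Equiv.Perm.mul_apply, ih (by omega)]
    change (if _ + 1 < N then _ + 1 else if _ + 1 = N then 0 else _) = _
    split_ifs <;> omega

theorem comp_rotPerm_pow_symm_apply {N m i : ℕ} (z : ℕ → ℂ) (hi : i < N) (hm : m ≤ N) :
    (z ∘ ((rotPerm N) ^ m).symm) i = if m ≤ i then z (i - m) else z (i + N - m) := by
  rw [Function.comp_apply]
  split_ifs with h <;> congr 1 <;> rw [Equiv.symm_apply_eq, rotPerm_pow_apply (by omega) hm] <;>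
    split_ifs <;> omega

theorem psiVec_wheel_base (n : ℕ) (z : ℕ → ℂ) (hz : z 0 = omega3 * z 1) :
    psiVec (n + 1) z
        (true :: false :: (List.replicate n false ++ List.replicate n true)) =
      (-omega3) ^ n * (∏ j ∈ Finset.range (2 * n), (z (j + 2) - omega3 ^ 2 * z 1)) *
        psiVec n (fun j => z (j + 2)) (List.replicate n false ++ List.replicate n true) := by
  set y : ℕ → ℂ := fun j => z (j + 2) with hy
  set z' := z ∘ ((rotPerm (2 * (n + 1))) ^ n).symm with hz'
  set y' := y ∘ ((rotPerm (2 * n)) ^ n).symm with hy'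
  have h1 := psiVec_replicate_append (n + 1) n z (true :: false :: List.replicate n false)
    (by simp; omega)
  have h2 := psiVec_replicate_append n n y (List.replicate n false) (by simp; omega)
  have e : List.replicate n true ++ true :: false :: List.replicate n false =
      List.replicate (n + 1) true ++ List.replicate (n + 1) false := by
    rw [List.replicate_succ', List.replicate_succ, List.append_assoc]; rfl
  rw [e, psiVec, psi_sorted, eval_gpoly] at h1
  rw [psiVec, psi_sorted, eval_gpoly] at h2
  have hz1 : ∀ i < n, z' i = z (i + n + 2) := fun i hi => by
    rw [hz', comp_rotPerm_pow_symm_apply z (by omega) (by omega), if_neg (by omega)]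
    congr 1; omega
  have hz2 : ∀ i < n + 2, z' (n + i) = z i := fun i hi => by
    rw [hz', comp_rotPerm_pow_symm_apply z (by omega) (by omega), if_pos (by omega)]
    congr 1; omega
  have hy1 : ∀ i < n, y' i = z (i + n + 2) := fun i hi => by
    rw [hy', comp_rotPerm_pow_symm_apply y (by omega) (by omega), if_neg (by omega), hy]
    congr 1; omega
  have hy2 : ∀ i < n, y' (n + i) = z (i + 2) := fun i hi => by
    rw [hy', comp_rotPerm_pow_symm_apply y (by omega) (by omega), if_pos (by omega), hy]
    congr 1; omega
  have t1 : tri omega3 (n + 1) z' = tri omega3 n y' *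
      ∏ i ∈ Finset.range n, (z (n + i + 2) - omega3 ^ 2 * z 1) := by
    rw [tri_succ, tri_congr omega3 fun i hi => (hz1 i hi).trans (hy1 i hi).symm]
    congr 1
    refine Finset.prod_congr rfl fun i hi => ?_
    rw [hz1 i (Finset.mem_range.mp hi), ← add_zero n, hz2 0 (by omega), hz]
    ring_nf
  have t2 : tri omega3 (n + 1) (fun i => z' (n + 1 + i)) =
      ((-omega3) ^ n * ∏ i ∈ Finset.range n, (z (i + 2) - omega3 ^ 2 * z 1)) *
        tri omega3 n (fun i => y' (n + i)) := by
    rw [tri_succ']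
    congr 1
    · have : ((-omega3) ^ n : ℂ) = ∏ _i ∈ Finset.range n, -omega3 := by simp
      rw [this, ← Finset.prod_mul_distrib]
      refine Finset.prod_congr rfl fun i hi => ?_
      rw [Finset.mem_range] at hi
      rw [add_assoc, hz2 (1 + 0) (by omega), show n + 1 + (i + 1) = n + (i + 2) by ring,
        hz2 (i + 2) (by omega)]
      linear_combination -z 1 * omega3_cube
    · refine tri_congr omega3 fun i hi => ?_
      rw [show n + 1 + (i + 1) = n + (i + 2) by ring, hz2 (i + 2) (by omega), hy2 i hi]
  rw [t1, t2] at h1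
  apply mul_left_cancel₀ (pow_ne_zero n (neg_ne_zero.mpr omega3_ne_zero))
  change _ = _ * psiVec (n + 1) z
    (true :: false :: (List.replicate n false ++ List.replicate n true)) at h1
  rw [← h1, two_mul, Finset.prod_range_add]
  linear_combination (-omega3) ^ n *
    (∏ i ∈ Finset.range n, (z (i + 2) - omega3 ^ 2 * z 1)) *
    (∏ i ∈ Finset.range n, (z (n + i + 2) - omega3 ^ 2 * z 1)) * h2

theorem psiVec_wheel (n : ℕ) (s : List Bool) (h1 : s.count true = n) (h2 : s.count false = n) :
    ∀ z : ℕ → ℂ, z 0 = omega3 * z 1 → (Function.Injective fun j => z (j + 2)) →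
      psiVec (n + 1) z (true :: false :: s) =
        (-omega3) ^ n * (∏ j ∈ Finset.range (2 * n), (z (j + 2) - omega3 ^ 2 * z 1)) *
          psiVec n (fun j => z (j + 2)) s := by
  have hs : s.length = 2 * n := by
    have := List.count_true_add_count_false s
    omega
  revert hs
  refine list_swap_induction (P := fun s => s.length = 2 * n → ∀ z : ℕ → ℂ,
    z 0 = omega3 * z 1 → (Function.Injective fun j => z (j + 2)) →
      psiVec (n + 1) z (true :: false :: s) =
        (-omega3) ^ n * (∏ j ∈ Finset.range (2 * n), (z (j + 2) - omega3 ^ 2 * z 1)) *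
          psiVec n (fun j => z (j + 2)) s) ?_ s ?_
  · intro l r ih hs z hz0 hinj
    have hs' : (l ++ false :: true :: r).length = 2 * n := by
      simpa using hs
    have hl : l.length + 2 ≤ 2 * n := by
      rw [← hs]; simp
    set y : ℕ → ℂ := fun j => z (j + 2) with hy
    have hsw : (fun j => (z ∘ sw (l.length + 2)) (j + 2)) = y ∘ sw l.length := by
      funext k
      simp only [Function.comp_apply, hy]
      congr 1
      simp only [Equiv.swap_apply_def]
      split_ifs <;> omega
    have e1 := psiVec_exchange (n + 1) z (l.length + 2) ((true :: false :: l) ++ false :: true :: r)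
      (by simp)
    have e2 := psiVec_exchange n y l.length (l ++ false :: true :: r) (by simp)
    have g1 := ins_length_append (con (l.length + 2) (psiVec (n + 1) z)) (true :: false :: l)
      false true r
    have g2 := con_length_append (psiVec (n + 1) z) (true :: false :: l) r
    have g3 := ins_length_append (con l.length (psiVec n y)) l false true r
    have g4 := con_length_append (psiVec n y) l r
    change _ = cup _ _ * con (l.length + 2) (psiVec (n + 1) z) _ at g1
    change con (l.length + 2) (psiVec (n + 1) z) _ = _ at g2
    rw [gen] at e1 e2
    change _ = _ + _ * ins (true :: false :: l).length _ _ at e1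
    rw [g1, g2] at e1
    rw [g3, g4] at e2
    have i1 := ih hs' z hz0 hinj
    have i2 := ih hs' (z ∘ sw (l.length + 2))
      (by rw [comp_sw_of_gt (by omega), comp_sw_of_gt (by omega), hz0])
      (by rw [hsw]; exact hinj.comp (sw l.length).injective)
    rw [hsw, comp_sw_of_gt (k := 1) (by omega)] at i2
    have hp := prod_range_comp_sw hl fun j => z (j + 2) - omega3 ^ 2 * z 1
    have hp' : ∏ j ∈ Finset.range (2 * n), ((z ∘ sw (l.length + 2)) (j + 2) - omega3 ^ 2 * z 1) =
        ∏ j ∈ Finset.range (2 * n), (z (j + 2) - omega3 ^ 2 * z 1) := by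
      rw [← hp]
      refine Finset.prod_congr rfl fun j _ => ?_
      have := congrFun hsw j
      exact congrArg (· - omega3 ^ 2 * z 1) this
    rw [hp'] at i2
    simp only [List.cons_append] at e1
    rw [i1, i2] at e1
    have hne : y l.length - y (l.length + 1) ≠ 0 := sub_ne_zero.mpr fun h => by
      have := hinj h
      omega
    have hne' : (1 + omega3) * (y l.length - y (l.length + 1)) * (cup false true * cupA) ≠ 0 := by
      refine mul_ne_zero (mul_ne_zero one_add_omega3_ne_zero hne) ?_
      rw [cup, mul_comm, cupA_mul_cupB]
      exact one_ne_zero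
    apply mul_left_cancel₀ hne'
    have hy1 : y l.length = z (l.length + 2) := rfl
    have hy2 : y (l.length + 1) = z (l.length + 2 + 1) := rfl
    rw [hy1, hy2] at e2 ⊢
    linear_combination ((-omega3) ^ n *
      (∏ j ∈ Finset.range (2 * n), (z (j + 2) - omega3 ^ 2 * z 1))) * e2 - e1
  · intro _ z hz _
    rw [h1, h2]
    exact psiVec_wheel_base n z hz

theorem psiVec_wheel_eq_ins (n : ℕ) (z : ℕ → ℂ) (hz : z 0 = omega3 * z 1) (hz1 : z 1 ≠ 0)
    (hinj : Function.Injective fun j => z (j + 2)) :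
    psiVec (n + 1) z =
      (cupB * (-omega3) ^ n * ∏ j ∈ Finset.range (2 * n), (z (j + 2) - omega3 ^ 2 * z 1)) •
        ins 0 (psiVec n fun j => z (j + 2)) := by
  have hgen : ∀ x y t, psiVec (n + 1) z (x :: y :: t) = cup x y * con 0 (psiVec (n + 1) z) t := by
    intro x y t
    have h := psiVec_exchange (n + 1) z 0 (x :: y :: t) (by simp)
    rw [zero_add, hz, sub_self, zero_mul, gen, ins_zero_cons] at h
    have hne : (1 + omega3) * (1 - omega3) * z 1 ≠ 0 :=
      mul_ne_zero (mul_ne_zero one_add_omega3_ne_zero (sub_ne_zero.mpr omega3_ne_one.symm)) hz1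
    apply mul_left_cancel₀ hne
    linear_combination -h
  refine Supp.ext (supp_psiVec _ z) (((supp_psiVec n _).ins 0).smul _) fun s hs => ?_
  rcases s with _ | ⟨x, _ | ⟨y, t⟩⟩
  · simp at hs
  · simp at hs; omega
  rw [Pi.smul_apply, ins_zero_cons, smul_eq_mul, hgen]
  have hA := hgen true false t
  have hw : psiVec (n + 1) z (true :: false :: t) =
      (-omega3) ^ n * (∏ j ∈ Finset.range (2 * n), (z (j + 2) - omega3 ^ 2 * z 1)) *
        psiVec n (fun j => z (j + 2)) t := by
    by_cases hc : t.count true = n ∧ t.count false = n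
    · exact psiVec_wheel n t hc.1 hc.2 z hz hinj
    · rw [psiVec, psiVec, psi, psi, if_neg hc, if_neg (by simpa using hc), map_zero, map_zero,
        mul_zero]
  rw [hw, cup] at hA
  linear_combination -cupB * cup x y * hA - cup x y * con 0 (psiVec (n + 1) z) t * cupA_mul_cupB

/-! ### The solution in terms of link patterns -/

theorem degreeOf_spread_le {d : ℕ} (o : ℕ) (s : List Bool) {f : MvPolynomial ℕ ℂ}
    (hf : ∀ j, MvPolynomial.degreeOf j f ≤ d) (j : ℕ) :
    MvPolynomial.degreeOf j (spread o s f) ≤ d := by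
  induction s generalizing o f with
  | nil => exact hf j
  | cons x s ih =>
    cases x with
    | true => exact ih (o + 1) hf
    | false => exact ih (o + 1) (degreeOf_chain_le o _ hf)

theorem polyLe_psiVec (n : ℕ) (z : ℕ → ℂ) (s : List Bool) :
    PolyLe n fun t => psiVec (n + 1) (Function.update z 0 t) s := by
  obtain ⟨p, hp, he⟩ := exists_restrict (psi (n + 1) s) z 0
  refine ⟨p, hp.trans ?_, he⟩
  unfold psi
  split_ifs
  · exact degreeOf_spread_le 0 s (degreeOf_gpoly_le (n + 1)) 0
  · simp

theorem altn_id_succ (N : ℕ) (z : ℕ → ℂ) :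
    altn (N + 1) id z = (∏ j ∈ Finset.range N, (z (j + 1) - z 0)) *
      altn N id fun j => z (j + 1) := by
  rw [altn_id_eq, altn_id_eq, Finset.prod_range_succ']
  simp only [Finset.prod_range_succ' _ (_ : ℕ), Finset.prod_mul_distrib]
  simp [mul_comm]

theorem altn_id_wheel (N : ℕ) (z : ℕ → ℂ) :
    altn (N + 2) id z = (z 1 - z 0) *
      (∏ j ∈ Finset.range N, ((z (j + 2) - z 0) * (z (j + 2) - z 1))) *
      altn N id fun j => z (j + 2) := by
  rw [altn_id_succ, altn_id_succ, Finset.prod_range_succ', Finset.prod_mul_distrib]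
  simp only [zero_add]
  ring

/-- Normalisation of the coefficient sum. -/
def linkConst (n : ℕ) : ℂ := ∏ k ∈ Finset.range n, (cupB * (-omega3) ^ k)

/-- The Vandermonde multiple of the solution. -/
def vdPsi (n : ℕ) (z : ℕ → ℂ) : LVec := altn (2 * n) id z • psiVec n z

/-- The coefficient sum of `vdPsi`. -/
def linkSum (n : ℕ) (z : ℕ → ℂ) : ℂ := linkConst n * altn (2 * n) expo z

theorem vdPsi_wheel (n : ℕ) (z : ℕ → ℂ) (hz : z 0 = omega3 * z 1) (hz1 : z 1 ≠ 0)
    (hinj : Function.Injective fun j => z (j + 2)) :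
    vdPsi (n + 1) z = (cupB * (-omega3) ^ n * ((z 1 - z 0) *
      ∏ j ∈ Finset.range (2 * n), (z (j + 2) ^ 3 - z 1 ^ 3))) •
        ins 0 (vdPsi n fun j => z (j + 2)) := by
  rw [vdPsi, show 2 * (n + 1) = 2 * n + 2 by ring, altn_id_wheel,
    psiVec_wheel_eq_ins n z hz hz1 hinj, vdPsi, ins_smul, smul_smul, smul_smul]
  congr 1
  have : ∏ j ∈ Finset.range (2 * n), (z (j + 2) ^ 3 - z 1 ^ 3) =
      (∏ j ∈ Finset.range (2 * n), ((z (j + 2) - z 0) * (z (j + 2) - z 1))) *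
        ∏ j ∈ Finset.range (2 * n), (z (j + 2) - omega3 ^ 2 * z 1) := by
    rw [← Finset.prod_mul_distrib]
    refine Finset.prod_congr rfl fun j _ => ?_
    rw [hz]
    generalize z (j + 2) = a
    generalize z 1 = b
    linear_combination (a ^ 2 * b - a * b ^ 2 * omega3 ) * omega3_sq_add +
      b ^ 3 * omega3_cube
  rw [this]
  ring

theorem linkSum_wheel (n : ℕ) (z : ℕ → ℂ) (hz : z 0 = omega3 * z 1) :
    linkSum (n + 1) z = (cupB * (-omega3) ^ n * ((z 1 - z 0) *
      ∏ j ∈ Finset.range (2 * n), (z (j + 2) ^ 3 - z 1 ^ 3))) *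
        linkSum n fun j => z (j + 2) := by
  rw [linkSum, show 2 * (n + 1) = 2 * n + 2 by ring, altn_expo_reduce, linkSum, linkConst,
    linkConst, Finset.prod_range_succ]
  · ring
  · rw [hz]
    linear_combination z 1 ^ 3 * omega3_cube

theorem gen_smul (i : ℕ) (c : ℂ) (v : LVec) : gen i (c • v) = c • gen i v := by
  rw [gen, con_smul, ins_smul, gen]

theorem link_vdPsi_sw {n i : ℕ} (hi : i + 2 ≤ 2 * n) {u : ℕ → ℂ}
    (hu : u i - omega3 * u (i + 1) ≠ 0) (h : Link n (vdPsi n u) (linkSum n u)) :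
    Link n (vdPsi n (u ∘ sw i)) (linkSum n (u ∘ sw i)) := by
  set D := u i - omega3 * u (i + 1) with hD
  have e1 : vdPsi n (u ∘ sw i) = (-(D⁻¹ * (u (i + 1) - omega3 * u i))) • vdPsi n u +
      (-(D⁻¹ * ((1 + omega3) * (u i - u (i + 1))))) • gen i (vdPsi n u) := by
    have hs := supp_psiVec n u
    have hg : Supp (2 * n) (gen i (vdPsi n u)) := (h.gen hi).supp
    refine Supp.ext ((supp_psiVec n _).smul _) ((h.supp.smul _).add (hg.smul _)) fun s hs => ?_
    have := psiVec_exchange n u i s (by omega)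
    simp only [vdPsi, gen_smul, Pi.add_apply, Pi.smul_apply, smul_eq_mul]
    rw [altn_comp_sw (by omega)]
    apply mul_left_cancel₀ hu
    rw [← hD] at this
    field_simp
    linear_combination -altn (2 * n) id u * this
  have e2 : linkSum n (u ∘ sw i) = (-(D⁻¹ * (u (i + 1) - omega3 * u i))) * linkSum n u +
      (-(D⁻¹ * ((1 + omega3) * (u i - u (i + 1))))) * linkSum n u := by
    rw [linkSum, altn_comp_sw (by omega), linkSum]
    apply mul_left_cancel₀ hu
    field_simp
    rw [hD]
    ring
  rw [e1, e2]
  exact Link.add n _ _ _ _ (Link.smul n _ _ _ h) (Link.smul n _ _ _ (h.gen hi))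

theorem update_comp_sw_succ (z : ℕ → ℂ) (i : ℕ) (t : ℂ) :
    Function.update (z ∘ sw (i + 1)) 0 t = Function.update z 0 t ∘ sw (i + 1) := by
  have h0 : sw (i + 1) 0 = 0 := Equiv.swap_apply_of_ne_of_ne (by omega) (by omega)
  funext k
  by_cases hk : k = 0
  · rw [hk, Function.comp_apply, h0, Function.update_self, Function.update_self]
  · have : sw (i + 1) k ≠ 0 := fun h => hk ((sw (i + 1)).injective (h.trans h0.symm))
    rw [Function.comp_apply, Function.update_of_ne hk, Function.update_of_ne this,
      Function.comp_apply]

theorem link_vdPsi_wheel {n : ℕ} (ih : ∀ x : ℕ → ℝ, Function.Injective x → (∀ i, 0 < x i) →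
      Link n (vdPsi n fun i => x i) (linkSum n fun i => x i)) (j : ℕ) (hj : j ≤ 2 * n)
    (x : ℕ → ℝ) (hinj : Function.Injective x) (hpos : ∀ i, 0 < x i) :
    Link (n + 1) (vdPsi (n + 1) (Function.update (fun i => (x i : ℂ)) 0 (omega3 * x (j + 1))))
      (linkSum (n + 1) (Function.update (fun i => (x i : ℂ)) 0 (omega3 * x (j + 1)))) := by
  induction j generalizing x with
  | zero =>
    set z := Function.update (fun i => (x i : ℂ)) 0 (omega3 * x 1) with hz
    have h0 : z 0 = omega3 * x 1 := Function.update_self ..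
    have h1 : ∀ i, z (i + 1) = x (i + 1) := fun i => Function.update_of_ne (by omega) ..
    have h01 : z 0 = omega3 * z 1 := by rw [h0, h1 0]
    have h2 : (fun j => z (j + 2)) = fun j => ((x (j + 2) : ℝ) : ℂ) := funext fun j => h1 (j + 1)
    have hinj2 : Function.Injective fun j => x (j + 2) := fun a b hab => by
      have := hinj hab
      omega
    rw [vdPsi_wheel n z h01 (by rw [h1 0]; exact_mod_cast (hpos 1).ne')
      (by rw [h2]; exact Complex.ofReal_injective.comp hinj2), linkSum_wheel n z h01]
    refine Link.smul (n + 1) _ _ _ (Link.ins n 0 (by omega) _ _ ?_)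
    rw [h2]
    exact ih _ hinj2 fun i => hpos _
  | succ j ihj =>
    have h := ihj (by omega) (x ∘ sw (j + 1)) (hinj.comp (sw (j + 1)).injective)
      fun i => hpos _
    rw [comp_sw_self] at h
    have e : (fun i => (((x ∘ sw (j + 1)) i : ℝ) : ℂ)) = (fun i => (x i : ℂ)) ∘ sw (j + 1) := rfl
    rw [e, update_comp_sw_succ] at h
    have h' := link_vdPsi_sw (i := j + 1) (by omega) ?_ h
    · rwa [comp_sw_sw] at h'
    · rw [comp_sw_self, comp_sw_succ, Function.update_of_ne (by omega),
        Function.update_of_ne (by omega)]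
      exact sub_ne_zero.mpr (omega3_mul_ofReal_ne (hpos _) (hpos _)).symm

theorem link_vdPsi (n : ℕ) (x : ℕ → ℝ) (hinj : Function.Injective x) (hpos : ∀ i, 0 < x i) :
    Link n (vdPsi n fun i => x i) (linkSum n fun i => x i) := by
  induction n generalizing x with
  | zero =>
    have e1 : vdPsi 0 (fun i => (x i : ℂ)) = single 1 [] := by
      refine Supp.ext (N := 0) ((supp_psiVec 0 _).smul _) (supp_single 1 []) fun s hs => ?_
      rw [List.length_eq_zero_iff.mp hs]
      simp [vdPsi, altn, psiVec, psi, spread, gpoly, tri, single]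
    have e2 : linkSum 0 (fun i => (x i : ℂ)) = 1 := by simp [linkSum, linkConst, altn]
    rw [e1, e2]
    exact Link.base
  | succ n ih =>
    set z : ℕ → ℂ := fun i => x i with hz
    set S : Finset ℂ := (Finset.range (2 * n + 1)).image (fun j => z (j + 1)) ∪
      (Finset.range (2 * n + 1)).image (fun j => omega3 * z (j + 1)) with hS
    have hzinj : Function.Injective z := Complex.ofReal_injective.comp hinj
    have hcard : 3 * n + 1 < S.card := by
      rw [hS, Finset.card_union_of_disjoint, Finset.card_image_of_injective,
        Finset.card_image_of_injective, Finset.card_range]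
      · omega
      · intro a b hab
        have := hzinj (mul_left_cancel₀ omega3_ne_zero hab)
        omega
      · intro a b hab
        have := hzinj hab
        omega
      · rw [Finset.disjoint_left]
        rintro a ha hb
        obtain ⟨j, _, rfl⟩ := Finset.mem_image.mp ha
        obtain ⟨k, _, hk⟩ := Finset.mem_image.mp hb
        exact omega3_mul_ofReal_ne (hpos _) (hpos _) hk
    have h := Link.interpolate (n := n + 1) (d := 3 * n + 1)
      (V := fun t => vdPsi (n + 1) (Function.update z 0 t))
      (c := fun t => linkSum (n + 1) (Function.update z 0 t)) ?_ ?_ S hcard ?_ (z 0)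
    · simpa only [Function.update_eq_self] using h
    · intro s
      have := (polyLe_altn (N := 2 * (n + 1)) (d := 2 * n + 1) (e := id)
        (fun j hj => by simp only [id]; omega) z).mul (polyLe_psiVec n z s)
      rwa [show 2 * n + 1 + n = 3 * n + 1 by ring] at this
    · exact (polyLe_altn (fun j hj => expo_le (by omega)) z).const_mul _
    · intro t ht
      rcases Finset.mem_union.mp ht with ht | ht
      · obtain ⟨j, hj, rfl⟩ := Finset.mem_image.mp ht
        rw [Finset.mem_range] at hj
        have h0 : ∀ e, altn (2 * (n + 1)) e (Function.update z 0 (z (j + 1))) = 0 := fun e =>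
          altn_eq_zero (i := 0) (j := j + 1) (by omega) (by omega) (by omega) e
            (by rw [Function.update_self, Function.update_of_ne (by omega)])
        simp only [vdPsi, linkSum, h0, zero_smul, mul_zero]
        exact Link.zero _
      · obtain ⟨j, hj, rfl⟩ := Finset.mem_image.mp ht
        rw [Finset.mem_range] at hj
        exact link_vdPsi_wheel ih j (by omega) x hinj hpos

/-! ### The sum rule at the homogeneous point -/

/-- The Vandermonde product of a sequence. -/
def vdm (N : ℕ) (f : ℕ → ℂ) : ℂ :=
  ∏ k ∈ Finset.range N, ∏ j ∈ Finset.range k, (f k - f j)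

theorem altn_geom (N : ℕ) (e : ℕ → ℕ) (t : ℂ) :
    altn N e (fun i => t ^ i) = vdm N fun j => t ^ e j := by
  rw [vdm, ← altn_id_eq, altn, altn, ← Matrix.det_transpose]
  congr 1
  ext i j
  simp only [Matrix.transpose_apply, Matrix.of_apply, id, ← pow_mul, mul_comm]

theorem vdm_pow (N : ℕ) (e : ℕ → ℕ) (t : ℂ) :
    vdm N (fun j => t ^ e j) = (∏ k ∈ Finset.range N, (t - 1) ^ k) *
      vdm N fun j => ∑ i ∈ Finset.range (e j), t ^ i := by
  simp only [vdm]
  rw [← Finset.prod_mul_distrib]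
  refine Finset.prod_congr rfl fun k _ => ?_
  rw [← Finset.card_range k, ← Finset.prod_const, Finset.card_range, ← Finset.prod_mul_distrib]
  refine Finset.prod_congr rfl fun j _ => ?_
  rw [mul_sub, mul_geom_sum, mul_geom_sum]
  ring

theorem continuous_sumL (N : ℕ) {f : ℝ → List Bool → ℂ} (hf : ∀ s, Continuous fun t => f t s) :
    Continuous fun t => sumL N (f t) := by
  induction N generalizing f with
  | zero => exact hf []
  | succ N ih => exact (ih fun s => hf _).add (ih fun s => hf _)

theorem continuous_vdm (N : ℕ) {f : ℝ → ℕ → ℂ} (hf : ∀ j, Continuous fun t => f t j) :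
    Continuous fun t => vdm N (f t) :=
  continuous_finsetProd _ fun k _ => continuous_finsetProd _ fun j _ => (hf k).sub (hf j)

theorem pairing_psiVec_geom (n : ℕ) {t : ℝ} (ht : 1 < t) :
    (vdm (2 * n) fun j => ∑ i ∈ Finset.range j, (t : ℂ) ^ i) ^ 2 *
        pairing (2 * n) (psiVec n fun i => (t : ℂ) ^ i) (psiVec n fun i => (t : ℂ) ^ i) =
      linkConst n ^ 2 * (vdm (2 * n) fun j => ∑ i ∈ Finset.range (expo j), (t : ℂ) ^ i) ^ 2 := by
  have h := link_vdPsi n (fun i => t ^ i) (pow_right_strictMono₀ ht).injective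
    fun i => pow_pos (by linarith) i
  have h2 := h.pairing_eq h
  simp only [Complex.ofReal_pow] at h2
  rw [vdPsi, pairing_smul_left, pairing_smul_right, linkSum, altn_geom, altn_geom, vdm_pow,
    vdm_pow] at h2
  have h0 : (∏ k ∈ Finset.range (2 * n), ((t : ℂ) - 1) ^ k) ≠ 0 :=
    Finset.prod_ne_zero_iff.mpr fun k _ => pow_ne_zero _
      (sub_ne_zero.mpr (by exact_mod_cast ht.ne'))
  apply mul_left_cancel₀ (pow_ne_zero 2 h0)
  simp only [id] at h2
  linear_combination h2

theorem pairing_psiVec_one (n : ℕ) :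
    (vdm (2 * n) fun j => (j : ℂ)) ^ 2 * pairing (2 * n) (psiVec n 1) (psiVec n 1) =
      linkConst n ^ 2 * (vdm (2 * n) fun j => (expo j : ℂ)) ^ 2 := by
  have hc : ∀ m : ℕ, Continuous fun t : ℝ => ∑ i ∈ Finset.range m, (t : ℂ) ^ i := fun m =>
    continuous_finsetSum _ fun i _ => Complex.continuous_ofReal.pow i
  have hpsi : ∀ s, Continuous fun t : ℝ => psiVec n (fun i => (t : ℂ) ^ i) s := fun s =>
    (continuous_psiVec n s).comp (continuous_pi fun i => Complex.continuous_ofReal.pow i)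
  have hl : Continuous fun t : ℝ =>
      (vdm (2 * n) fun j => ∑ i ∈ Finset.range j, (t : ℂ) ^ i) ^ 2 *
        pairing (2 * n) (psiVec n fun i => (t : ℂ) ^ i) (psiVec n fun i => (t : ℂ) ^ i) :=
    ((continuous_vdm _ fun j => hc j).pow 2).mul
      (continuous_sumL _ fun s => (hpsi s).mul (hpsi s))
  have hr : Continuous fun t : ℝ =>
      linkConst n ^ 2 * (vdm (2 * n) fun j => ∑ i ∈ Finset.range (expo j), (t : ℂ) ^ i) ^ 2 :=
    continuous_const.mul ((continuous_vdm _ fun j => hc (expo j)).pow 2)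
  have h := tendsto_nhds_unique_of_eventuallyEq
    ((hl.tendsto 1).mono_left (nhdsWithin_le_nhds (s := Set.Ioi 1)))
    ((hr.tendsto 1).mono_left nhdsWithin_le_nhds)
    (Filter.eventually_of_mem self_mem_nhdsWithin fun t ht => pairing_psiVec_geom n ht)
  have e1 : (fun _ : ℕ => (1 : ℂ)) = 1 := rfl
  simpa [e1] using h

theorem vdm_succ (N : ℕ) (f : ℕ → ℂ) :
    vdm (N + 1) f = vdm N f * ∏ j ∈ Finset.range N, (f N - f j) :=
  Finset.prod_range_succ _ _

theorem prod_natCast_sub (N : ℕ) : ∏ j ∈ Finset.range N, ((N : ℂ) - j) = (N.factorial : ℂ) := by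
  induction N with
  | zero => simp
  | succ N ih =>
    rw [Finset.prod_range_succ', Nat.factorial_succ, Nat.cast_mul, ← ih]
    push_cast
    simp only [add_sub_add_right_eq_sub]
    ring

theorem vdm_natCast_succ (n : ℕ) :
    vdm (2 * (n + 1)) (fun j => (j : ℂ)) =
      vdm (2 * n) (fun j => (j : ℂ)) * ((2 * n).factorial * (2 * n + 1).factorial) := by
  rw [show 2 * (n + 1) = 2 * n + 1 + 1 by ring, vdm_succ, vdm_succ, prod_natCast_sub,
    prod_natCast_sub, mul_assoc]

theorem prod_range_two_mul (n : ℕ) (f : ℕ → ℂ) :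
    ∏ j ∈ Finset.range (2 * n), f j = ∏ m ∈ Finset.range n, (f (2 * m) * f (2 * m + 1)) := by
  induction n with
  | zero => simp
  | succ n ih =>
    rw [show 2 * (n + 1) = 2 * n + 1 + 1 by ring, Finset.prod_range_succ, Finset.prod_range_succ,
      Finset.prod_range_succ, ih, mul_assoc]

theorem expo_two_mul (m : ℕ) : expo (2 * m) = 3 * m := by
  unfold expo
  omega

theorem expo_two_mul_add_one (m : ℕ) : expo (2 * m + 1) = 3 * m + 1 := by
  unfold expo
  omega

theorem prod_triple (n : ℕ) :
    ∏ m ∈ Finset.range n, ((3 * (n : ℂ) - 3 * m) * (3 * n - (3 * m + 1)) *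
      ((3 * n + 1 - 3 * m) * (3 * n + 1 - (3 * m + 1)))) =
      3 ^ n * n.factorial * (3 * n + 1).factorial := by
  induction n with
  | zero => simp
  | succ n ih =>
    rw [Finset.prod_range_succ', show 3 * (n + 1) + 1 = 3 * n + 1 + 1 + 1 + 1 by ring,
      Nat.factorial_succ (3 * n + 1 + 1 + 1), Nat.factorial_succ (3 * n + 1 + 1),
      Nat.factorial_succ (3 * n + 1), Nat.factorial_succ n]
    have : ∀ m : ℕ, ((3 * ((n + 1 : ℕ) : ℂ) - 3 * ((m + 1 : ℕ) : ℂ)) *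
        (3 * ((n + 1 : ℕ) : ℂ) - (3 * ((m + 1 : ℕ) : ℂ) + 1)) *
        ((3 * ((n + 1 : ℕ) : ℂ) + 1 - 3 * ((m + 1 : ℕ) : ℂ)) *
          (3 * ((n + 1 : ℕ) : ℂ) + 1 - (3 * ((m + 1 : ℕ) : ℂ) + 1)))) =
        (3 * (n : ℂ) - 3 * m) * (3 * n - (3 * m + 1)) *
          ((3 * n + 1 - 3 * m) * (3 * n + 1 - (3 * m + 1))) := fun m => by
      push_cast
      ring
    simp only [this, ih]
    push_cast
    ring

theorem vdm_expo_succ (n : ℕ) :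
    vdm (2 * (n + 1)) (fun j => (expo j : ℂ)) = vdm (2 * n) (fun j => (expo j : ℂ)) *
      (3 ^ n * n.factorial * (3 * n + 1).factorial) := by
  rw [show 2 * (n + 1) = 2 * n + 1 + 1 by ring, vdm_succ, vdm_succ, Finset.prod_range_succ,
    prod_range_two_mul, prod_range_two_mul, mul_assoc, ← mul_assoc (Finset.prod _ _),
    ← Finset.prod_mul_distrib, ← prod_triple]
  simp only [expo_two_mul, expo_two_mul_add_one]
  push_cast
  rw [add_sub_cancel_left, mul_one]

/-- The number of alternating sign matrices of size `n`. -/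
def asm (n : ℕ) : ℂ :=
  ∏ j ∈ Finset.range n, (((3 * j + 1).factorial : ℂ) / ((n + j).factorial : ℂ))

theorem asm_ne_zero (n : ℕ) : asm n ≠ 0 :=
  Finset.prod_ne_zero_iff.mpr fun j _ => div_ne_zero
    (by exact_mod_cast Nat.factorial_ne_zero _) (by exact_mod_cast Nat.factorial_ne_zero _)

theorem asm_succ (n : ℕ) :
    asm (n + 1) * ((2 * n).factorial * (2 * n + 1).factorial) =
      asm n * (n.factorial * (3 * n + 1).factorial) := by
  have hd : (∏ j ∈ Finset.range (n + 1), ((n + 1 + j).factorial : ℂ)) * n.factorial =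
      (∏ j ∈ Finset.range n, ((n + j).factorial : ℂ)) *
        ((2 * n).factorial * (2 * n + 1).factorial) := by
    have h1 := Finset.prod_range_succ' (fun j => ((n + j).factorial : ℂ)) (n + 1)
    rw [Finset.prod_range_succ, Finset.prod_range_succ] at h1
    simp only [← two_mul, ← add_assoc, add_zero] at h1
    simp only [add_right_comm n 1]
    rw [← h1, mul_assoc]
  have h0 : ∀ m k : ℕ, (∏ j ∈ Finset.range m, ((k + j).factorial : ℂ)) ≠ 0 := fun m k =>
    Finset.prod_ne_zero_iff.mpr fun j _ => by exact_mod_cast Nat.factorial_ne_zero _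
  rw [asm, asm, Finset.prod_div_distrib, Finset.prod_div_distrib, div_mul_eq_mul_div,
    div_mul_eq_mul_div, div_eq_div_iff (h0 _ _) (h0 _ _), Finset.prod_range_succ _ n]
  linear_combination -(∏ j ∈ Finset.range n, ((3 * j + 1).factorial : ℂ)) *
    (3 * n + 1).factorial * hd

theorem vdm_expo_eq (n : ℕ) :
    vdm (2 * n) (fun j => (expo j : ℂ)) =
      vdm (2 * n) (fun j => (j : ℂ)) * ((∏ k ∈ Finset.range n, 3 ^ k) * asm n) := by
  induction n with
  | zero => simp [vdm, asm]
  | succ n ih =>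
    rw [vdm_expo_succ, vdm_natCast_succ, ih, Finset.prod_range_succ]
    linear_combination -vdm (2 * n) (fun j => (j : ℂ)) * (∏ k ∈ Finset.range n, 3 ^ k) * 3 ^ n *
      asm_succ n

theorem vdm_natCast_ne_zero (N : ℕ) : vdm N (fun j => (j : ℂ)) ≠ 0 :=
  Finset.prod_ne_zero_iff.mpr fun _ _ => Finset.prod_ne_zero_iff.mpr fun _ hj =>
    sub_ne_zero.mpr (Nat.cast_injective.ne (Finset.mem_range.mp hj).ne')

theorem pairing_psiVec_one_eq (n : ℕ) :
    pairing (2 * n) (psiVec n 1) (psiVec n 1) =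
      (linkConst n * (∏ k ∈ Finset.range n, 3 ^ k) * asm n) ^ 2 := by
  apply mul_left_cancel₀ (pow_ne_zero 2 (vdm_natCast_ne_zero (2 * n)))
  rw [pairing_psiVec_one, vdm_expo_eq]
  ring

theorem omega3_ne_one_sub : (1 : ℂ) - omega3 ≠ 0 := sub_ne_zero.mpr omega3_ne_one.symm

/-- The basis configuration `↑ⁿ↓ⁿ`. -/
def wall (n : ℕ) : List Bool := List.replicate n true ++ List.replicate n false

theorem psiVec_one_wall (n : ℕ) :
    psiVec n 1 (wall n) = (∏ k ∈ Finset.range n, (1 - omega3) ^ k) ^ 2 := by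
  rw [psiVec, wall, psi_sorted, eval_gpoly]
  simp [tri, sq]

theorem psiVec_one_wall_ne_zero (n : ℕ) : psiVec n 1 (wall n) ≠ 0 := by
  rw [psiVec_one_wall]
  exact pow_ne_zero 2 (Finset.prod_ne_zero_iff.mpr fun k _ => pow_ne_zero _ omega3_ne_one_sub)

theorem linkConst_sq_mul (n : ℕ) :
    (-omega3) ^ n * (linkConst n * ∏ k ∈ Finset.range n, 3 ^ k) ^ 2 = psiVec n 1 (wall n) ^ 2 := by
  rw [psiVec_one_wall, ← pow_mul, linkConst, ← Finset.prod_mul_distrib, ← Finset.prod_pow,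
    ← Finset.prod_pow, ← Finset.card_range n, ← Finset.prod_const, Finset.card_range,
    ← Finset.prod_mul_distrib]
  refine Finset.prod_congr rfl fun k _ => ?_
  have h : (1 - omega3) ^ 4 = (3 * -omega3) ^ 2 := by
    linear_combination ((1 - omega3) ^ 2 - 3 * omega3) * omega3_sq_add
  rw [← pow_mul, mul_comm k, pow_mul, h, mul_pow, mul_pow, cupB_sq, ← pow_mul, ← pow_mul,
    ← pow_mul, mul_comm 2 k, mul_pow]
  linear_combination (-omega3) ^ (k * 2) * 3 ^ (k * 2) * omega3_cube

theorem psiVec_one_wall_sq (n : ℕ) :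
    psiVec n 1 (wall n) ^ 2 * asm n ^ 2 =
      (-omega3) ^ n * pairing (2 * n) (psiVec n 1) (psiVec n 1) := by
  rw [pairing_psiVec_one_eq, ← linkConst_sq_mul]
  ring

/-! ### The Hamiltonian in terms of cups -/

theorem localOp_mulVec {N : ℕ} (i : Fin N) (A : Matrix Bool Bool ℂ) (w : Cfg N → ℂ) (c : Cfg N) :
    (localOp N i A).mulVec w c = ∑ b, A (c i) b * w (Function.update c i b) := by
  have h : ∀ g : Cfg N, localOp N i A c g =
      ∑ b, if g = Function.update c i b then A (c i) b else 0 := by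
    intro g
    rw [localOp, Matrix.of_apply, Finset.prod_ite_zero, Finset.prod_const_one]
    by_cases hg : ∀ j ∈ Finset.univ.erase i, c j = g j
    · rw [if_pos hg, mul_one, Finset.sum_eq_single (g i)]
      · rw [if_pos]
        funext j
        by_cases hj : j = i
        · rw [hj, Function.update_self]
        · rw [Function.update_of_ne hj, hg j (by simp [hj])]
      · intro b _ hb
        rw [if_neg]
        rintro rfl
        exact hb (Function.update_self i b c).symm
      · simp
    · rw [if_neg hg, mul_zero, Finset.sum_eq_zero]
      intro b _
      rw [if_neg]
      rintro rfl
      exact hg fun j hj => (Function.update_of_ne (Finset.ne_of_mem_erase hj) ..).symm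
  simp only [Matrix.mulVec, dotProduct, h, Finset.sum_mul, ite_mul, zero_mul]
  rw [Finset.sum_comm]
  simp

theorem localOp_mul_mulVec {N : ℕ} {i j : Fin N} (hij : i ≠ j) (A B : Matrix Bool Bool ℂ)
    (w : Cfg N → ℂ) (c : Cfg N) :
    (localOp N i A * localOp N j B).mulVec w c =
      ∑ b, ∑ b', A (c i) b * (B (c j) b' * w (Function.update (Function.update c i b) j b')) := by
  rw [← Matrix.mulVec_mulVec, localOp_mulVec]
  simp only [localOp_mulVec, Function.update_of_ne hij.symm, Finset.mul_sum]

theorem localOp_mul_comm {N : ℕ} {i j : Fin N} (hij : i ≠ j) (A B : Matrix Bool Bool ℂ) :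
    localOp N i A * localOp N j B = localOp N j B * localOp N i A := by
  apply Matrix.toLin'.injective
  refine LinearMap.ext fun w => funext fun c => ?_
  rw [Matrix.toLin'_apply, Matrix.toLin'_apply, localOp_mul_mulVec hij,
    localOp_mul_mulVec hij.symm, Finset.sum_comm]
  refine Finset.sum_congr rfl fun b _ => Finset.sum_congr rfl fun b' _ => ?_
  rw [Function.update_comm hij]
  ring

theorem localOp_conjTranspose {N : ℕ} (i : Fin N) (A : Matrix Bool Bool ℂ) :
    (localOp N i A).conjTranspose = localOp N i A.conjTranspose := by
  ext f g
  simp only [localOp, Matrix.conjTranspose_apply, Matrix.of_apply, star_mul', star_prod,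
    apply_ite star, star_one, star_zero, eq_comm]

theorem localOp_mul_conjTranspose {N : ℕ} {i j : Fin N} (hij : i ≠ j)
    (A B : Matrix Bool Bool ℂ) :
    (localOp N i A * localOp N j B).conjTranspose =
      localOp N i A.conjTranspose * localOp N j B.conjTranspose := by
  rw [Matrix.conjTranspose_mul, localOp_conjTranspose, localOp_conjTranspose,
    localOp_mul_comm hij]

theorem sigmaX_conjTranspose : sigmaX.conjTranspose = sigmaX := by
  ext b c
  cases b <;> cases c <;> simp [sigmaX]

theorem sigmaY_conjTranspose : sigmaY.conjTranspose = sigmaY := by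
  ext b c
  cases b <;> cases c <;> simp [sigmaY]

theorem sigmaZ_conjTranspose : sigmaZ.conjTranspose = sigmaZ := by
  ext b c
  cases b <;> cases c <;> simp [sigmaZ]

theorem sigmaP_conjTranspose : sigmaP.conjTranspose = sigmaM := by
  rw [sigmaP, Matrix.conjTranspose_add, Matrix.conjTranspose_smul, sigmaX_conjTranspose,
    sigmaY_conjTranspose, sigmaM]
  simp [sub_eq_add_neg]

theorem sigmaM_conjTranspose : sigmaM.conjTranspose = sigmaP := by
  rw [← sigmaP_conjTranspose, Matrix.conjTranspose_conjTranspose]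

theorem exp_neg_eq : Complex.exp (-(2 * Real.pi * Complex.I / 3)) = omega3 ^ 2 := by
  rw [Complex.exp_neg]
  exact inv_eq_of_mul_eq_one_right (a := omega3) (by linear_combination omega3_cube)

theorem Htw_isHermitian (N : ℕ) (hN : 2 ≤ N) :
    (Htw N (by omega)).conjTranspose = Htw N (by omega) := by
  have h1 : star omega3 = omega3 ^ 2 := conj_omega3
  have h2 : star (omega3 ^ 2) = omega3 := by rw [← h1, star_star]
  have h0 : star (1 / 2 : ℂ) = 1 / 2 := by simp
  have h3 : star (-(1 / 2) : ℂ) = -(1 / 2) := by simp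
  have hl : (⟨N - 1, by omega⟩ : Fin N) ≠ ⟨0, by omega⟩ := by
    simp only [ne_eq, Fin.mk.injEq]
    omega
  have hb : ∀ i : Fin (N - 1), (⟨i, by omega⟩ : Fin N) ≠ ⟨i + 1, by omega⟩ := fun i => by
    simp
  simp only [Htw, exp_neg_eq, Matrix.conjTranspose_smul, Matrix.conjTranspose_add,
    Matrix.conjTranspose_sub, Matrix.conjTranspose_sum, h0, h1, h2, h3,
    localOp_mul_conjTranspose hl, localOp_mul_conjTranspose (hb _), sigmaX_conjTranspose,
    sigmaY_conjTranspose, sigmaZ_conjTranspose, sigmaP_conjTranspose, sigmaM_conjTranspose]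
  rw [add_comm (omega3 ^ 2 • _)]

/-- The eigenvalue of `σ^z`. -/
def sgn (b : Bool) : ℂ := if b then 1 else -1

theorem localOp_sigmaZ_mulVec {N : ℕ} (i : Fin N) (w : Cfg N → ℂ) (c : Cfg N) :
    (localOp N i sigmaZ).mulVec w c = sgn (c i) * w c := by
  rw [localOp_mulVec, Finset.sum_eq_single (c i)]
  · simp [sigmaZ, sgn]
  · intro b _ hb
    simp [sigmaZ, hb.symm]
  · simp

/-- The local weight of the pair of sites `(i, j)`. -/
def cupAt {N : ℕ} (i j : Fin N) (w : Cfg N → ℂ) (c : Cfg N) : ℂ :=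
  cup (c i) (c j) * (cupA * w (Function.update (Function.update c i true) j false) +
    cupB * w (Function.update (Function.update c i false) j true))

theorem bond_mulVec {N : ℕ} {i j : Fin N} (hij : i ≠ j) (w : Cfg N → ℂ) (c : Cfg N) :
    (localOp N i sigmaX * localOp N j sigmaX + localOp N i sigmaY * localOp N j sigmaY -
      (1 / 2 : ℂ) • (localOp N i sigmaZ * localOp N j sigmaZ)).mulVec w c =
      2 * cupAt i j w c - (1 / 2) * w c + (omega3 + 1 / 2) * (sgn (c i) - sgn (c j)) * w c := by
  simp only [Matrix.sub_mulVec, Matrix.add_mulVec, Matrix.smul_mulVec, Pi.add_apply,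
    Pi.sub_apply, Pi.smul_apply, localOp_mul_mulVec hij, Fintype.sum_bool, smul_eq_mul, cupAt]
  have hw : w c = w (Function.update (Function.update c i (c i)) j (c j)) := by simp
  rw [hw]
  have h1 := cupA_sq
  have h2 := cupB_sq
  have h3 := cupA_mul_cupB
  generalize c i = x
  generalize c j = y
  cases x <;> cases y <;> simp [sigmaX, sigmaY, sigmaZ, cup, sgn]
  · linear_combination w (Function.update (Function.update c i true) j true) * Complex.I_sq
  · linear_combination -2 * w (Function.update (Function.update c i false) j true) *
        (h2 - omega3_sq_add) -
      2 * w (Function.update (Function.update c i true) j false) * h3 -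
      w (Function.update (Function.update c i true) j false) * Complex.I_sq
  · linear_combination -2 * w (Function.update (Function.update c i true) j false) * h1 -
      2 * w (Function.update (Function.update c i false) j true) * h3 -
      w (Function.update (Function.update c i false) j true) * Complex.I_sq
  · linear_combination w (Function.update (Function.update c i false) j false) * Complex.I_sq

theorem wrap_mulVec {N : ℕ} {i j : Fin N} (hij : i ≠ j) (w : Cfg N → ℂ) (c : Cfg N) :
    ((1 / 2 : ℂ) • (omega3 • (localOp N i sigmaP * localOp N j sigmaM) +
      omega3 ^ 2 • (localOp N i sigmaM * localOp N j sigmaP)) -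
      (1 / 2 : ℂ) • (localOp N i sigmaZ * localOp N j sigmaZ)).mulVec w c =
      2 * (ph (c j) * cup (c i) (c j) *
        (cupA * ((ph false)⁻¹ * w (Function.update (Function.update c i true) j false)) +
        cupB * ((ph true)⁻¹ * w (Function.update (Function.update c i false) j true)))) -
        (1 / 2) * w c + (omega3 + 1 / 2) * (sgn (c i) - sgn (c j)) * w c := by
  simp only [Matrix.sub_mulVec, Matrix.add_mulVec, Matrix.smul_mulVec, Pi.add_apply,
    Pi.sub_apply, Pi.smul_apply, localOp_mul_mulVec hij, Fintype.sum_bool, smul_eq_mul]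
  have hw : w c = w (Function.update (Function.update c i (c i)) j (c j)) := by simp
  rw [hw]
  have h1 := cupA_sq
  have h2 := cupB_sq
  have h3 := cupA_mul_cupB
  have h4 : omega3⁻¹ = omega3 ^ 2 :=
    inv_eq_of_mul_eq_one_right (by linear_combination omega3_cube)
  have h7 : (-omega3)⁻¹ = -omega3 ^ 2 := by rw [inv_neg, h4]
  have h8 : (-omega3 ^ 2)⁻¹ = -omega3 := by rw [← h4, inv_neg, inv_inv]
  generalize c i = x
  generalize c j = y
  cases x <;> cases y <;>
    simp [sigmaP, sigmaM, sigmaX, sigmaY, sigmaZ, cup, sgn, ph, -inv_neg, h7, h8]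
  · linear_combination
      -2 * omega3 ^ 2 * w (Function.update (Function.update c i true) j false) * h3 +
      2 * w (Function.update (Function.update c i false) j true) *
        (omega3 ^ 2 * omega3_cube + omega3_sq_add - omega3 ^ 3 * h2)
  · linear_combination
      -2 * w (Function.update (Function.update c i false) j true) *
        (omega3 ^ 4 * h3 + omega3 * omega3_cube) +
      2 * w (Function.update (Function.update c i true) j false) *
        (omega3 * omega3_cube - omega3 ^ 3 * h1)

theorem ofFn_update {N : ℕ} (c : Cfg N) (i : Fin N) (b : Bool) :
    List.ofFn (Function.update c i b) = (List.ofFn c).set i b := by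
  refine List.ext_getElem (by simp) fun k hk hk' => ?_
  rw [List.getElem_ofFn, List.getElem_set, List.getElem_ofFn]
  split_ifs with h
  · subst h
    simp
  · exact Function.update_of_ne (fun e => h (by rw [← e])) ..

theorem gen_ofFn {N i : ℕ} (h1 : i < N) (h2 : i + 1 < N) (v : LVec) (c : Cfg N) :
    gen i v (List.ofFn c) = cupAt ⟨i, h1⟩ ⟨i + 1, h2⟩ (fun c => v (List.ofFn c)) c := by
  obtain ⟨l, x, y, r, hs, rfl⟩ := exists_split_two i (List.ofFn c) (by simp; omega)
  have hx : c ⟨l.length, h1⟩ = x := by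
    have : (List.ofFn c)[l.length]? = some x := by rw [hs]; simp
    simpa [h1] using this
  have hy : c ⟨l.length + 1, h2⟩ = y := by
    have : (List.ofFn c)[l.length + 1]? = some y := by rw [hs]; simp
    simpa [h2] using this
  rw [cupAt, ofFn_update, ofFn_update, ofFn_update, ofFn_update, hx, hy, hs, gen,
    ins_length_append, con_length_append]
  simp

theorem genWrap_ofFn {N : ℕ} (v : LVec) (c : Cfg (N + 2)) :
    genWrap (N + 2) v (List.ofFn c) =
      ph (c 0) * cup (c (Fin.last _)) (c 0) *
        (cupA * ((ph false)⁻¹ *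
          v (List.ofFn (Function.update (Function.update c (Fin.last _) true) 0 false))) +
        cupB * ((ph true)⁻¹ *
          v (List.ofFn (Function.update (Function.update c (Fin.last _) false) 0 true)))) := by
  obtain ⟨m, hm, rfl⟩ : ∃ m : List Bool,
      List.ofFn c = c 0 :: (m ++ [c (Fin.last _)]) ∧ m.length = N :=
    ⟨List.ofFn fun i : Fin N => c i.succ.castSucc, by
      rw [List.ofFn_succ, List.ofFn_succ_last]; simp, by simp⟩
  rw [ofFn_update, ofFn_update, ofFn_update, ofFn_update, hm]
  generalize c (Fin.last _) = y
  generalize c 0 = x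
  rw [genWrap, rot_cons, gen, Nat.add_sub_cancel, List.append_assoc, List.singleton_append,
    ins_length_append, con_length_append]
  rw [List.append_cons m true, List.append_cons m false, unrot_append, unrot_append]
  simp
  ring

theorem Htw_mulVec {N : ℕ} (v : LVec) (c : Cfg (N + 2)) :
    (Htw (N + 2) (by omega)).mulVec (fun c => v (List.ofFn c)) c =
      ((N + 2 : ℕ) / 4 : ℂ) * v (List.ofFn c) -
        (∑ j ∈ Finset.range (N + 1), gen j v (List.ofFn c) +
          genWrap (N + 2) v (List.ofFn c)) := by
  have hb : ∀ i : Fin (N + 1), (⟨i, by omega⟩ : Fin (N + 2)) ≠ ⟨i + 1, by omega⟩ := fun i => by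
    simp
  have hl : (Fin.last (N + 1)) ≠ 0 := (Fin.last_pos).ne'
  have ht : ∑ i : Fin (N + 1), sgn (c ⟨i, by omega⟩) -
      ∑ i : Fin (N + 1), sgn (c ⟨i + 1, by omega⟩) =
      sgn (c 0) - sgn (c (Fin.last _)) := by
    have h1 := Fin.sum_univ_succ fun i => sgn (c i)
    rw [Fin.sum_univ_castSucc] at h1
    rw [sub_eq_sub_iff_add_eq_add]
    exact h1
  have hw := wrap_mulVec hl (fun c => v (List.ofFn c)) c
  have hs : ∀ i : Fin (N + 1), gen i v (List.ofFn c) =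
      cupAt ⟨i, by omega⟩ ⟨i + 1, by omega⟩ (fun c => v (List.ofFn c)) c := fun i =>
    gen_ofFn (by omega) (by omega) v c
  rw [Finset.sum_range]
  simp only [hs]
  rw [genWrap_ofFn]
  rw [Htw, exp_neg_eq, add_sub_assoc]
  rw [Matrix.smul_mulVec, Matrix.add_mulVec, Pi.smul_apply, Pi.add_apply,
    Matrix.sum_mulVec, Finset.sum_apply]
  have hbond : ∀ i : Fin (N + 1), _ := fun i => bond_mulVec (hb i) (fun c => v (List.ofFn c)) c
  erw [hw, Finset.sum_congr rfl fun i _ => hbond i]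
  simp only [Finset.sum_add_distrib, Finset.sum_sub_distrib, ← Finset.mul_sum, ← Finset.sum_mul]
  rw [ht, Finset.sum_const, Finset.card_univ, Fintype.card_fin, nsmul_eq_mul, smul_eq_mul]
  push_cast
  ring

/-! ### Eigenvectors of the Hamiltonian -/

theorem sumL_eq_sum (N : ℕ) (f : List Bool → ℂ) : sumL N f = ∑ c : Cfg N, f (List.ofFn c) := by
  induction N generalizing f with
  | zero => simp [sumL]
  | succ N ih =>
    rw [← (Fin.consEquiv fun _ : Fin (N + 1) => Bool).sum_comp, Fintype.sum_prod_type,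
      Fintype.sum_bool, sumL, ih, ih]
    simp [Fin.consEquiv, List.ofFn_succ]

theorem sum_sgn (N : ℕ) (c : Cfg N) :
    ∑ i, sgn (c i) = ((List.ofFn c).count true : ℂ) - (List.ofFn c).count false := by
  induction N with
  | zero => simp
  | succ N ih =>
    rw [Fin.sum_univ_succ, ih, List.ofFn_succ, List.count_cons, List.count_cons]
    cases c 0 <;> simp [sgn] <;> ring

theorem eq_zero_of_Sz {N : ℕ} {Ψ : Cfg N → ℂ} (h : (Sz N).mulVec Ψ = 0) {c : Cfg N}
    (hc : ¬ Bal (List.ofFn c)) : Ψ c = 0 := by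
  have h1 := congrFun h c
  simp only [Sz, Matrix.smul_mulVec, Matrix.sum_mulVec, Pi.smul_apply, Finset.sum_apply,
    localOp_sigmaZ_mulVec, ← Finset.sum_mul, sum_sgn, Pi.zero_apply, smul_eq_mul, mul_eq_zero] at h1
  rcases h1 with h1 | h1 | h1
  · norm_num at h1
  · exact absurd (by exact_mod_cast sub_eq_zero.mp h1) hc
  · exact h1

/-- The Hermitian pairing of a vector on configurations with a vector on lists. -/
def herm {N : ℕ} (Φ : Cfg N → ℂ) (v : LVec) : ℂ := ∑ c, star (Φ c) * v (List.ofFn c)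

theorem herm_add {N : ℕ} (Φ : Cfg N → ℂ) (v w : LVec) :
    herm Φ (v + w) = herm Φ v + herm Φ w := by
  simp only [herm, Pi.add_apply, mul_add, Finset.sum_add_distrib]

theorem herm_smul {N : ℕ} (Φ : Cfg N → ℂ) (u : ℂ) (v : LVec) :
    herm Φ (u • v) = u * herm Φ v := by
  simp only [herm, Pi.smul_apply, smul_eq_mul, Finset.mul_sum]
  exact Finset.sum_congr rfl fun c _ => by ring

theorem herm_sum {N : ℕ} (Φ : Cfg N → ℂ) (s : Finset ℕ) (v : ℕ → LVec) :
    herm Φ (∑ j ∈ s, v j) = ∑ j ∈ s, herm Φ (v j) := by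
  simp only [herm, Finset.sum_apply, Finset.mul_sum]
  exact Finset.sum_comm

theorem herm_eigen {N : ℕ} {Φ : Cfg (N + 2) → ℂ} {E : ℝ}
    (h : (Htw (N + 2) (by omega)).mulVec Φ = (E : ℂ) • Φ) (v : LVec) :
    ((((N + 2 : ℕ) / 4 - E : ℝ)) : ℂ) * herm Φ v =
      ∑ j ∈ Finset.range (N + 1), herm Φ (gen j v) + herm Φ (genWrap (N + 2) v) := by
  have h1 : herm Φ (∑ j ∈ Finset.range (N + 1), gen j v + genWrap (N + 2) v) =
      ∑ c, star (Φ c) * (((N + 2 : ℕ) / 4 : ℂ) * v (List.ofFn c) -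
        (Htw (N + 2) (by omega)).mulVec (fun c => v (List.ofFn c)) c) := by
    refine Finset.sum_congr rfl fun c _ => ?_
    rw [Htw_mulVec, sub_sub_cancel, Pi.add_apply, Finset.sum_apply]
  have h2 : ∑ c, star (Φ c) * (Htw (N + 2) (by omega)).mulVec (fun c => v (List.ofFn c)) c =
      E * herm Φ v := by
    change star Φ ⬝ᵥ _ = _
    rw [Matrix.dotProduct_mulVec, ← Htw_isHermitian (N + 2) (by omega), ← Matrix.star_mulVec, h,
      herm, Finset.mul_sum]
    refine Finset.sum_congr rfl fun c _ => ?_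
    simp [mul_assoc]
  rw [← herm_sum, ← herm_add, h1]
  simp only [mul_sub, Finset.sum_sub_distrib, mul_left_comm _ (_ / _ : ℂ), ← Finset.mul_sum]
  rw [h2, ← herm]
  push_cast
  ring

theorem herm_cups_ne_zero {k : ℕ} {Φ : Cfg (2 * (k + 1)) → ℂ} {E : ℝ}
    (h : (Htw (2 * (k + 1)) (by omega)).mulVec Φ = (E : ℂ) • Φ)
    (hE : (2 * (k + 1) : ℕ) ≤ ((2 * (k + 1) : ℕ) : ℝ) / 4 - E)
    (hb : ∀ c, ¬ Bal (List.ofFn c) → Φ c = 0) (h0 : Φ ≠ 0) :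
    ((2 * (k + 1) : ℕ) : ℝ) / 4 - E = (2 * (k + 1) : ℕ) ∧ herm Φ (cups (k + 1)) ≠ 0 := by
  obtain ⟨c, hc⟩ := Function.ne_iff.mp h0
  rw [Pi.zero_apply] at hc
  refine cups_pairing_ne_zero (herm Φ) (by simp [herm]) (fun u v hu => ?_) _ hE
    (fun v _ => herm_eigen h v) (single 1 (List.ofFn c))
    (Dia.single _ _ _ List.length_ofFn (not_not.mp fun hn => hc (hb c hn)) (one_pow _)) ?_
  · rw [herm_smul, norm_mul, Complex.norm_eq_one_of_pow_eq_one hu (by norm_num), one_mul]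
  · rw [herm, Finset.sum_eq_single c]
    · simpa [single] using hc
    · intro b _ hbc
      rw [single, if_neg fun e => hbc (List.ofFn_injective e), mul_zero]
    · simp

/-- The solution at the homogeneous point as a vector on configurations. -/
def homPsi (n : ℕ) (c : Cfg (2 * n)) : ℂ := psiVec n 1 (List.ofFn c)

theorem ofFn_wall (n : ℕ) :
    (List.ofFn fun i : Fin (2 * n) => decide (i.val < n)) = wall n := by
  refine List.ext_getElem (by simp [wall]; omega) fun k hk hk' => ?_
  rw [List.getElem_ofFn]
  simp only [wall, List.getElem_append, List.length_replicate, List.getElem_replicate]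
  split_ifs with h <;> simp [h]

theorem homPsi_ne_zero (n : ℕ) : homPsi n ≠ 0 := by
  intro h
  have := congrFun h fun i => decide (i.val < n)
  rw [homPsi, ofFn_wall] at this
  exact psiVec_one_wall_ne_zero n this

theorem homPsi_eigen (k : ℕ) :
    (Htw (2 * (k + 1)) (by omega)).mulVec (homPsi (k + 1)) =
      ((-(3 / 4) * (2 * (k + 1) : ℕ) : ℝ) : ℂ) • homPsi (k + 1) := by
  funext c
  have h := sum_gen_psiVec_one (n := k + 1) (by omega) (List.ofFn c) List.length_ofFn
  refine (Htw_mulVec (N := 2 * k) (psiVec (k + 1) 1) c).trans ?_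
  rw [show 2 * k + 1 = 2 * (k + 1) - 1 by omega]
  erw [h]
  simp only [Pi.smul_apply, homPsi, smul_eq_mul]
  push_cast
  ring

theorem homPsi_of_not_bal {n : ℕ} {c : Cfg (2 * n)} (hc : ¬ Bal (List.ofFn c)) :
    homPsi n c = 0 := by
  rw [homPsi, psiVec, psi, if_neg, map_zero]
  rintro ⟨h1, h2⟩
  exact hc (h1.trans h2.symm)

theorem eq_smul_homPsi {k : ℕ} {Ψ : Cfg (2 * (k + 1)) → ℂ} (hΨ : Ψ ≠ 0) {E : ℝ}
    (h : (Htw (2 * (k + 1)) (by omega)).mulVec Ψ = (E : ℂ) • Ψ)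
    (hE : E ≤ -(3 / 4) * (2 * (k + 1) : ℕ))
    (hb : ∀ c, ¬ Bal (List.ofFn c) → Ψ c = 0) :
    ∃ a : ℂ, a ≠ 0 ∧ Ψ = a • homPsi (k + 1) := by
  obtain ⟨h1, h2⟩ := herm_cups_ne_zero h (by linarith) hb hΨ
  have hE' : E = -(3 / 4) * (2 * (k + 1) : ℕ) := by linarith
  subst hE'
  obtain ⟨-, h3⟩ := herm_cups_ne_zero (homPsi_eigen k) (by linarith)
    (fun c => homPsi_of_not_bal) (homPsi_ne_zero (k + 1))
  set a := star (herm Ψ (cups (k + 1))) with ha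
  set b := star (herm (homPsi (k + 1)) (cups (k + 1))) with hb'
  have hb0 : b ≠ 0 := by simpa [hb'] using h3
  have ha0 : a ≠ 0 := by simpa [ha] using h2
  have hz : b • Ψ - a • homPsi (k + 1) = 0 := by
    by_contra hne
    refine (herm_cups_ne_zero (Φ := b • Ψ - a • homPsi (k + 1)) ?_ (le_of_eq h1.symm) ?_ hne).2 ?_
    · rw [Matrix.mulVec_sub, Matrix.mulVec_smul, Matrix.mulVec_smul, h, homPsi_eigen, smul_sub,
        smul_comm, smul_comm a]
    · intro c hc
      simp [hb c hc, homPsi_of_not_bal hc]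
    · have : herm (b • Ψ - a • homPsi (k + 1)) (cups (k + 1)) =
          star b * herm Ψ (cups (k + 1)) -
            star a * herm (homPsi (k + 1)) (cups (k + 1)) := by
        simp only [herm, Pi.sub_apply, Pi.smul_apply, smul_eq_mul, star_sub, star_mul', sub_mul,
          Finset.sum_sub_distrib, Finset.mul_sum, mul_assoc]
      rw [this, ha, hb', star_star, star_star]
      ring
  refine ⟨b⁻¹ * a, mul_ne_zero (inv_ne_zero hb0) ha0, ?_⟩
  rw [mul_smul, ← sub_eq_zero.mp hz, smul_smul, inv_mul_cancel₀ hb0, one_smul]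

theorem pUp_mulVec {N : ℕ} (i : Fin N) (w : Cfg N → ℂ) (c : Cfg N) :
    (pUp N i).mulVec w c = if c i then w c else 0 := by
  rw [pUp, Matrix.smul_mulVec, Matrix.add_mulVec, Matrix.one_mulVec, Pi.smul_apply, Pi.add_apply,
    localOp_sigmaZ_mulVec, smul_eq_mul]
  cases c i <;> simp [sgn]
  ring

theorem prod_pUp_mulVec {N : ℕ} (l : List (Fin N)) (w : Cfg N → ℂ) (c : Cfg N) :
    ((l.map (pUp N)).prod).mulVec w c = if ∀ i ∈ l, c i = true then w c else 0 := by
  induction l with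
  | nil => simp
  | cons i l ih =>
    rw [List.map_cons, List.prod_cons, ← Matrix.mulVec_mulVec, pUp_mulVec, ih]
    cases hc : c i <;> simp [hc]

theorem eq_wall {n : ℕ} {c : Cfg (2 * n)} (hb : Bal (List.ofFn c))
    (hc : ∀ i : Fin (2 * n), i.val < n → c i = true) : List.ofFn c = wall n := by
  have ht : (List.ofFn c).take n = List.replicate n true := by
    refine List.eq_replicate_iff.mpr ⟨by simp; omega, fun b hb => ?_⟩
    obtain ⟨i, hi, rfl⟩ := List.getElem_of_mem hb
    rw [List.getElem_take, List.getElem_ofFn]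
    exact hc _ (by simp at hi; exact hi.1)
  have hs := List.take_append_drop n (List.ofFn c)
  have hl : ((List.ofFn c).drop n).length = n := by simp; omega
  have hcount := List.count_true_add_count_false ((List.ofFn c).drop n)
  rw [Bal, ← hs, ht, List.count_append, List.count_append] at hb
  simp only [List.count_replicate] at hb
  have h0 : ((List.ofFn c).drop n).count true = 0 := by
    simp at hb
    omega
  rw [← hs, ht, wall]
  congr 1
  refine List.eq_replicate_iff.mpr ⟨hl, fun b hb => ?_⟩
  cases b
  · rfl
  · exact absurd hb (List.count_eq_zero.mp h0)

theorem bilin_projProd (n : ℕ) :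
    bilin (homPsi n) ((projProd (2 * n) n).mulVec (homPsi n)) = psiVec n 1 (wall n) ^ 2 := by
  rw [bilin, Finset.sum_eq_single fun i => decide (i.val < n)]
  · rw [projProd, prod_pUp_mulVec, if_pos (by simp), homPsi, ofFn_wall, sq]
  · intro c _ hc
    rw [projProd, prod_pUp_mulVec]
    by_cases hb : Bal (List.ofFn c)
    · rw [if_neg, mul_zero]
      intro h
      refine hc (List.ofFn_injective ((eq_wall hb fun i hi => h i ?_).trans (ofFn_wall n).symm))
      simpa using hi
    · rw [homPsi_of_not_bal hb, zero_mul]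
  · simp

theorem bilin_homPsi (n : ℕ) :
    bilin (homPsi n) (homPsi n) = pairing (2 * n) (psiVec n 1) (psiVec n 1) := by
  rw [pairing, sumL_eq_sum]
  rfl

theorem pseudoEFP_smul {N : ℕ} (a : ℂ) (ha : a ≠ 0) (Ψ : Cfg N → ℂ) (k : ℕ) :
    pseudoEFP (a • Ψ) k = pseudoEFP Ψ k := by
  have h : ∀ v w : Cfg N → ℂ, bilin (a • v) (a • w) = a ^ 2 * bilin v w := fun v w => by
    simp only [bilin, Finset.mul_sum, Pi.smul_apply, smul_eq_mul]
    exact Finset.sum_congr rfl fun c _ => by ring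
  rw [pseudoEFP, Matrix.mulVec_smul, h, h, mul_div_mul_left _ _ (pow_ne_zero 2 ha), pseudoEFP]

theorem pseudoEFP_homPsi (n : ℕ) : pseudoEFP (homPsi n) n = (-omega3) ^ n * (asm n ^ 2)⁻¹ := by
  have h := psiVec_one_wall_sq n
  have h0 : pairing (2 * n) (psiVec n 1) (psiVec n 1) ≠ 0 := fun h0 => by
    rw [h0, mul_zero] at h
    exact mul_ne_zero (pow_ne_zero 2 (psiVec_one_wall_ne_zero n)) (pow_ne_zero 2 (asm_ne_zero n)) h
  rw [pseudoEFP, bilin_projProd, bilin_homPsi, div_eq_iff h0, mul_right_comm, ← h,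
    mul_inv_cancel_right₀ (pow_ne_zero 2 (asm_ne_zero n))]

theorem pseudoEFP_half_chain (n : ℕ) (hn : 1 ≤ n)
    (Ψ : Cfg (2*n) → ℂ) (hΨ : Ψ ≠ 0) (E₀ : ℝ)
    (hground : (Htw (2*n) (by omega)).mulVec Ψ = (E₀ : ℂ) • Ψ)
    (hmin : ∀ (E : ℂ) (v : Cfg (2*n) → ℂ), v ≠ 0 →
      (Htw (2*n) (by omega)).mulVec v = E • v → E₀ ≤ E.re)
    (hSz : (Sz (2*n)).mulVec Ψ = 0) :
    pseudoEFP Ψ n =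
      (-omega3)^n *
        ((∏ j ∈ Finset.range n, (((3*j+1).factorial : ℂ) / ((n+j).factorial : ℂ)))^2)⁻¹ := by
  obtain ⟨k, rfl⟩ : ∃ k, n = k + 1 := ⟨n - 1, by omega⟩
  have hE := hmin _ _ (homPsi_ne_zero (k + 1)) (homPsi_eigen k)
  rw [Complex.ofReal_re] at hE
  obtain ⟨a, ha, rfl⟩ := eq_smul_homPsi hΨ hground hE fun c => eq_zero_of_Sz hSz
  rw [pseudoEFP_smul a ha, pseudoEFP_homPsi, asm]
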